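/- Fix n ≥ 3. The sequence M_2 →(δ_2) M_1 →(δ_1) M_0 is exact at M_1; that is, the kernel of δ_1 equals the image of δ_2 (in particular δ_1 ∘ δ_2 = 0 and both maps are well defined on the quotients). -/

import Mathlib

open scoped Classical

/-- The vectors `v x`, for `x ∈ s`, form a `ℤ`-basis of `ℤ^n`: they are linearly
independent and span `ℤ^n`. -/
def IsBasisOn {n : ℕ} {ι : Type} (v : ι → (Fin n → ℤ)) (s : Set ι) : Prop :=
  LinearIndependent ℤ (s.restrict v) ∧ Submodule.span ℤ (v '' s) = ⊤

/-- Generators of `M₀`: ordered bases `(v 0, …, v (n-1))` of `ℤ^n`. -/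
def Gen0 (n : ℕ) (v : Fin n → (Fin n → ℤ)) : Prop :=
  IsBasisOn v Set.univ

/-- Generators of `M₁`: tuples `(v 0, …, v n)` for which there are indices
`i, j, k` such that deleting `v i` leaves a basis of `ℤ^n` and
`v i = ± v j ± v k` or `v i = ± v j ± v k ± v l` for some `l ∉ {i, j, k}`. -/
def Gen1 (n : ℕ) (v : Fin (n + 1) → (Fin n → ℤ)) : Prop :=
  ∃ i j k : Fin (n + 1), i ≠ j ∧ i ≠ k ∧ j ≠ k ∧
    IsBasisOn v {x | x ≠ i} ∧
    ((∃ ε η : ℤˣ, v i = (ε : ℤ) • v j + (η : ℤ) • v k) ∨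
      ∃ l : Fin (n + 1), l ≠ i ∧ l ≠ j ∧ l ≠ k ∧
        ∃ ε η θ : ℤˣ, v i = (ε : ℤ) • v j + (η : ℤ) • v k + (θ : ℤ) • v l)

/-- Generators of `M₂`: tuples `(v 0, …, v (n+1))` for which there are distinct
indices `i, j, k, l, m` such that deleting `v i` and `v j` leaves a basis of `ℤ^n`,
`v i = ± v k ± v l`, and `v j = ± v m ± v l` or `v j = ± v m ± v q` for some
`q ∉ {i, j, k, l, m}`. -/
def Gen2 (n : ℕ) (v : Fin (n + 2) → (Fin n → ℤ)) : Prop :=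
  ∃ i j k l m : Fin (n + 2), [i, j, k, l, m].Pairwise (· ≠ ·) ∧
    IsBasisOn v {x | x ≠ i ∧ x ≠ j} ∧
    (∃ ε η : ℤˣ, v i = (ε : ℤ) • v k + (η : ℤ) • v l) ∧
    ((∃ ε η : ℤˣ, v j = (ε : ℤ) • v m + (η : ℤ) • v l) ∨
      ∃ q : Fin (n + 2), q ≠ i ∧ q ≠ j ∧ q ≠ k ∧ q ≠ l ∧ q ≠ m ∧
        ∃ ε η : ℤˣ, v j = (ε : ℤ) • v m + (η : ℤ) • v q)

/-- The relations imposed on the formal symbols `[[v 0, …, v (m-1)]]`: the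
permutation relations `[[v 0, …]] = sgn(σ) · [[v (σ 0), …]]` and the sign-change
relations `[[v 0, …]] = [[± v 0, …]]` (signs chosen independently). -/
def Rels (n m : ℕ) (P : (Fin m → (Fin n → ℤ)) → Prop) :
    AddSubgroup (FreeAbelianGroup {v : Fin m → (Fin n → ℤ) // P v}) :=
  AddSubgroup.closure
    ({x | ∃ (a b : {v : Fin m → (Fin n → ℤ) // P v}) (σ : Equiv.Perm (Fin m)),
        (∀ t, b.1 t = a.1 (σ t)) ∧
        x = FreeAbelianGroup.of a -
          ((Equiv.Perm.sign σ : ℤˣ) : ℤ) • FreeAbelianGroup.of b} ∪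
      {x | ∃ (a b : {v : Fin m → (Fin n → ℤ) // P v}) (ε : Fin m → ℤˣ),
        (∀ t, b.1 t = ((ε t : ℤˣ) : ℤ) • a.1 t) ∧
        x = FreeAbelianGroup.of a - FreeAbelianGroup.of b})

/-- `M₀`: the quotient of the free abelian group on the symbols `[[v 0, …, v (n-1)]]`,
`(v 0, …, v (n-1))` a basis of `ℤ^n`, by the permutation and sign relations. -/
abbrev M0 (n : ℕ) :=
  FreeAbelianGroup {v : Fin n → (Fin n → ℤ) // Gen0 n v} ⧸ Rels n n (Gen0 n)

/-- `M₁`: the analogous quotient on the symbols `[[v 0, …, v n]]`. -/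
abbrev M1 (n : ℕ) :=
  FreeAbelianGroup {v : Fin (n + 1) → (Fin n → ℤ) // Gen1 n v} ⧸ Rels n (n + 1) (Gen1 n)

/-- `M₂`: the analogous quotient on the symbols `[[v 0, …, v (n+1)]]`. -/
abbrev M2 (n : ℕ) :=
  FreeAbelianGroup {v : Fin (n + 2) → (Fin n → ℤ) // Gen2 n v} ⧸ Rels n (n + 2) (Gen2 n)

/-- The class in `M₀` of the symbol attached to a tuple; zero if the tuple is not a
basis of `ℤ^n`. -/
noncomputable def sym0 (n : ℕ) (a : Fin n → (Fin n → ℤ)) : M0 n :=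
  if h : Gen0 n a then
    QuotientAddGroup.mk' (Rels n n (Gen0 n)) (FreeAbelianGroup.of ⟨a, h⟩) else 0

/-- The boundary `δ₁` on the free abelian group of `M₁`-symbols:
`[[v 0, …, v n]] ↦ Σᵢ (-1)ⁱ [[v 0, …, v (i-1), v (i+1), …, v n]]`. -/
noncomputable def d1 (n : ℕ) :
    FreeAbelianGroup {v : Fin (n + 1) → (Fin n → ℤ) // Gen1 n v} →+ M0 n :=
  FreeAbelianGroup.lift fun a =>
    ∑ i : Fin (n + 1), ((-1 : ℤ) ^ (i : ℕ)) • sym0 n (a.1 ∘ i.succAbove)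

/-- The class in `M₁` of the symbol attached to a tuple; zero if the tuple is not a
generator. -/
noncomputable def sym1 (n : ℕ) (a : Fin (n + 1) → (Fin n → ℤ)) : M1 n :=
  if h : Gen1 n a then
    QuotientAddGroup.mk' (Rels n (n + 1) (Gen1 n)) (FreeAbelianGroup.of ⟨a, h⟩) else 0

/-- The boundary `δ₂` on the free abelian group of `M₂`-symbols:
`[[v 0, …, v (n+1)]] ↦ Σᵢ (-1)^{i+1} [[v 0, …, v (i-1), v (i+1), …, v (n+1)]]`. -/
noncomputable def d2 (n : ℕ) :
    FreeAbelianGroup {v : Fin (n + 2) → (Fin n → ℤ) // Gen2 n v} →+ M1 n :=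
  FreeAbelianGroup.lift fun a =>
    ∑ i : Fin (n + 2), ((-1 : ℤ) ^ ((i : ℕ) + 1)) • sym1 n (a.1 ∘ i.succAbove)

/-- The relations defining `Alt V`. -/
def altRel (V : Type) [AddCommGroup V] : AddSubgroup (FreeAbelianGroup (List V)) :=
  AddSubgroup.closure
    ({x | ∃ l₁ a b l₂, x = FreeAbelianGroup.of (l₁ ++ a :: b :: l₂) +
        FreeAbelianGroup.of (l₁ ++ b :: a :: l₂)} ∪
      ({x | ∃ l₁ a l₂, x = FreeAbelianGroup.of (l₁ ++ (-a) :: l₂) -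
        FreeAbelianGroup.of (l₁ ++ a :: l₂)} ∪
      {x | ∃ l₁ a l₂, x = FreeAbelianGroup.of (l₁ ++ a :: a :: l₂)}))

/-- The group of alternating, sign-invariant symbols on lists of elements of `V`. -/
def Alt (V : Type) [AddCommGroup V] : Type := FreeAbelianGroup (List V) ⧸ altRel V

namespace Alt

variable {V : Type} [AddCommGroup V] {B : Type} [AddCommGroup B]

noncomputable instance : AddCommGroup (Alt V) :=
  inferInstanceAs (AddCommGroup (FreeAbelianGroup (List V) ⧸ altRel V))

/-- The quotient map onto `Alt V`. -/
noncomputable def mk : FreeAbelianGroup (List V) →+ Alt V := QuotientAddGroup.mk' (altRel V)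

theorem mk_eq_zero {x : FreeAbelianGroup (List V)} : mk x = 0 ↔ x ∈ altRel V :=
  QuotientAddGroup.eq_zero_iff x

/-- The symbol of a list. -/
noncomputable def sy (l : List V) : Alt V := mk (FreeAbelianGroup.of l)

theorem sy_swap (l₁ : List V) (a b : V) (l₂ : List V) :
    sy (l₁ ++ a :: b :: l₂) = - sy (l₁ ++ b :: a :: l₂) := by
  rw [eq_neg_iff_add_eq_zero]
  unfold sy
  rw [← map_add]
  exact mk_eq_zero.2
    (AddSubgroup.subset_closure (Or.inl ⟨l₁, a, b, l₂, rfl⟩))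

theorem sy_neg (l₁ : List V) (a : V) (l₂ : List V) :
    sy (l₁ ++ (-a) :: l₂) = sy (l₁ ++ a :: l₂) := by
  rw [← sub_eq_zero]
  unfold sy
  rw [← map_sub]
  exact mk_eq_zero.2
    (AddSubgroup.subset_closure (Or.inr (Or.inl ⟨l₁, a, l₂, rfl⟩)))

theorem sy_dup (l₁ : List V) (a : V) (l₂ : List V) : sy (l₁ ++ a :: a :: l₂) = 0 :=
  mk_eq_zero.2
    (AddSubgroup.subset_closure (Or.inr (Or.inr ⟨l₁, a, l₂, rfl⟩)))

theorem sy_swap_front (a b : V) (l : List V) : sy (a :: b :: l) = - sy (b :: a :: l) :=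
  sy_swap [] a b l

theorem sy_dup_front (a : V) (l : List V) : sy (a :: a :: l) = 0 := sy_dup [] a l

/-- The universal property of `Alt V`. -/
noncomputable def lift (F : List V → B)
    (hs : ∀ l₁ a b l₂, F (l₁ ++ a :: b :: l₂) = - F (l₁ ++ b :: a :: l₂))
    (hn : ∀ l₁ a l₂, F (l₁ ++ (-a) :: l₂) = F (l₁ ++ a :: l₂))
    (hd : ∀ l₁ a l₂, F (l₁ ++ a :: a :: l₂) = 0) : Alt V →+ B :=
  QuotientAddGroup.lift (altRel V) (FreeAbelianGroup.lift F) (by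
    intro x hx
    refine (AddSubgroup.closure_le (K := (FreeAbelianGroup.lift F).ker)).2 ?_ hx
    rintro y (⟨l₁, a, b, l₂, rfl⟩ | ⟨l₁, a, l₂, rfl⟩ | ⟨l₁, a, l₂, rfl⟩)
    · simp [AddMonoidHom.mem_ker, hs l₁ a b l₂]
    · simp [AddMonoidHom.mem_ker, hn l₁ a l₂]
    · simp [AddMonoidHom.mem_ker, hd l₁ a l₂])

@[simp] theorem lift_sy (F : List V → B) (hs) (hn) (hd) (l : List V) :
    lift F hs hn hd (sy l) = F l := by
  unfold lift sy
  exact FreeAbelianGroup.lift_apply_of F l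

theorem induction {P : Alt V → Prop} (x : Alt V) (h0 : P 0) (hsy : ∀ l, P (sy l))
    (hneg : ∀ x, P x → P (-x)) (hadd : ∀ x y, P x → P y → P (x + y)) : P x := by
  obtain ⟨y, rfl⟩ : ∃ y, mk y = x := QuotientAddGroup.mk'_surjective (altRel V) x
  induction y using FreeAbelianGroup.induction_on with
  | zero => rw [map_zero]; exact h0
  | of l => exact hsy l
  | neg l h => rw [map_neg]; exact hneg _ h
  | add a b ha hb => rw [map_add]; exact hadd _ _ ha hb

theorem hom_eq {f g : Alt V →+ B} (h : ∀ l, f (sy l) = g (sy l)) (x : Alt V) : f x = g x := by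
  induction x using Alt.induction with
  | h0 => simp
  | hsy l => exact h l
  | hneg x hx => simp [hx]
  | hadd x y hx hy => simp [hx, hy]

/-- Adding an entry in front of a symbol. -/
noncomputable def cons (a : V) : Alt V →+ Alt V :=
  lift (fun l => sy (a :: l)) (fun l₁ => sy_swap (a :: l₁)) (fun l₁ => sy_neg (a :: l₁))
    (fun l₁ => sy_dup (a :: l₁))

@[simp] theorem cons_sy (a : V) (l : List V) : cons a (sy l) = sy (a :: l) := by simp [cons]

theorem cons_cons (a b : V) (x : Alt V) : cons a (cons b x) = - cons b (cons a x) := by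
  have := hom_eq (f := (cons a).comp (cons b)) (g := -((cons b).comp (cons a)))
    (fun l => by simpa using sy_swap [] a b l) x
  simpa using this

theorem cons_self (a : V) (x : Alt V) : cons a (cons a x) = 0 := by
  have := hom_eq (f := (cons a).comp (cons a)) (g := 0)
    (fun l => by simpa using sy_dup [] a l) x
  simpa using this

theorem cons_neg (a : V) (x : Alt V) : cons (-a) x = cons a x :=
  hom_eq (f := cons (-a)) (g := cons a) (fun l => by simpa using sy_neg [] a l) x

/-- Contraction of a list against a weight function. -/
noncomputable def conList (w : V → ℤ) : List V → Alt V
  | [] => 0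
  | a :: l => w a • sy l - cons a (conList w l)

/-- Contraction of a symbol against an even weight function; the boundary map is the case `w = 1`
and the link of `v` is the case where `w` is the indicator function of `{v, -v}`. -/
noncomputable def con (w : V → ℤ) (hw : ∀ a, w (-a) = w a) : Alt V →+ Alt V :=
  lift (conList w)
    (by
      intro l₁ a b l₂
      induction l₁ with
      | nil =>
        simp only [List.nil_append, conList, map_sub, map_zsmul, cons_sy]
        rw [cons_cons a b]
        abel
      | cons c l₁ ih =>
        simp only [List.cons_append, conList, ih, map_neg, sy_swap l₁ a b l₂, smul_neg]
        abel)
    (by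
      intro l₁ a l₂
      induction l₁ with
      | nil => simp [conList, hw, cons_neg]
      | cons c l₁ ih => simp only [List.cons_append, conList, ih, sy_neg])
    (by
      intro l₁ a l₂
      induction l₁ with
      | nil => simp [conList, cons_self]
      | cons c l₁ ih => simp [conList, ih, sy_dup])

theorem con_cons (w : V → ℤ) (hw) (a : V) (x : Alt V) :
    con w hw (cons a x) = w a • x - cons a (con w hw x) := by
  have := hom_eq (f := (con w hw).comp (cons a))
    (g := w a • AddMonoidHom.id _ - (cons a).comp (con w hw))
    (fun l => by simp [con, conList]) x
  simpa using this

@[simp] theorem con_nil (w : V → ℤ) (hw) : con w hw (sy []) = 0 := by simp [con, conList]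

theorem con_sy_cons (w : V → ℤ) (hw) (a : V) (l : List V) :
    con w hw (sy (a :: l)) = w a • sy l - cons a (con w hw (sy l)) := by
  rw [← cons_sy, con_cons]

theorem con_con_self (w : V → ℤ) (hw) (x : Alt V) : con w hw (con w hw x) = 0 := by
  refine hom_eq (f := (con w hw).comp (con w hw)) (g := 0) (fun l => ?_) x
  induction l with
  | nil => simp
  | cons a l ih =>
    have ih' : con w hw (con w hw (sy l)) = 0 := ih
    simp [con_sy_cons, con_cons, ih']

theorem con_con (w w' : V → ℤ) (hw) (hw') (x : Alt V) :
    con w hw (con w' hw' x) = - con w' hw' (con w hw x) := by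
  refine hom_eq (f := (con w hw).comp (con w' hw')) (g := -((con w' hw').comp (con w hw)))
    (fun l => ?_) x
  induction l with
  | nil => simp
  | cons a l ih =>
    have ih' : con w hw (con w' hw' (sy l)) = -con w' hw' (con w hw (sy l)) := ih
    simp [con_sy_cons, con_cons, ih']
    abel

/-- The boundary map. -/
noncomputable def bd : Alt V →+ Alt V := con (fun _ => 1) (fun _ => rfl)

theorem bd_cons (a : V) (x : Alt V) : bd (cons a x) = x - cons a (bd x) := by
  simp [bd, con_cons]

@[simp] theorem bd_nil : bd (sy ([] : List V)) = 0 := con_nil _ _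

theorem bd_sy_cons (a : V) (l : List V) : bd (sy (a :: l)) = sy l - cons a (bd (sy l)) := by
  rw [← cons_sy, bd_cons]

@[simp] theorem bd_bd (x : Alt V) : bd (bd x) = 0 := con_con_self _ _ x

/-- The map of symbols induced by a homomorphism. -/
noncomputable def map {W : Type} [AddCommGroup W] (p : V →+ W) : Alt V →+ Alt W :=
  lift (fun l => sy (l.map p))
    (fun l₁ a b l₂ => by simpa using sy_swap (l₁.map p) (p a) (p b) (l₂.map p))
    (fun l₁ a l₂ => by simpa using sy_neg (l₁.map p) (p a) (l₂.map p))
    (fun l₁ a l₂ => by simpa using sy_dup (l₁.map p) (p a) (l₂.map p))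

@[simp] theorem map_sy {W : Type} [AddCommGroup W] (p : V →+ W) (l : List V) :
    map p (sy l) = sy (l.map p) := by simp [map]

theorem map_cons {W : Type} [AddCommGroup W] (p : V →+ W) (a : V) (x : Alt V) :
    map p (cons a x) = cons (p a) (map p x) :=
  hom_eq (f := (map p).comp (cons a)) (g := (cons (p a)).comp (map p)) (fun l => by simp) x

theorem map_bd {W : Type} [AddCommGroup W] (p : V →+ W) (x : Alt V) :
    map p (bd x) = bd (map p x) := by
  refine hom_eq (f := (map p).comp bd) (g := bd.comp (map p)) (fun l => ?_) x
  induction l with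
  | nil => simp
  | cons a l ih =>
    have ih' : map p (bd (sy l)) = bd (map p (sy l)) := ih
    simp only [map_sy] at ih'
    simp [bd_sy_cons, map_cons, ih']

/-- The part of a symbol containing `v` or `-v`, with that entry removed. -/
noncomputable def link (v : V) : Alt V →+ Alt V :=
  con (fun x => if x = v ∨ x = -v then 1 else 0) (by
    intro a
    have : (-a = v ∨ -a = -v) ↔ (a = v ∨ a = -v) := by
      rw [neg_eq_iff_eq_neg, neg_inj]; tauto
    simp only [this])

theorem link_bd (v : V) (x : Alt V) : link v (bd x) = - bd (link v x) := con_con _ _ _ _ x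

theorem link_of_forall_ne (v : V) (l : List V) (h : ∀ x ∈ l, x ≠ v ∧ x ≠ -v) :
    link v (sy l) = 0 := by
  induction l with
  | nil => simp [link]
  | cons a l ih =>
    have ih' := ih (fun x hx => h x (List.mem_cons_of_mem _ hx))
    have ha := h a List.mem_cons_self
    unfold link at *
    rw [con_sy_cons, ih']
    simp [ha.1, ha.2]

theorem link_cons_of_forall_ne (v : V) (l : List V) (h : ∀ x ∈ l, x ≠ v ∧ x ≠ -v) :
    link v (sy (v :: l)) = sy l := by
  have := link_of_forall_ne v l h
  unfold link at *
  rw [con_sy_cons, this]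
  simp

theorem sy_perm {l l' : List V} (h : l.Perm l') : sy l = sy l' ∨ sy l = - sy l' := by
  induction h with
  | nil => exact Or.inl rfl
  | cons a _ ih =>
    rcases ih with h | h
    · exact Or.inl (by rw [← cons_sy, h, cons_sy])
    · exact Or.inr (by rw [← cons_sy, h, map_neg, cons_sy])
  | swap a b l => exact Or.inr (sy_swap [] b a l)
  | trans _ _ h₁ h₂ =>
    rcases h₁ with h₁ | h₁ <;> rcases h₂ with h₂ | h₂ <;> simp [h₁, h₂]

theorem sy_forall₂ {l l' : List V} (h : List.Forall₂ (fun a b => b = a ∨ b = -a) l l') :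
    sy l' = sy l := by
  induction h with
  | nil => rfl
  | cons h _ ih =>
    rw [← cons_sy, ih, cons_sy]
    rcases h with rfl | rfl
    · rfl
    · exact sy_neg [] _ _

theorem sy_middle (l₁ : List V) (a : V) (l₂ : List V) :
    sy (l₁ ++ a :: l₂) = (-1 : ℤ) ^ l₁.length • sy (a :: (l₁ ++ l₂)) := by
  induction l₁ with
  | nil => simp
  | cons b l₁ ih =>
    rw [List.cons_append, ← cons_sy, ih, map_zsmul, cons_sy, sy_swap_front b a]
    simp [pow_succ]

theorem sy_eq_zero_of_neg_mem (a : V) (l : List V) (h : a ∈ l ∨ -a ∈ l) : sy (a :: l) = 0 := by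
  rcases h with h | h
  · obtain ⟨l₁, l₂, rfl⟩ := List.append_of_mem h
    rw [← cons_sy, sy_middle, map_zsmul, cons_sy, sy_dup_front a, smul_zero]
  · obtain ⟨l₁, l₂, rfl⟩ := List.append_of_mem h
    rw [← List.cons_append, sy_neg (a :: l₁) a l₂, List.cons_append, ← cons_sy, sy_middle,
      map_zsmul, cons_sy, sy_dup_front a, smul_zero]

theorem bd_mem (l : List V) (K : AddSubgroup (Alt V))
    (h : ∀ l₁ a l₂, l = l₁ ++ a :: l₂ → sy (l₁ ++ l₂) ∈ K) : bd (sy l) ∈ K := by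
  induction l generalizing K with
  | nil => simp [K.zero_mem]
  | cons a l ih =>
    rw [bd_sy_cons]
    refine K.sub_mem (by simpa using h [] a l rfl) ?_
    refine ih (K.comap (cons a)) ?_
    rintro l₁ b l₂ rfl
    simpa using h (a :: l₁) b l₂ rfl

end Alt

section Spanning

variable {V W : Type} [AddCommGroup V] [AddCommGroup W]

/-- The entries of `l` span `V`. -/
def Sp (l : List V) : Prop := Submodule.span ℤ {x | x ∈ l} = ⊤

theorem Sp.of_mem_span {l l' : List V} (h : Sp l)
    (hl : ∀ x ∈ l, x ∈ Submodule.span ℤ {x | x ∈ l'}) : Sp l' := by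
  unfold Sp at *
  rw [eq_top_iff, ← h]
  exact Submodule.span_le.2 hl

theorem Sp.of_subset {l l' : List V} (h : Sp l) (hl : ∀ x ∈ l, x ∈ l') : Sp l' :=
  h.of_mem_span fun x hx => Submodule.subset_span (hl x hx)

theorem Sp.of_mem_or_neg {l l' : List V} (h : Sp l) (hl : ∀ x ∈ l, x ∈ l' ∨ -x ∈ l') : Sp l' :=
  h.of_mem_span fun x hx => (hl x hx).elim (fun h => Submodule.subset_span h)
    (fun h => (neg_neg x) ▸ Submodule.neg_mem _ (Submodule.subset_span h))

theorem Sp.perm {l l' : List V} (h : Sp l) (hl : l.Perm l') : Sp l' :=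
  h.of_subset fun _ hx => hl.subset hx

theorem Sp.forall₂ {l l' : List V} (h : Sp l)
    (hl : List.Forall₂ (fun a b => b = a ∨ b = -a) l l') : Sp l' := by
  refine h.of_mem_or_neg ?_
  clear h
  induction hl with
  | nil => simp
  | @cons a b l l' hab _ ih =>
    intro x hx
    rcases List.mem_cons.1 hx with rfl | hx
    · rcases hab with rfl | rfl <;> simp
    · rcases ih x hx with h | h <;> simp [h]

theorem Sp.map {l : List V} (h : Sp l) (p : V →+ W) (hp : Function.Surjective p) :
    Sp (l.map p) := by
  unfold Sp at *
  have h1 : {x | x ∈ l.map p} = p.toIntLinearMap '' {x | x ∈ l} := by ext; simp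
  rw [h1, Submodule.span_image, h, Submodule.map_top, LinearMap.range_eq_top]
  exact hp

theorem Sp.of_map {l : List V} (p : V →+ W) (v : V) (hv : ∀ x, p x = 0 → ∃ k : ℤ, x = k • v)
    (h : Sp (l.map p)) : Sp (v :: l) := by
  unfold Sp at *
  have h1 : {x | x ∈ l.map p} = p.toIntLinearMap '' {x | x ∈ l} := by ext; simp
  rw [h1, Submodule.span_image] at h
  rw [eq_top_iff]
  intro x _
  have hx : p.toIntLinearMap x ∈ Submodule.map p.toIntLinearMap (Submodule.span ℤ {x | x ∈ l}) := by
    rw [h]; trivial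
  obtain ⟨y, hy, hyx⟩ := Submodule.mem_map.1 hx
  obtain ⟨k, hk⟩ := hv (x - y) (by
    have : p y = p x := hyx
    simp [this])
  have hle : Submodule.span ℤ {x | x ∈ l} ≤ Submodule.span ℤ {x | x ∈ v :: l} :=
    Submodule.span_mono fun x hx => List.mem_cons_of_mem _ hx
  rw [← sub_add_cancel x y, hk]
  exact Submodule.add_mem _ (Submodule.smul_mem _ _ (Submodule.subset_span List.mem_cons_self))
    (hle hy)

theorem Sp.le_length {n : ℕ} {l : List (Fin n → ℤ)} (h : Sp l) : n ≤ l.length := by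
  unfold Sp at h
  have h1 : {x | x ∈ l} = (l.toFinset : Set (Fin n → ℤ)) := by ext; simp
  rw [h1] at h
  have := finrank_span_finset_le_card (R := ℤ) l.toFinset
  unfold Set.finrank at this
  rw [h, finrank_top, Module.finrank_fin_fun] at this
  exact this.trans (List.toFinset_card_le l)

/-- `SRel l k y`: a combination of `k` entries of `l` with coefficients `±1` equals `y`. -/
inductive SRel : List V → ℕ → V → Prop
  | nil : SRel [] 0 0
  | skip (a : V) {l k y} : SRel l k y → SRel (a :: l) k y
  | pos (a : V) {l k y} : SRel l k y → SRel (a :: l) (k + 1) (y + a)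
  | neg (a : V) {l k y} : SRel l k y → SRel (a :: l) (k + 1) (y - a)

theorem SRel.pos' {l : List V} {k : ℕ} {y : V} (a : V) (h : SRel l k (y - a)) :
    SRel (a :: l) (k + 1) y := by
  simpa using h.pos a

theorem SRel.neg' {l : List V} {k : ℕ} {y : V} (a : V) (h : SRel l k (y + a)) :
    SRel (a :: l) (k + 1) y := by
  simpa using h.neg a

theorem SRel.zero (l : List V) : SRel l 0 0 := by
  induction l with
  | nil => exact .nil
  | cons a l ih => exact .skip a ih

theorem SRel.eq_zero {l : List V} {y : V} (h : SRel l 0 y) : y = 0 := by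
  induction l generalizing y with
  | nil => cases h; rfl
  | cons a l ih => cases h with | skip _ h => exact ih h

theorem SRel.append_sum (E r : List V) : SRel (E ++ r) E.length E.sum := by
  induction E with
  | nil => exact SRel.zero r
  | cons a E ih =>
    rw [List.sum_cons, add_comm]
    exact ih.pos a

theorem SRel.map {l : List V} {k : ℕ} {y : V} (p : V →+ W) (h : SRel l k y) :
    SRel (l.map p) k (p y) := by
  induction h with
  | nil => simpa using SRel.nil
  | skip a _ ih => exact ih.skip _
  | pos a _ ih => simpa using ih.pos (p a)
  | neg a _ ih => simpa using ih.neg (p a)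

theorem SRel.opp {l : List V} {k : ℕ} {y : V} (h : SRel l k y) : SRel l k (-y) := by
  induction h with
  | nil => simpa using SRel.nil
  | skip a _ ih => exact ih.skip _
  | pos a _ ih => exact .neg' _ (by simpa using ih)
  | neg a _ ih => exact .pos' _ (by simpa using ih)

theorem SRel.forall₂ {l l' : List V} {k : ℕ} {y : V} (h : SRel l k y)
    (hl : List.Forall₂ (fun a b => b = a ∨ b = -a) l l') : SRel l' k y := by
  induction hl generalizing k y with
  | nil => exact h
  | cons hab _ ih =>
    cases h with
    | skip _ h => exact (ih h).skip _
    | pos _ h =>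
      rcases hab with rfl | rfl
      · exact (ih h).pos _
      · exact .neg' _ (by simpa using ih h)
    | neg _ h =>
      rcases hab with rfl | rfl
      · exact (ih h).neg _
      · exact .pos' _ (by simpa using ih h)

theorem SRel.cons_of_imp {l l' : List V} (h : ∀ k y, SRel l k y → SRel l' k y) {a : V}
    {k : ℕ} {y : V}
    (hr : SRel (a :: l) k y) : SRel (a :: l') k y := by
  cases hr with
  | skip _ hr => exact (h _ _ hr).skip _
  | pos _ hr => exact (h _ _ hr).pos _
  | neg _ hr => exact (h _ _ hr).neg _

theorem SRel.perm {l l' : List V} (hl : l.Perm l') {k : ℕ} {y : V} (h : SRel l k y) :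
    SRel l' k y := by
  induction hl generalizing k y with
  | nil => exact h
  | cons a _ ih => exact h.cons_of_imp fun _ _ => ih
  | trans _ _ h₁ h₂ => exact h₂ (h₁ h)
  | swap a b l =>
    cases h with
    | skip _ h =>
      cases h with
      | skip _ h => exact (h.skip _).skip _
      | pos _ h => exact (h.skip _).pos _
      | neg _ h => exact (h.skip _).neg _
    | pos _ h =>
      cases h with
      | skip _ h => exact (h.pos _).skip _
      | pos _ h => exact .pos' _ (.pos' _ (by convert h using 1; abel))
      | neg _ h => exact .neg' _ (.pos' _ (by convert h using 1; abel))
    | neg _ h =>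
      cases h with
      | skip _ h => exact (h.neg _).skip _
      | pos _ h => exact .pos' _ (.neg' _ (by convert h using 1; abel))
      | neg _ h => exact .neg' _ (.neg' _ (by convert h using 1; abel))

theorem SRel.exists_perm {ι : Type} (g : ι → V) {P : List ι} {k : ℕ} {y : V}
    (h : SRel (P.map g) (k + 1) y) :
    ∃ a P', P.Perm (a :: P') ∧ (SRel (P'.map g) k (y - g a) ∨ SRel (P'.map g) k (y + g a)) := by
  induction P generalizing k y with
  | nil => cases h
  | cons b P ih =>
    cases h with
    | skip _ h =>
      obtain ⟨a, P', hP, hr⟩ := ih h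
      exact ⟨a, b :: P', (hP.cons b).trans (.swap _ _ _), hr.imp (SRel.skip _) (SRel.skip _)⟩
    | pos _ h => exact ⟨b, P, .refl _, Or.inl (by simpa using h)⟩
    | neg _ h => exact ⟨b, P, .refl _, Or.inr (by simpa using h)⟩

theorem SRel.coeffs {l : List V} {k : ℕ} {y : V} (h : SRel l k y) :
    ∃ C : List ℤ, C.length = l.length ∧ (∀ c ∈ C, |c| ≤ 1) ∧ (C.map Int.natAbs).sum = k ∧
      (List.zipWith (fun (c : ℤ) x => c • x) C l).sum = y := by
  induction h with
  | nil => exact ⟨[], by simp⟩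
  | skip a _ ih =>
    obtain ⟨C, h1, h2, h3, h4⟩ := ih
    exact ⟨0 :: C, by simp [h1], by simpa using h2, by simpa using h3, by simpa using h4⟩
  | pos a _ ih =>
    obtain ⟨C, h1, h2, h3, h4⟩ := ih
    exact ⟨1 :: C, by simp [h1], by simpa using h2, by simp [h3, add_comm],
      by simp [h4, add_comm]⟩
  | neg a _ ih =>
    obtain ⟨C, h1, h2, h3, h4⟩ := ih
    exact ⟨-1 :: C, by simp [h1], by simpa using h2, by simp [h3, add_comm],
      by simp [h4]; abel⟩

end Spanning

section Uniqueness

theorem coeffs_proportional {n : ℕ} (g : Fin (n + 1) → (Fin n → ℤ))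
    (hg : Submodule.span ℤ (Set.range g) = ⊤) (c d : Fin (n + 1) → ℤ)
    (hc : ∑ i, c i • g i = 0) (hd : ∑ i, d i • g i = 0) (i j : Fin (n + 1)) :
    c i * d j = c j * d i := by
  by_contra hne
  let φ : (Fin (n + 1) → ℤ) →ₗ[ℤ] (Fin n → ℤ) := Fintype.linearCombination ℤ g
  have hφ : LinearMap.range φ = ⊤ := by
    rw [Fintype.range_linearCombination, hg]
  have hrank := (LinearMap.ker φ).finrank_quotient_add_finrank
  rw [φ.quotKerEquivRange.finrank_eq, hφ, finrank_top, Module.finrank_fin_fun,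
    Module.finrank_fin_fun] at hrank
  let w : Fin 2 → LinearMap.ker φ :=
    ![⟨c, by simpa [φ, Fintype.linearCombination_apply] using hc⟩,
      ⟨d, by simpa [φ, Fintype.linearCombination_apply] using hd⟩]
  have hw : LinearIndependent ℤ w := by
    rw [LinearIndependent.pair_iff]
    intro s t hst
    have h1 : s • c + t • d = 0 := congrArg Subtype.val hst
    have hi := congrFun h1 i
    have hj := congrFun h1 j
    simp at hi hj
    have e1 : s * (c i * d j - c j * d i) = 0 := by linear_combination d j * hi - d i * hj
    have e2 : t * (c i * d j - c j * d i) = 0 := by linear_combination c i * hj - c j * hi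
    have hne' : c i * d j - c j * d i ≠ 0 := sub_ne_zero.2 hne
    exact ⟨(mul_eq_zero.1 e1).resolve_right hne', (mul_eq_zero.1 e2).resolve_right hne'⟩
  have := hw.fintype_card_le_finrank
  simp at this
  omega

theorem sum_zipWith_eq {V : Type} [AddCommGroup V] {N : ℕ} (C : List ℤ) (l : List V)
    (hC : C.length = N) (hl : l.length = N) :
    (List.zipWith (fun (c : ℤ) x => c • x) C l).sum =
      ∑ i : Fin N, C[i]'(hC ▸ i.2) • l[i]'(hl ▸ i.2) := by
  rw [← List.sum_ofFn]
  congr 1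
  apply List.ext_getElem
  · simp [hC, hl]
  · intro i h1 h2
    simp

theorem sum_zipWith_replicate {V : Type} [AddCommGroup V] (E r : List V) :
    (List.zipWith (fun (c : ℤ) x => c • x)
      (List.replicate E.length 1 ++ List.replicate r.length 0) (E ++ r)).sum = E.sum := by
  induction E with
  | nil =>
    induction r with
    | nil => simp
    | cons a r ih =>
      simp only [List.length_nil, List.replicate_zero, List.nil_append] at ih
      simp [List.replicate_succ, ih]
  | cons a E ih => simp [List.replicate_succ, ih]

theorem SRel.unique {n : ℕ} {v : Fin n → ℤ} {E r : List (Fin n → ℤ)} {j : ℕ} {κ k : ℤ}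
    (hsp : Sp (v :: (E ++ r))) (hlen : (E ++ r).length = n) (hE : E.sum = k • v)
    (hE0 : E ≠ []) (hj : 0 < j) (h : SRel (E ++ r) j (κ • v)) :
    j = E.length ∧ |κ| = |k| := by
  obtain ⟨C, hC1, hC2, hC3, hC4⟩ := h.coeffs
  set g := v :: (E ++ r) with hgdef
  have hgl : g.length = n + 1 := by simp [hgdef]; simpa using hlen
  let C' : List ℤ := -κ :: C
  let D : List ℤ := -k :: (List.replicate E.length 1 ++ List.replicate r.length 0)
  have hCl : C'.length = n + 1 := by simp [C', hC1]; simpa using hlen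
  have hDl : D.length = n + 1 := by simp [D]; simpa using hlen
  have hspan : Submodule.span ℤ (Set.range fun i : Fin (n + 1) => g[i]'(hgl.symm ▸ i.2)) = ⊤ := by
    rw [← show _ = _ from hsp]
    congr 1
    ext x
    simp only [Set.mem_range, Set.mem_ofPred_eq, List.mem_iff_getElem]
    constructor
    · rintro ⟨i, rfl⟩
      exact ⟨i, hgl.symm ▸ i.2, rfl⟩
    · rintro ⟨i, hi, rfl⟩
      exact ⟨⟨i, hgl ▸ hi⟩, rfl⟩
  have hsumD : (List.zipWith (fun (c : ℤ) x => c • x) D g).sum = 0 := by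
    simp only [D, hgdef, List.zipWith_cons_cons, List.sum_cons, sum_zipWith_replicate, hE]
    simp
  have hsumC : (List.zipWith (fun (c : ℤ) x => c • x) C' g).sum = 0 := by
    simp only [C', hgdef, List.zipWith_cons_cons, List.sum_cons, hC4]
    simp
  rw [sum_zipWith_eq _ _ hCl hgl] at hsumC
  rw [sum_zipWith_eq _ _ hDl hgl] at hsumD
  have key := coeffs_proportional _ hspan _ _ hsumC hsumD
  obtain ⟨e, E', rfl⟩ := List.exists_cons_of_ne_nil hE0
  have hC0 : C ≠ [] := by
    intro h0
    simp [h0] at hC1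
  obtain ⟨c, C₀, rfl⟩ := List.exists_cons_of_ne_nil hC0
  have hn : 1 < n + 1 := by simp at hlen; omega
  have hall : C' = D.map (c * ·) := by
    apply List.ext_getElem
    · simp [hCl, hDl]
    · intro i h1 h2
      have := key ⟨i, hCl ▸ h1⟩ ⟨1, hn⟩
      simp only [Fin.getElem_fin] at this
      have hD1 : D[1]'(by omega) = 1 := by simp [D, List.replicate_succ]
      have hC'1 : C'[1]'(by omega) = c := by simp [C']
      rw [hD1, hC'1, mul_one] at this
      simpa using this
  simp only [C', D, List.map_cons, List.map_append, List.map_replicate, mul_one, mul_zero,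
    List.cons.injEq] at hall
  obtain ⟨hκ, hCC⟩ := hall
  rw [hCC] at hC3
  simp at hC3
  have hc1 : |c| ≤ 1 := hC2 c List.mem_cons_self
  have hc : c.natAbs = 1 := by
    rcases Nat.eq_zero_or_pos c.natAbs with h0 | h0
    · rw [h0] at hC3; omega
    · rw [Int.abs_eq_natAbs] at hc1; omega
  rw [hc] at hC3
  refine ⟨by simp; omega, ?_⟩
  have : κ = c * k := by linear_combination -hκ
  rw [this, abs_mul, Int.abs_eq_natAbs c, hc]
  simp

end Uniqueness

section Generators

open Alt

variable {V : Type} [AddCommGroup V]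

/-- The subgroup spanned by the symbols of the lists satisfying `P`. -/
noncomputable def symSub (P : List V → Prop) : AddSubgroup (Alt V) :=
  AddSubgroup.closure (sy '' {l | P l})

theorem sy_mem_symSub {P : List V → Prop} {l : List V} (h : P l) : sy l ∈ symSub P :=
  AddSubgroup.subset_closure ⟨l, h, rfl⟩

theorem symSub_le {P : List V → Prop} {K : AddSubgroup (Alt V)} (h : ∀ l, P l → sy l ∈ K) :
    symSub P ≤ K := by
  refine (AddSubgroup.closure_le _).2 ?_
  rintro _ ⟨l, hl, rfl⟩
  exact h l hl

theorem symSub_mono {P P' : List V → Prop} (h : ∀ l, P l → P' l) : symSub P ≤ symSub P' :=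
  symSub_le fun l hl => sy_mem_symSub (h l hl)

/-- The span of the non-generating symbols. -/
noncomputable def NS (V : Type) [AddCommGroup V] : AddSubgroup (Alt V) := symSub fun l => ¬ Sp l

theorem bd_mem_NS {x : Alt V} (hx : x ∈ NS V) : bd x ∈ NS V := by
  refine (symSub_le (K := (NS V).comap bd) fun l hl => ?_) hx
  refine AddSubgroup.mem_comap.2 (bd_mem l _ ?_)
  rintro l₁ a l₂ rfl
  refine sy_mem_symSub fun h => hl (h.of_subset fun x hx => ?_)
  simp only [List.mem_append, List.mem_cons] at hx ⊢
  tauto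

/-- Lists of length `n + 1` containing a circuit of length three or four. -/
def IsG1 (n : ℕ) (l : List V) : Prop := l.length = n + 1 ∧ (SRel l 3 0 ∨ SRel l 4 0)

/-- Lists of length `n + 2` starting with two triangles, sharing one edge or disjoint. -/
def IsG2 (n : ℕ) (l : List V) : Prop :=
  l.length = n + 2 ∧
    ((∃ s a b c d r, l = s :: a :: b :: c :: d :: r ∧ s + a + b = 0 ∧ s + c + d = 0) ∨
      ∃ a b c d e f r, l = a :: b :: c :: d :: e :: f :: r ∧ a + b + c = 0 ∧ d + e + f = 0)

theorem bd_sy_five (s a b c d : V) (r : List V) :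
    bd (sy (s :: a :: b :: c :: d :: r)) = sy (a :: b :: c :: d :: r) - sy (s :: b :: c :: d :: r)
      + sy (s :: a :: c :: d :: r) - sy (s :: a :: b :: d :: r) + sy (s :: a :: b :: c :: r)
      - cons s (cons a (cons b (cons c (cons d (bd (sy r)))))) := by
  simp only [bd_sy_cons, map_sub, cons_sy]
  abel

theorem bd_sy_six (a b c d e f : V) (r : List V) :
    bd (sy (a :: b :: c :: d :: e :: f :: r)) =
      sy (b :: c :: d :: e :: f :: r) - sy (a :: c :: d :: e :: f :: r)
      + sy (a :: b :: d :: e :: f :: r) - sy (a :: b :: c :: e :: f :: r)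
      + sy (a :: b :: c :: d :: f :: r) - sy (a :: b :: c :: d :: e :: r)
      + cons a (cons b (cons c (cons d (cons e (cons f (bd (sy r))))))) := by
  simp only [bd_sy_cons, map_sub, cons_sy]
  abel

theorem mem_span_of_add_eq_zero {l : List V} {a b c : V} (hb : b ∈ Submodule.span ℤ {x | x ∈ l})
    (hc : c ∈ Submodule.span ℤ {x | x ∈ l}) (h : a + b + c = 0) :
    a ∈ Submodule.span ℤ {x | x ∈ l} := by
  have : a = -(b + c) := by rw [eq_neg_iff_add_eq_zero, ← h]; abel
  rw [this]
  exact Submodule.neg_mem _ (Submodule.add_mem _ hb hc)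

end Generators

section Faces

open Alt

variable {n : ℕ}

theorem cons_bd_mem_NS_five {s a b c d : Fin n → ℤ} {r : List (Fin n → ℤ)}
    (hr : r.length + 3 = n) (h₁ : s + a + b = 0) (h₂ : s + c + d = 0) :
    cons s (cons a (cons b (cons c (cons d (bd (sy r)))))) ∈ NS (Fin n → ℤ) := by
  refine bd_mem r ((NS _).comap
    ((cons s).comp ((cons a).comp ((cons b).comp ((cons c).comp (cons d)))))) ?_
  rintro l₁ x l₂ rfl
  simp only [AddSubgroup.mem_comap, AddMonoidHom.coe_comp, Function.comp_apply, cons_sy]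
  refine sy_mem_symSub fun h => ?_
  have h' : Sp (s :: a :: c :: (l₁ ++ l₂)) := by
    refine h.of_mem_span fun y hy => ?_
    have hs := Submodule.subset_span (R := ℤ) (show s ∈ {x | x ∈ s :: a :: c :: (l₁ ++ l₂)} by simp)
    have ha := Submodule.subset_span (R := ℤ) (show a ∈ {x | x ∈ s :: a :: c :: (l₁ ++ l₂)} by simp)
    have hc := Submodule.subset_span (R := ℤ) (show c ∈ {x | x ∈ s :: a :: c :: (l₁ ++ l₂)} by simp)
    by_cases hb : y = b
    · exact mem_span_of_add_eq_zero hs ha (by rw [hb, ← h₁]; abel)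
    by_cases hd : y = d
    · exact mem_span_of_add_eq_zero hs hc (by rw [hd, ← h₂]; abel)
    refine Submodule.subset_span ?_
    simp only [List.mem_cons, Set.mem_ofPred_eq, hb, hd, false_or] at hy ⊢
    exact hy
  have := h'.le_length
  simp at this hr
  omega

theorem cons_bd_mem_NS_six {a b c d e f : Fin n → ℤ} {r : List (Fin n → ℤ)}
    (hr : r.length + 4 = n) (h₁ : a + b + c = 0) (h₂ : d + e + f = 0) :
    cons a (cons b (cons c (cons d (cons e (cons f (bd (sy r))))))) ∈ NS (Fin n → ℤ) := by
  refine bd_mem r ((NS _).comap ((cons a).comp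
    ((cons b).comp ((cons c).comp ((cons d).comp ((cons e).comp (cons f))))))) ?_
  rintro l₁ x l₂ rfl
  simp only [AddSubgroup.mem_comap, AddMonoidHom.coe_comp, Function.comp_apply, cons_sy]
  refine sy_mem_symSub fun h => ?_
  have h' : Sp (a :: b :: d :: e :: (l₁ ++ l₂)) := by
    refine h.of_mem_span fun y hy => ?_
    have hs : ∀ x ∈ a :: b :: d :: e :: (l₁ ++ l₂),
      x ∈ Submodule.span ℤ {x | x ∈ a :: b :: d :: e :: (l₁ ++ l₂)} :=
      fun x hx => Submodule.subset_span hx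
    by_cases hc : y = c
    · exact mem_span_of_add_eq_zero (hs a (by simp)) (hs b (by simp)) (by rw [hc, ← h₁]; abel)
    by_cases hf : y = f
    · exact mem_span_of_add_eq_zero (hs d (by simp)) (hs e (by simp)) (by rw [hf, ← h₂]; abel)
    refine hs y ?_
    simp only [List.mem_cons, hc, hf, false_or] at hy ⊢
    exact hy
  have := h'.le_length
  simp at this hr
  omega

variable {V : Type} [AddCommGroup V]

theorem SRel.three {a b c : V} (h : a + b + c = 0) (r : List V) : SRel (a :: b :: c :: r) 3 0 := by
  have := SRel.append_sum [a, b, c] r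
  simpa [← add_assoc, h] using this

theorem bd_mem_of_isG2 {B : Set (Fin n → ℤ)} {l : List (Fin n → ℤ)} (hl : IsG2 n l)
    (hB : ∀ x ∈ l, x ∈ B) :
    bd (sy l) ∈ symSub (fun l => IsG1 n l ∧ ∀ x ∈ l, x ∈ B) ⊔ NS (Fin n → ℤ) := by
  have key : ∀ l' : List (Fin n → ℤ), l'.length = n + 1 → (SRel l' 3 0 ∨ SRel l' 4 0) →
      (∀ x ∈ l', x ∈ l) →
      sy l' ∈ symSub (fun l => IsG1 n l ∧ ∀ x ∈ l, x ∈ B) ⊔ NS (Fin n → ℤ) :=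
    fun l' h₁ h₂ h₃ => AddSubgroup.mem_sup_left
      (sy_mem_symSub ⟨⟨h₁, h₂⟩, fun x hx => hB x (h₃ x hx)⟩)
  obtain ⟨hlen, ⟨s, a, b, c, d, r, rfl, h₁, h₂⟩ | ⟨a, b, c, d, e, f, r, rfl, h₁, h₂⟩⟩ := hl
  · rw [bd_sy_five]
    simp only [List.length_cons] at hlen
    refine AddSubgroup.sub_mem _ (AddSubgroup.add_mem _ (AddSubgroup.sub_mem _
      (AddSubgroup.add_mem _ (AddSubgroup.sub_mem _ ?_ ?_) ?_) ?_) ?_)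
      (AddSubgroup.mem_sup_right (cons_bd_mem_NS_five (by omega) h₁ h₂))
    · refine key _ (by simp; omega) (Or.inr ?_) (by simp; tauto)
      refine .pos' _ (.pos' _ (.neg' _ (.neg' _ ?_)))
      convert SRel.zero r using 1
      linear_combination h₂ - h₁
    · refine key _ (by simp; omega) (Or.inl ?_) (by simp; tauto)
      refine .pos' _ (.skip _ (.pos' _ (.pos' _ ?_)))
      convert SRel.zero r using 1
      linear_combination -h₂
    · refine key _ (by simp; omega) (Or.inl ?_) (by simp; tauto)
      refine .pos' _ (.skip _ (.pos' _ (.pos' _ ?_)))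
      convert SRel.zero r using 1
      linear_combination -h₂
    · exact key _ (by simp; omega) (Or.inl (.three h₁ _)) (by simp; tauto)
    · exact key _ (by simp; omega) (Or.inl (.three h₁ _)) (by simp; tauto)
  · rw [bd_sy_six]
    simp only [List.length_cons] at hlen
    refine AddSubgroup.add_mem _ (AddSubgroup.sub_mem _ (AddSubgroup.add_mem _
      (AddSubgroup.sub_mem _ (AddSubgroup.add_mem _ (AddSubgroup.sub_mem _ ?_ ?_) ?_) ?_) ?_) ?_)
      (AddSubgroup.mem_sup_right (cons_bd_mem_NS_six (by omega) h₁ h₂))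
    · exact key _ (by simp; omega) (Or.inl ((SRel.three h₂ _).skip _ |>.skip _)) (by simp; tauto)
    · exact key _ (by simp; omega) (Or.inl ((SRel.three h₂ _).skip _ |>.skip _)) (by simp; tauto)
    · exact key _ (by simp; omega) (Or.inl ((SRel.three h₂ _).skip _ |>.skip _)) (by simp; tauto)
    · exact key _ (by simp; omega) (Or.inl (.three h₁ _)) (by simp; tauto)
    · exact key _ (by simp; omega) (Or.inl (.three h₁ _)) (by simp; tauto)
    · exact key _ (by simp; omega) (Or.inl (.three h₁ _)) (by simp; tauto)

end Faces

namespace Alt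

variable {V : Type} [AddCommGroup V]

theorem sy_neg_snd (x a : V) (l : List V) : sy (x :: -a :: l) = sy (x :: a :: l) := sy_neg [x] a l

theorem sy_neg_third (x y a : V) (l : List V) : sy (x :: y :: -a :: l) = sy (x :: y :: a :: l) :=
  sy_neg [x, y] a l

theorem sy_swap_snd (x a b : V) (l : List V) : sy (x :: a :: b :: l) = - sy (x :: b :: a :: l) :=
  sy_swap [x] a b l

theorem sy_swap_third (x y a b : V) (l : List V) :
    sy (x :: y :: a :: b :: l) = - sy (x :: y :: b :: a :: l) :=
  sy_swap [x, y] a b l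

end Alt

section Congruences

open Alt

variable {n : ℕ} {f : (Fin n → ℤ) →+ ℤ} {v : Fin n → ℤ} {U : Set (Fin n → ℤ)}
  {B : Type} [AddCommGroup B] {q : Alt (Fin n → ℤ) →+ B}

/-- `U` is a set of vectors lying below `v`, with heights measured by `f`. -/
structure Below (f : (Fin n → ℤ) →+ ℤ) (v : Fin n → ℤ) (U : Set (Fin n → ℤ)) : Prop where
  pos : 0 < f v
  neg : ∀ u ∈ U, -u ∈ U
  mem : ∀ u, |f u| < f v → u ∈ U
  le : ∀ u ∈ U, |f u| ≤ f v
  diff : ∀ u (k : ℤ), u ∈ U → u + k • v ∈ U → |k| ≤ 1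

/-- `q` kills the non-generating symbols, the boundaries of double circuits, and the
`M₁`-generators below `v`. -/
structure Kills (U : Set (Fin n → ℤ)) (q : Alt (Fin n → ℤ) →+ B) : Prop where
  ns : ∀ x ∈ NS (Fin n → ℤ), q x = 0
  g2 : ∀ l, IsG2 n l → q (bd (sy l)) = 0
  g1 : ∀ l, IsG1 n l → (∀ x ∈ l, x ∈ U) → q (sy l) = 0

/-- `q` moreover kills the triangles formed by `v` and two entries below `v`. -/
structure KillsTwins (v : Fin n → ℤ) (U : Set (Fin n → ℤ)) (q : Alt (Fin n → ℤ) →+ B) : Prop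
    extends Kills U q where
  twin : ∀ a b r, r.length + 3 = n + 1 → a ∈ U → b ∈ U → (∀ x ∈ r, x ∈ U) →
    (b = a + v ∨ b = a - v) → q (sy (v :: a :: b :: r)) = 0

theorem Below.ne_zero (hU : Below f v U) : v ≠ 0 := fun h => by
  have := hU.pos
  simp [h] at this

theorem Below.smul_eq_zero (hU : Below f v U) {k : ℤ} (h : k • v = 0) : k = 0 := by
  have h1 : f (k • v) = 0 := by rw [h, map_zero]
  rw [map_zsmul, smul_eq_mul] at h1
  exact (mul_eq_zero.1 h1).resolve_right hU.pos.ne'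

theorem Below.ne (hU : Below f v U) {u : Fin n → ℤ} (hu : u ∈ U) : u ≠ v ∧ u ≠ -v := by
  have key : v ∉ U := fun h => by
    have := hU.diff v (-2) h (by convert hU.neg v h using 1; module)
    norm_num at this
  refine ⟨fun h => key (h ▸ hu), fun h => key ?_⟩
  have := hU.neg u hu
  rwa [h, neg_neg] at this

theorem KillsTwins.shift_rest (hq : KillsTwins v U q) (hU : Below f v U)
    {a b c w w' : Fin n → ℤ} {r : List (Fin n → ℤ)} (hlen : r.length + 4 = n)
    (hm : ∀ x ∈ w :: a :: b :: c :: r, x ∈ U) (hw' : w' ∈ U) (h : a + b + c = 0)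
    (hw : w' = w + v ∨ w' = w - v) :
    q (sy (v :: w :: a :: b :: c :: r)) = q (sy (v :: w' :: a :: b :: c :: r)) := by
  obtain ⟨e, he, hev⟩ : ∃ e, w + e + -w' = 0 ∧ (e = v ∨ e = -v) := by
    rcases hw with rfl | rfl
    · exact ⟨v, by abel, Or.inl rfl⟩
    · exact ⟨-v, by abel, Or.inr rfl⟩
  simp only [List.mem_cons, forall_eq_or_imp] at hm
  obtain ⟨hmw, hma, hmb, hmc, hmr⟩ := hm
  have hbd := hq.g2 (w :: e :: (-w') :: a :: b :: c :: r)
    ⟨by simp; omega, Or.inr ⟨_, _, _, _, _, _, _, rfl, he, h⟩⟩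
  have hv : ∀ l, sy (e :: l) = sy (v :: l) := fun l => by
    rcases hev with rfl | rfl
    · rfl
    · exact sy_neg [] v l
  rw [bd_sy_six] at hbd
  simp only [map_add, map_sub, hq.ns _ (cons_bd_mem_NS_six hlen he h), add_zero] at hbd
  have hF : q (sy (w :: (-w') :: a :: b :: c :: r)) = 0 := by
    refine hq.g1 _ ⟨by simp; omega, Or.inl ((SRel.three h _).skip _ |>.skip _)⟩ ?_
    simp only [List.mem_cons, forall_eq_or_imp]
    exact ⟨hmw, hU.neg _ hw', hma, hmb, hmc, hmr⟩
  have hT : ∀ x y, x ∈ U → y ∈ U → q (sy (w :: e :: (-w') :: x :: y :: r)) = 0 := by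
    intro x y hx hy
    rw [sy_swap_front, hv, sy_neg_third v w w', map_neg, neg_eq_zero]
    refine hq.twin w w' _ (by simp; omega) hmw hw' ?_ hw
    simp only [List.mem_cons, forall_eq_or_imp]
    exact ⟨hx, hy, hmr⟩
  rw [hF, hT b c hmb hmc, hT a c hma hmc, hT a b hma hmb, hv, sy_neg_snd v w',
    sy_swap_front w e, hv, map_neg] at hbd
  rw [← sub_eq_zero, ← neg_eq_zero, ← hbd]
  abel

theorem KillsTwins.shift (hq : KillsTwins v U q) (hU : Below f v U)
    {a a' b c : Fin n → ℤ} {r : List (Fin n → ℤ)} (hlen : r.length + 3 = n)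
    (hm : ∀ x ∈ a :: b :: c :: r, x ∈ U) (ha' : a' ∈ U) (h : a + b + c = 0)
    (hw : a' = a + v ∨ a' = a - v) :
    q (sy (v :: a :: b :: c :: r)) = q (sy (v :: a' :: b :: c :: r)) := by
  obtain ⟨e, he, hev⟩ : ∃ e, a + e + -a' = 0 ∧ (e = v ∨ e = -v) := by
    rcases hw with rfl | rfl
    · exact ⟨v, by abel, Or.inl rfl⟩
    · exact ⟨-v, by abel, Or.inr rfl⟩
  simp only [List.mem_cons, forall_eq_or_imp] at hm
  obtain ⟨hma, hmb, hmc, hmr⟩ := hm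
  have hbd := hq.g2 (a :: e :: (-a') :: b :: c :: r)
    ⟨by simp; omega, Or.inl ⟨_, _, _, _, _, _, rfl, he, h⟩⟩
  have hv : ∀ l, sy (e :: l) = sy (v :: l) := fun l => by
    rcases hev with rfl | rfl
    · rfl
    · exact sy_neg [] v l
  rw [bd_sy_five] at hbd
  simp only [map_add, map_sub, hq.ns _ (cons_bd_mem_NS_five hlen he h), sub_zero] at hbd
  have hF : q (sy (a :: (-a') :: b :: c :: r)) = 0 := by
    refine hq.g1 _ ⟨by simp; omega, Or.inl ?_⟩ ?_
    · refine .pos' _ (.skip _ (.pos' _ (.pos' _ ?_)))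
      convert SRel.zero r using 1
      linear_combination -h
    simp only [List.mem_cons, forall_eq_or_imp]
    exact ⟨hma, hU.neg _ ha', hmb, hmc, hmr⟩
  have hT : ∀ x, x ∈ U → q (sy (a :: e :: (-a') :: x :: r)) = 0 := by
    intro x hx
    rw [sy_swap_front, hv, sy_neg_third v a a', map_neg, neg_eq_zero]
    refine hq.twin a a' _ (by simp; omega) hma ha' ?_ hw
    simp only [List.mem_cons, forall_eq_or_imp]
    exact ⟨hx, hmr⟩
  rw [hF, hT b hmb, hT c hmc, hv, sy_neg_snd v a', sy_swap_front a e, hv, map_neg] at hbd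
  rw [← sub_eq_zero, ← neg_eq_zero, ← hbd]
  abel

theorem Kills.split_four (hq : Kills U q)
    {a b c d : Fin n → ℤ} {r : List (Fin n → ℤ)} (hlen : r.length + 4 = n)
    (h : a + b + c + d = 0) :
    q (sy (v :: a :: b :: c :: d :: r)) =
      q (sy (v :: (a + b) :: c :: d :: b :: r)) - q (sy (v :: (a + b) :: c :: d :: a :: r)) +
      q (sy (v :: -(a + b) :: a :: b :: d :: r)) - q (sy (v :: -(a + b) :: a :: b :: c :: r)) := by
  have h₁ : -(a + b) + a + b = 0 := by ring
  have h₂ : -(a + b) + (-c) + (-d) = 0 := by linear_combination -h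
  have hbd := hq.g2 (-(a + b) :: a :: b :: (-c) :: (-d) :: v :: r)
    ⟨by simp; omega, Or.inl ⟨_, _, _, _, _, _, rfl, h₁, h₂⟩⟩
  rw [bd_sy_five] at hbd
  simp only [map_add, map_sub, hq.ns _ (cons_bd_mem_NS_five (r := v :: r) (by simp; omega) h₁ h₂),
    sub_zero] at hbd
  have hs : ∀ x y z w : Fin n → ℤ, ∀ l, sy (x :: y :: z :: w :: v :: l) =
      sy (v :: x :: y :: z :: w :: l) := fun x y z w l => by
    simpa using sy_middle [x, y, z, w] v l
  have hn : ∀ x y l, sy (v :: x :: y :: (-c) :: (-d) :: l) = sy (v :: x :: y :: c :: d :: l) :=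
    fun x y l => (sy_neg [v, x, y] c (-d :: l)).trans (sy_neg [v, x, y, c] d l)
  have hn' : ∀ x y z, sy (v :: x :: y :: z :: (-c) :: r) = sy (v :: x :: y :: z :: c :: r) :=
    fun x y z => sy_neg [v, x, y, z] c r
  have hn'' : ∀ x y z, sy (v :: x :: y :: z :: (-d) :: r) = sy (v :: x :: y :: z :: d :: r) :=
    fun x y z => sy_neg [v, x, y, z] d r
  have hr : ∀ x, sy (v :: -(a + b) :: x :: c :: d :: r) = sy (v :: (a + b) :: c :: d :: x :: r) :=
    fun x => by
      rw [sy_neg_snd v (a + b), sy_swap_third v (a + b) x c]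
      have h2 := sy_swap [v, a + b, c] x d r
      simp only [List.cons_append, List.nil_append] at h2
      rw [h2, neg_neg]
  simp only [hs, hn, hn', hn'', hr] at hbd
  rw [← sub_eq_zero, ← hbd]
  abel

end Congruences

section Independence

open Alt

variable {n : ℕ} {f : (Fin n → ℤ) →+ ℤ} {v : Fin n → ℤ} {U : Set (Fin n → ℤ)}
  {B : Type} [AddCommGroup B] {q : Alt (Fin n → ℤ) →+ B}

/-- `y` differs from `x` by a multiple of `v`. -/
def Lifts (v x y : Fin n → ℤ) : Prop := ∃ k : ℤ, y = x + k • v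

theorem Lifts.refl (v x : Fin n → ℤ) : Lifts v x x := ⟨0, by simp⟩

theorem Lifts.symm {x y : Fin n → ℤ} : Lifts v x y → Lifts v y x := by
  rintro ⟨k, rfl⟩
  exact ⟨-k, by module⟩

theorem Lifts.trans {x y z : Fin n → ℤ} : Lifts v x y → Lifts v y z → Lifts v x z := by
  rintro ⟨k, rfl⟩ ⟨l, rfl⟩
  exact ⟨k + l, by module⟩

theorem Lifts.neg {x y : Fin n → ℤ} : Lifts v x y → Lifts v (-x) (-y) := by
  rintro ⟨k, rfl⟩
  exact ⟨-k, by module⟩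

theorem Lifts.add {x y x' y' : Fin n → ℤ} :
    Lifts v x y → Lifts v x' y' → Lifts v (x + x') (y + y') := by
  rintro ⟨k, rfl⟩ ⟨l, rfl⟩
  exact ⟨k + l, by module⟩

theorem Below.lift_cases (hU : Below f v U) {x y : Fin n → ℤ} (hx : x ∈ U) (hy : y ∈ U)
    (h : Lifts v x y) : y = x ∨ y = x + v ∨ y = x - v := by
  obtain ⟨k, rfl⟩ := h
  have := abs_le.1 (hU.diff x k hx hy)
  obtain rfl | rfl | rfl : k = 0 ∨ k = 1 ∨ k = -1 := by omega
  · left; module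
  · right; left; module
  · right; right; module

theorem KillsTwins.shift_rest_any (hq : KillsTwins v U q) (hU : Below f v U)
    {a b c w w' : Fin n → ℤ} {l₁ l₂ : List (Fin n → ℤ)} (hlen : (l₁ ++ w :: l₂).length + 3 = n)
    (hm : ∀ x ∈ a :: b :: c :: (l₁ ++ w :: l₂), x ∈ U) (hw' : w' ∈ U) (h : a + b + c = 0)
    (hw : Lifts v w w') :
    q (sy (v :: a :: b :: c :: (l₁ ++ w :: l₂))) =
      q (sy (v :: a :: b :: c :: (l₁ ++ w' :: l₂))) := by
  have hs : ∀ x, sy (v :: a :: b :: c :: (l₁ ++ x :: l₂)) =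
      -((-1 : ℤ) ^ (v :: a :: b :: c :: l₁).length •
        sy (v :: x :: a :: b :: c :: (l₁ ++ l₂))) := fun x => by
    have := sy_middle (v :: a :: b :: c :: l₁) x l₂
    simp only [List.cons_append] at this
    rw [this, sy_swap_front, smul_neg]
  simp only [List.mem_cons, List.mem_append, or_imp, forall_and,
    forall_eq] at hm
  obtain ⟨ha, hb, hc, h₁, hwU, h₂⟩ := hm
  rcases hU.lift_cases hwU hw' hw with h0 | h0
  · rw [h0]
  · rw [hs w, hs w', map_neg, map_neg, map_zsmul, map_zsmul,
      hq.shift_rest hU (by simp at hlen ⊢; omega) (w' := w') _ hw' h h0]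
    simp only [List.mem_cons, List.mem_append, or_imp, forall_and,
      forall_eq]
    exact ⟨hwU, ha, hb, hc, h₁, h₂⟩

theorem KillsTwins.rest_indep (hq : KillsTwins v U q) (hU : Below f v U)
    {a b c : Fin n → ℤ} {r r' : List (Fin n → ℤ)} (hlen : r.length + 3 = n)
    (hm : ∀ x ∈ a :: b :: c :: r, x ∈ U) (hr' : ∀ x ∈ r', x ∈ U) (h : a + b + c = 0)
    (hr : List.Forall₂ (Lifts v) r r') :
    q (sy (v :: a :: b :: c :: r)) = q (sy (v :: a :: b :: c :: r')) := by
  suffices H : ∀ l₁ : List (Fin n → ℤ), (l₁ ++ r).length + 3 = n →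
      (∀ x ∈ a :: b :: c :: (l₁ ++ r), x ∈ U) →
      q (sy (v :: a :: b :: c :: (l₁ ++ r))) = q (sy (v :: a :: b :: c :: (l₁ ++ r'))) from
    H [] hlen hm
  clear hlen hm
  induction hr with
  | nil => intros; rfl
  | @cons w w' r r' hw hr ih =>
    intro l₁ hlen hm
    have hw' : w' ∈ U := hr' w' List.mem_cons_self
    rw [hq.shift_rest_any hU hlen hm hw' h hw]
    have := ih (fun x hx => hr' x (List.mem_cons_of_mem _ hx)) (l₁ ++ [w'])
      (by simp at hlen ⊢; omega) (by
        simp only [List.mem_cons, List.mem_append, or_imp, forall_and, forall_eq,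
          List.not_mem_nil] at hm ⊢
        obtain ⟨ha, hb, hc, h₁, -, h₂⟩ := hm
        exact ⟨ha, hb, hc, ⟨h₁, hw', fun _ h => h.elim⟩, h₂⟩)
    simpa using this

theorem sy_triple_swap {V : Type} [AddCommGroup V] (v a b c : V) (r : List V) :
    sy (v :: c :: b :: a :: r) = - sy (v :: a :: b :: c :: r) := by
  rw [sy_swap_snd v c b, sy_swap_third v b c a, sy_swap_snd v b a, neg_neg]

theorem KillsTwins.exact_of_sub_mem (hq : KillsTwins v U q) (hU : Below f v U)
    {a b c : Fin n → ℤ} {r : List (Fin n → ℤ)} {κ : ℤ} (hlen : r.length + 3 = n)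
    (hm : ∀ x ∈ a :: b :: c :: r, x ∈ U) (h : a + b + c = κ • v) (hκ : κ = 1 ∨ κ = -1)
    (ha' : a - κ • v ∈ U) :
    q (sy (v :: a :: b :: c :: r)) = q (sy (v :: (a - κ • v) :: b :: c :: r)) := by
  simp only [List.mem_cons, forall_eq_or_imp] at hm
  refine (hq.shift hU hlen ?_ hm.1 (by linear_combination h) ?_).symm
  · simp only [List.mem_cons, forall_eq_or_imp]
    exact ⟨ha', hm.2⟩
  · rcases hκ with rfl | rfl
    · left; module
    · right; module

theorem KillsTwins.exists_exact (hq : KillsTwins v U q) (hU : Below f v U)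
    {a b c : Fin n → ℤ} {r : List (Fin n → ℤ)} {κ : ℤ} (hlen : r.length + 3 = n)
    (hm : ∀ x ∈ a :: b :: c :: r, x ∈ U) (h : a + b + c = κ • v) (hκ : |κ| ≤ 1) :
    ∃ a' b' c', a' ∈ U ∧ b' ∈ U ∧ c' ∈ U ∧ Lifts v a a' ∧ Lifts v b b' ∧ Lifts v c c' ∧
      a' + b' + c' = 0 ∧
      q (sy (v :: a :: b :: c :: r)) = q (sy (v :: a' :: b' :: c' :: r)) := by
  have hm' := hm
  simp only [List.mem_cons, forall_eq_or_imp] at hm'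
  obtain ⟨ha, hb, hc, hr⟩ := hm'
  have hκ' := abs_le.1 hκ
  by_cases h0 : κ = 0
  · exact ⟨a, b, c, ha, hb, hc, .refl _ _, .refl _ _, .refl _ _, by rw [h, h0, zero_smul], rfl⟩
  have hκ1 : κ = 1 ∨ κ = -1 := by omega
  have hf : f a + f b + f c = κ * f v := by
    rw [← map_add, ← map_add, h, map_zsmul, smul_eq_mul]
  have hl : ∀ x, Lifts v x (x - κ • v) := fun x => ⟨-κ, by module⟩
  have hsub : ∀ x ∈ U, 0 < κ * f x → x - κ • v ∈ U := fun x hx hpos => by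
    refine hU.mem _ ?_
    have h1 := abs_le.1 (hU.le x hx)
    have h2 := hU.pos
    rw [map_sub, map_zsmul, smul_eq_mul, abs_lt]
    rcases hκ1 with rfl | rfl <;> constructor <;> omega
  have hcase : 0 < κ * f a ∨ 0 < κ * f b ∨ 0 < κ * f c := by
    have h2 := hU.pos
    rcases hκ1 with rfl | rfl <;> omega
  rcases hcase with hpos | hpos | hpos
  · exact ⟨a - κ • v, b, c, hsub a ha hpos, hb, hc, hl a, .refl _ _, .refl _ _,
      by linear_combination h, hq.exact_of_sub_mem hU hlen hm h hκ1 (hsub a ha hpos)⟩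
  · refine ⟨a, b - κ • v, c, ha, hsub b hb hpos, hc, .refl _ _, hl b, .refl _ _,
      by linear_combination h, ?_⟩
    rw [sy_swap_snd v a b, sy_swap_snd v a (b - κ • v), map_neg, map_neg,
      hq.exact_of_sub_mem hU hlen _ (by linear_combination h) hκ1 (hsub b hb hpos)]
    simp only [List.mem_cons, forall_eq_or_imp]
    exact ⟨hb, ha, hc, hr⟩
  · refine ⟨a, b, c - κ • v, ha, hb, hsub c hc hpos, .refl _ _, .refl _ _, hl c,
      by linear_combination h, ?_⟩
    rw [sy_triple_swap v c b a, sy_triple_swap v (c - κ • v) b a, map_neg, map_neg,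
      hq.exact_of_sub_mem hU hlen _ (by linear_combination h) hκ1 (hsub c hc hpos)]
    simp only [List.mem_cons, forall_eq_or_imp]
    exact ⟨hc, hb, ha, hr⟩

theorem KillsTwins.exchange (hq : KillsTwins v U q) (hU : Below f v U)
    {a b c a' b' : Fin n → ℤ} {r : List (Fin n → ℤ)} (hlen : r.length + 3 = n)
    (hm : ∀ x ∈ a :: b :: c :: r, x ∈ U) (ha' : a' ∈ U) (hb' : b' ∈ U) (h : a + b + c = 0)
    (h' : a' + b' + c = 0) (hl : Lifts v a a') :
    q (sy (v :: a :: b :: c :: r)) = q (sy (v :: a' :: b' :: c :: r)) := by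
  have hm' := hm
  simp only [List.mem_cons, forall_eq_or_imp] at hm'
  obtain ⟨ha, hb, hc, hr⟩ := hm'
  rcases hU.lift_cases ha ha' hl with h0 | h0
  · obtain rfl : b' = b := by rw [h0] at h'; linear_combination h' - h
    rw [h0]
  · rw [hq.shift hU hlen hm ha' h h0, sy_swap_snd v a' b, sy_swap_snd v a' b', map_neg, map_neg,
      hq.shift hU (a := b') (a' := b) hlen _ hb (by linear_combination h')]
    · rcases h0 with rfl | rfl
      · left; linear_combination h - h'
      · right; linear_combination h - h'
    · simp only [List.mem_cons, forall_eq_or_imp]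
      exact ⟨hb', ha', hc, hr⟩

theorem KillsTwins.exact_indep (hq : KillsTwins v U q) (hU : Below f v U)
    {a b c a' b' c' : Fin n → ℤ} {r : List (Fin n → ℤ)} (hlen : r.length + 3 = n)
    (hm : ∀ x ∈ a :: b :: c :: r, x ∈ U) (ha' : a' ∈ U) (hb' : b' ∈ U) (hc' : c' ∈ U)
    (h : a + b + c = 0) (h' : a' + b' + c' = 0)
    (hla : Lifts v a a') (hlb : Lifts v b b') (hlc : Lifts v c c') :
    q (sy (v :: a :: b :: c :: r)) = q (sy (v :: a' :: b' :: c' :: r)) := by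
  have hm' := hm
  simp only [List.mem_cons, forall_eq_or_imp] at hm'
  obtain ⟨ha, hb, hc, hr⟩ := hm'
  obtain ⟨i, rfl⟩ := hla
  obtain ⟨j, rfl⟩ := hlb
  obtain ⟨k, rfl⟩ := hlc
  have hi := abs_le.1 (hU.diff _ _ ha ha')
  have hj := abs_le.1 (hU.diff _ _ hb hb')
  have hk := abs_le.1 (hU.diff _ _ hc hc')
  have hs : i + j + k = 0 := hU.smul_eq_zero (by
    rw [add_smul, add_smul]; linear_combination h' - h)
  obtain hk0 | hj0 | hi0 : k = 0 ∨ j = 0 ∨ i = 0 := by omega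
  · subst hk0
    rw [zero_smul, add_zero] at *
    exact hq.exchange hU hlen hm ha' hb' h h' ⟨i, rfl⟩
  · subst hj0
    rw [zero_smul, add_zero] at *
    rw [sy_swap_third v a b, sy_swap_third v (a + i • v) b, map_neg, map_neg,
      hq.exchange hU hlen _ ha' hc' (by linear_combination h) (by linear_combination h') ⟨i, rfl⟩]
    simp only [List.mem_cons, forall_eq_or_imp]
    exact ⟨ha, hc, hb, hr⟩
  · subst hi0
    rw [zero_smul, add_zero] at *
    rw [sy_triple_swap v c b a, sy_triple_swap v (c + k • v) (b + j • v) a, map_neg, map_neg,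
      hq.exchange hU hlen _ hc' hb' (by linear_combination h) (by linear_combination h') ⟨k, rfl⟩]
    simp only [List.mem_cons, forall_eq_or_imp]
    exact ⟨hc, hb, ha, hr⟩

theorem KillsTwins.triangle_indep (hq : KillsTwins v U q) (hU : Below f v U)
    {a b c a' b' c' : Fin n → ℤ} {r r' : List (Fin n → ℤ)} {κ κ' : ℤ} (hlen : r.length + 3 = n)
    (hm : ∀ x ∈ a :: b :: c :: r, x ∈ U) (hm' : ∀ x ∈ a' :: b' :: c' :: r', x ∈ U)
    (h : a + b + c = κ • v) (h' : a' + b' + c' = κ' • v) (hκ : |κ| ≤ 1) (hκ' : |κ'| ≤ 1)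
    (hl : List.Forall₂ (Lifts v) (a :: b :: c :: r) (a' :: b' :: c' :: r')) :
    q (sy (v :: a :: b :: c :: r)) = q (sy (v :: a' :: b' :: c' :: r')) := by
  simp only [List.forall₂_cons] at hl
  obtain ⟨hla, hlb, hlc, hlr⟩ := hl
  have hlen' : r'.length + 3 = n := hlr.length_eq ▸ hlen
  obtain ⟨a₁, b₁, c₁, ha₁, hb₁, hc₁, hla₁, hlb₁, hlc₁, h₁, e₁⟩ := hq.exists_exact hU hlen hm h hκ
  obtain ⟨a₂, b₂, c₂, ha₂, hb₂, hc₂, hla₂, hlb₂, hlc₂, h₂, e₂⟩ :=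
    hq.exists_exact hU hlen' hm' h' hκ'
  simp only [List.mem_cons, forall_eq_or_imp] at hm hm'
  have hm₁ : ∀ x ∈ a₁ :: b₁ :: c₁ :: r, x ∈ U := by
    simp only [List.mem_cons, forall_eq_or_imp]
    exact ⟨ha₁, hb₁, hc₁, hm.2.2.2⟩
  have hm₁' : ∀ x ∈ a₁ :: b₁ :: c₁ :: r', x ∈ U := by
    simp only [List.mem_cons, forall_eq_or_imp]
    exact ⟨ha₁, hb₁, hc₁, hm'.2.2.2⟩
  rw [e₁, e₂, hq.rest_indep hU hlen hm₁ hm'.2.2.2 h₁ hlr,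
    hq.exact_indep hU hlen' hm₁' ha₂ hb₂ hc₂ h₁ h₂ ((hla₁.symm.trans hla).trans hla₂)
      ((hlb₁.symm.trans hlb).trans hlb₂) ((hlc₁.symm.trans hlc).trans hlc₂)]

end Independence

section FourCircuits

open Alt

variable {n : ℕ} {f : (Fin n → ℤ) →+ ℤ} {v : Fin n → ℤ} {U : Set (Fin n → ℤ)}
  {B : Type} [AddCommGroup B] {q : Alt (Fin n → ℤ) →+ B}

theorem KillsTwins.four_of_diagonal (hq : KillsTwins v U q) (hU : Below f v U)
    {a b c d a' b' c' d' : Fin n → ℤ} {r r' : List (Fin n → ℤ)} (hlen : r.length + 4 = n)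
    (hm : ∀ x ∈ a :: b :: c :: d :: r, x ∈ U) (hm' : ∀ x ∈ a' :: b' :: c' :: d' :: r', x ∈ U)
    (h : a + b + c + d = 0) (h' : a' + b' + c' + d' = 0)
    (hl : List.Forall₂ (Lifts v) (a :: b :: c :: d :: r) (a' :: b' :: c' :: d' :: r'))
    (he : a + b ∈ U) (he' : a' + b' ∈ U) :
    q (sy (v :: a :: b :: c :: d :: r)) = q (sy (v :: a' :: b' :: c' :: d' :: r')) := by
  simp only [List.forall₂_cons] at hl
  obtain ⟨hla, hlb, hlc, hld, hlr⟩ := hl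
  simp only [List.mem_cons, forall_eq_or_imp] at hm hm'
  obtain ⟨ha, hb, hc, hd, hr⟩ := hm
  obtain ⟨ha', hb', hc', hd', hr'⟩ := hm'
  have hlen' : r'.length + 4 = n := hlr.length_eq ▸ hlen
  have key : ∀ x y z w x' y' z' w' : Fin n → ℤ, x ∈ U → y ∈ U → z ∈ U → w ∈ U →
      x' ∈ U → y' ∈ U → z' ∈ U → w' ∈ U → Lifts v x x' → Lifts v y y' → Lifts v z z' →
      Lifts v w w' → x + y + z = 0 → x' + y' + z' = 0 →
      q (sy (v :: x :: y :: z :: w :: r)) = q (sy (v :: x' :: y' :: z' :: w' :: r')) := by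
    intro x y z w x' y' z' w' hx hy hz hw hx' hy' hz' hw' h₁ h₂ h₃ h₄ h₅ h₆
    refine hq.triangle_indep hU (κ := 0) (κ' := 0) (by simp; omega) ?_ ?_ (by simpa using h₅)
      (by simpa using h₆) (by simp) (by simp) ?_
    · simp only [List.mem_cons, forall_eq_or_imp]
      exact ⟨hx, hy, hz, hw, hr⟩
    · simp only [List.mem_cons, forall_eq_or_imp]
      exact ⟨hx', hy', hz', hw', hr'⟩
    · simp only [List.forall₂_cons]
      exact ⟨h₁, h₂, h₃, h₄, hlr⟩
  have hne := hU.neg _ he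
  have hne' := hU.neg _ he'
  rw [hq.split_four hlen h, hq.split_four hlen' h',
    key (a + b) c d b (a' + b') c' d' b' he hc hd hb he' hc' hd' hb' (hla.add hlb) hlc hld hlb h h',
    key (a + b) c d a (a' + b') c' d' a' he hc hd ha he' hc' hd' ha' (hla.add hlb) hlc hld hla h h',
    key (-(a + b)) a b d (-(a' + b')) a' b' d' hne ha hb hd hne' ha' hb' hd' (hla.add hlb).neg hla
      hlb hld (by ring) (by ring),
    key (-(a + b)) a b c (-(a' + b')) a' b' c' hne ha hb hc hne' ha' hb' hc' (hla.add hlb).neg hla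
      hlb hlc (by ring) (by ring)]

theorem KillsTwins.four_of_diagonals (hq : KillsTwins v U q) (hU : Below f v U)
    {a b c d a' b' c' d' : Fin n → ℤ} {r r' : List (Fin n → ℤ)} (hlen : r.length + 4 = n)
    (hm : ∀ x ∈ a :: b :: c :: d :: r, x ∈ U) (hm' : ∀ x ∈ a' :: b' :: c' :: d' :: r', x ∈ U)
    (h : a + b + c + d = 0) (h' : a' + b' + c' + d' = 0)
    (hl : List.Forall₂ (Lifts v) (a :: b :: c :: d :: r) (a' :: b' :: c' :: d' :: r'))
    (he : (a + b ∈ U ∧ a' + b' ∈ U) ∨ (a + c ∈ U ∧ a' + c' ∈ U) ∨ (b + c ∈ U ∧ b' + c' ∈ U)) :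
    q (sy (v :: a :: b :: c :: d :: r)) = q (sy (v :: a' :: b' :: c' :: d' :: r')) := by
  rcases he with ⟨he, he'⟩ | ⟨he, he'⟩ | ⟨he, he'⟩
  · exact hq.four_of_diagonal hU hlen hm hm' h h' hl he he'
  · simp only [List.mem_cons, forall_eq_or_imp, List.forall₂_cons] at hm hm' hl
    rw [sy_swap_third v a b, sy_swap_third v a' b', map_neg, map_neg,
      hq.four_of_diagonal hU (b' := c') (c' := b') (d' := d') (r' := r') hlen _ _
        (by linear_combination h) (by linear_combination h') _ he he']
    · simp only [List.mem_cons, forall_eq_or_imp]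
      tauto
    · simp only [List.mem_cons, forall_eq_or_imp]
      tauto
    · simp only [List.forall₂_cons]
      tauto
  · simp only [List.mem_cons, forall_eq_or_imp, List.forall₂_cons] at hm hm' hl
    rw [sy_swap_snd v a b, sy_swap_snd v a' b', sy_swap_third v b a, sy_swap_third v b' a',
      map_neg, map_neg, map_neg, map_neg,
      hq.four_of_diagonal hU (b' := c') (c' := a') (d' := d') (r' := r') hlen _ _
        (by linear_combination h) (by linear_combination h') _ he he']
    · simp only [List.mem_cons, forall_eq_or_imp]
      tauto
    · simp only [List.mem_cons, forall_eq_or_imp]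
      tauto
    · simp only [List.forall₂_cons]
      tauto

/-- If the heights of a four-circuit are not all in `{0, ±R}`, at most one diagonal is too high. -/
theorem diagonals_lt {R x y z w : ℤ} (hx : |x| ≤ R) (hy : |y| ≤ R) (hz : |z| ≤ R)
    (hw : |w| ≤ R) (hs : x + y + z + w = 0)
    (h : ¬ ((x = 0 ∨ x = R ∨ x = -R) ∧ (y = 0 ∨ y = R ∨ y = -R) ∧ (z = 0 ∨ z = R ∨ z = -R) ∧
      (w = 0 ∨ w = R ∨ w = -R))) :
    (|x + y| < R ∧ |x + z| < R) ∨ (|x + y| < R ∧ |y + z| < R) ∨ (|x + z| < R ∧ |y + z| < R) := by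
  simp only [abs_le, abs_lt] at *
  omega

theorem exists_diagonal_lt {R x y z w : ℤ} (hR : 0 < R) (hs : x + y + z + w = 0)
    (hx : x = 0 ∨ x = R ∨ x = -R) (hy : y = 0 ∨ y = R ∨ y = -R) (hz : z = 0 ∨ z = R ∨ z = -R)
    (hw : w = 0 ∨ w = R ∨ w = -R) :
    |x + y| < R ∨ |x + z| < R ∨ |y + z| < R := by
  simp only [abs_lt]
  omega

theorem KillsTwins.four_indep (hq : KillsTwins v U q) (hU : Below f v U)
    {a b c d a' b' c' d' : Fin n → ℤ} {r r' : List (Fin n → ℤ)} (hlen : r.length + 4 = n)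
    (hm : ∀ x ∈ a :: b :: c :: d :: r, x ∈ U) (hm' : ∀ x ∈ a' :: b' :: c' :: d' :: r', x ∈ U)
    (h : a + b + c + d = 0) (h' : a' + b' + c' + d' = 0)
    (hl : List.Forall₂ (Lifts v) (a :: b :: c :: d :: r) (a' :: b' :: c' :: d' :: r')) :
    q (sy (v :: a :: b :: c :: d :: r)) = q (sy (v :: a' :: b' :: c' :: d' :: r')) := by
  have hl' := hl
  simp only [List.forall₂_cons] at hl'
  obtain ⟨hla, hlb, hlc, hld, hlr⟩ := hl'
  have hmm := hm
  have hmm' := hm'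
  simp only [List.mem_cons, forall_eq_or_imp] at hmm hmm'
  obtain ⟨ha, hb, hc, hd, hr⟩ := hmm
  obtain ⟨ha', hb', hc', hd', hr'⟩ := hmm'
  have hpos := hU.pos
  have hf : f a + f b + f c + f d = 0 := by rw [← map_add, ← map_add, ← map_add, h, map_zero]
  have hf' : f a' + f b' + f c' + f d' = 0 := by rw [← map_add, ← map_add, ← map_add, h', map_zero]
  let Z : ℤ → Prop := fun x => x = 0 ∨ x = f v ∨ x = -f v
  have hmem : ∀ x y, |f x + f y| < f v → x + y ∈ U := fun x y hxy =>
    hU.mem _ (by rwa [map_add])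
  have hZ : ∀ x y, y ∈ U → Lifts v x y → Z (f x) → Z (f y) := by
    rintro x _ hy ⟨k, rfl⟩ hx
    have h1 := abs_le.1 (hU.le _ hy)
    rw [map_add, map_zsmul, smul_eq_mul] at h1 ⊢
    obtain ⟨j, hj⟩ : ∃ j, f x + k * f v = j * f v := by
      rcases hx with hx | hx | hx <;> rw [hx]
      · exact ⟨k, by ring⟩
      · exact ⟨k + 1, by ring⟩
      · exact ⟨k - 1, by ring⟩
    rw [hj] at h1 ⊢
    have h2 : j ≤ 1 := by nlinarith
    have h3 : -1 ≤ j := by nlinarith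
    obtain rfl | rfl | rfl : j = 0 ∨ j = 1 ∨ j = -1 := by omega
    · left; ring
    · right; left; ring
    · right; right; ring
  by_cases hall : Z (f a) ∧ Z (f b) ∧ Z (f c) ∧ Z (f d)
  · have hall' : Z (f a') ∧ Z (f b') ∧ Z (f c') ∧ Z (f d') :=
      ⟨hZ _ _ ha' hla hall.1, hZ _ _ hb' hlb hall.2.1, hZ _ _ hc' hlc hall.2.2.1,
        hZ _ _ hd' hld hall.2.2.2⟩
    have hlev : ∀ x, Z (f x) → ∃ y, Lifts v x y ∧ f y = 0 := by
      rintro x (hx | hx | hx)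
      · exact ⟨x, .refl _ _, hx⟩
      · exact ⟨x + (-1 : ℤ) • v, ⟨_, rfl⟩, by simp [hx]⟩
      · exact ⟨x + (1 : ℤ) • v, ⟨_, rfl⟩, by simp [hx]⟩
    obtain ⟨a₀, hla₀, ha₀⟩ := hlev a hall.1
    obtain ⟨b₀, hlb₀, hb₀⟩ := hlev b hall.2.1
    obtain ⟨c₀, hlc₀, hc₀⟩ := hlev c hall.2.2.1
    obtain ⟨d₀, hld₀, hd₀⟩ := hlev d hall.2.2.2
    have h₀ : a₀ + b₀ + c₀ + d₀ = 0 := by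
      obtain ⟨k, hk⟩ := ((hla₀.add hlb₀).add hlc₀).add hld₀
      rw [h, zero_add] at hk
      have h1 := congrArg f hk
      rw [map_add, map_add, map_add, ha₀, hb₀, hc₀, hd₀, map_zsmul, smul_eq_mul] at h1
      have hk0 : k = 0 := by
        rcases mul_eq_zero.1 (show k * f v = 0 by linarith) with h2 | h2
        · exact h2
        · omega
      rw [hk, hk0, zero_smul]
    have h0U : ∀ x, f x = 0 → x ∈ U := fun x hx => hU.mem x (by rw [hx]; simpa using hpos)
    have hm₀ : ∀ x ∈ a₀ :: b₀ :: c₀ :: d₀ :: r, x ∈ U := by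
      simp only [List.mem_cons, forall_eq_or_imp]
      exact ⟨h0U _ ha₀, h0U _ hb₀, h0U _ hc₀, h0U _ hd₀, hr⟩
    have e₁ := hq.four_of_diagonals hU (r' := r) hlen hm hm₀ h h₀
      (by
        simp only [List.forall₂_cons]
        exact ⟨hla₀, hlb₀, hlc₀, hld₀, List.forall₂_same.2 fun _ _ => .refl _ _⟩)
      ((exists_diagonal_lt hpos hf hall.1 hall.2.1 hall.2.2.1 hall.2.2.2).imp
        (fun h => ⟨hmem _ _ h, h0U _ (by simp [ha₀, hb₀])⟩) (Or.imp
        (fun h => ⟨hmem _ _ h, h0U _ (by simp [ha₀, hc₀])⟩)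
        (fun h => ⟨hmem _ _ h, h0U _ (by simp [hb₀, hc₀])⟩)))
    have e₂ := hq.four_of_diagonals hU (r := r) (r' := r') hlen hm₀ hm' h₀ h'
      (by
        simp only [List.forall₂_cons]
        exact ⟨hla₀.symm.trans hla, hlb₀.symm.trans hlb, hlc₀.symm.trans hlc,
          hld₀.symm.trans hld, hlr⟩)
      ((exists_diagonal_lt hpos hf' hall'.1 hall'.2.1 hall'.2.2.1 hall'.2.2.2).imp
        (fun h => ⟨h0U _ (by simp [ha₀, hb₀]), hmem _ _ h⟩) (Or.imp
        (fun h => ⟨h0U _ (by simp [ha₀, hc₀]), hmem _ _ h⟩)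
        (fun h => ⟨h0U _ (by simp [hb₀, hc₀]), hmem _ _ h⟩)))
    rw [e₁, e₂]
  · have hall' : ¬ (Z (f a') ∧ Z (f b') ∧ Z (f c') ∧ Z (f d')) := fun hz => hall
      ⟨hZ _ _ ha hla.symm hz.1, hZ _ _ hb hlb.symm hz.2.1, hZ _ _ hc hlc.symm hz.2.2.1,
        hZ _ _ hd hld.symm hz.2.2.2⟩
    have g₁ := diagonals_lt (hU.le _ ha) (hU.le _ hb) (hU.le _ hc) (hU.le _ hd) hf hall
    have g₂ := diagonals_lt (hU.le _ ha') (hU.le _ hb') (hU.le _ hc') (hU.le _ hd') hf' hall'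
    refine hq.four_of_diagonals hU hlen hm hm' h h' hl ?_
    have m₁ := hmem a b
    have m₂ := hmem a c
    have m₃ := hmem b c
    have m₁' := hmem a' b'
    have m₂' := hmem a' c'
    have m₃' := hmem b' c'
    rcases g₁ with ⟨_, _⟩ | ⟨_, _⟩ | ⟨_, _⟩ <;> rcases g₂ with ⟨_, _⟩ | ⟨_, _⟩ | ⟨_, _⟩ <;>
    first
    | exact Or.inl ⟨m₁ ‹_›, m₁' ‹_›⟩
    | exact Or.inr (Or.inl ⟨m₂ ‹_›, m₂' ‹_›⟩)
    | exact Or.inr (Or.inr ⟨m₃ ‹_›, m₃' ‹_›⟩)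

end FourCircuits

section NormalForm

variable {V W : Type} [AddCommGroup V] [AddCommGroup W]

/-- Two lists agree up to the signs of their entries. -/
abbrev UpToSigns (l l' : List V) : Prop := List.Forall₂ (fun a b => b = a ∨ b = -a) l l'

theorem UpToSigns.refl (l : List V) : UpToSigns l l := List.forall₂_same.2 fun _ _ => Or.inl rfl

theorem UpToSigns.map {l l' : List V} (h : UpToSigns l l') (g : V →+ W) :
    UpToSigns (l.map g) (l'.map g) := by
  induction h with
  | nil => exact .nil
  | cons h _ ih =>
    refine .cons ?_ ih
    rcases h with rfl | rfl
    · exact Or.inl rfl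
    · exact Or.inr (map_neg _ _)

theorem UpToSigns.forall_mem {l l' : List V} (h : UpToSigns l l') {D : V → Prop}
    (hD : ∀ x, D x → D (-x)) (hl : ∀ x ∈ l, D x) : ∀ x ∈ l', D x := by
  induction h with
  | nil => simp
  | cons h _ ih =>
    simp only [List.mem_cons, forall_eq_or_imp] at hl ⊢
    refine ⟨?_, ih hl.2⟩
    rcases h with rfl | rfl
    · exact hl.1
    · exact hD _ hl.1

theorem UpToSigns.symm {l l' : List V} (h : UpToSigns l l') : UpToSigns l' l :=
  h.flip.imp fun a b hab => by
    rcases hab with rfl | rfl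
    · exact Or.inl rfl
    · exact Or.inr (neg_neg _).symm

theorem SRel.exists_normal (g : V →+ W) {P : List V} {k : ℕ} {y : W} (h : SRel (P.map g) k y) :
    ∃ E R : List V, E.length = k ∧ g E.sum = y ∧ ∃ Q, P.Perm Q ∧ UpToSigns Q (E ++ R) := by
  induction k generalizing P y with
  | zero => exact ⟨[], P, rfl, by simp [h.eq_zero], P, .refl _, .refl _⟩
  | succ k ih =>
    obtain ⟨a, P', hP, h | h⟩ := h.exists_perm g
    · obtain ⟨E, R, hE, hy, Q, hPQ, hQ⟩ := ih h
      exact ⟨a :: E, R, by simp [hE], by simp [hy], a :: Q, hP.trans (hPQ.cons a),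
        .cons (Or.inl rfl) hQ⟩
    · obtain ⟨E, R, hE, hy, Q, hPQ, hQ⟩ := ih h
      exact ⟨-a :: E, R, by simp [hE], by simp [hy], a :: Q, hP.trans (hPQ.cons a),
        .cons (Or.inr rfl) hQ⟩

theorem exists_pairs {A B : Type} {R : A → B → Prop} {l : List A} {l' : List B}
    (h : List.Forall₂ R l l') :
    ∃ P : List (A × B), P.map Prod.fst = l ∧ P.map Prod.snd = l' ∧ ∀ z ∈ P, R z.1 z.2 := by
  induction h with
  | nil => exact ⟨[], by simp⟩
  | @cons a b _ _ h _ ih =>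
    obtain ⟨P, h₁, h₂, h₃⟩ := ih
    exact ⟨(a, b) :: P, by simp [h₁], by simp [h₂], by
      simp only [List.mem_cons, forall_eq_or_imp]; exact ⟨h, h₃⟩⟩

end NormalForm

section Admissible

open Alt

variable {n : ℕ} {f : (Fin n → ℤ) →+ ℤ} {v : Fin n → ℤ} {U : Set (Fin n → ℤ)}
  {B : Type} [AddCommGroup B] {q : Alt (Fin n → ℤ) →+ B}

/-- Lists below `v` that generate together with `v` and become a generator of `M₁` modulo `v`. -/
def Admissible (v : Fin n → ℤ) (U : Set (Fin n → ℤ)) (L : List (Fin n → ℤ)) : Prop :=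
  (∀ x ∈ L, x ∈ U) ∧ L.length = n ∧ Sp (v :: L) ∧
    ∃ (j : ℕ) (κ : ℤ), SRel L j (κ • v) ∧ ((j = 3 ∧ |κ| ≤ 1) ∨ (j = 4 ∧ κ = 0))

theorem Admissible.upToSigns (hU : Below f v U) {L L' : List (Fin n → ℤ)} (h : Admissible v U L)
    (hL : UpToSigns L L') : Admissible v U L' := by
  obtain ⟨h₁, h₂, h₃, j, κ, h₄, h₅⟩ := h
  exact ⟨hL.forall_mem hU.neg h₁, hL.length_eq ▸ h₂, h₃.forall₂ (.cons (Or.inl rfl) hL),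
    j, κ, h₄.forall₂ hL, h₅⟩

theorem Admissible.perm {L L' : List (Fin n → ℤ)} (h : Admissible v U L)
    (hL : L.Perm L') : Admissible v U L' := by
  obtain ⟨h₁, h₂, h₃, j, κ, h₄, h₅⟩ := h
  exact ⟨fun x hx => h₁ x (hL.symm.subset hx), hL.length_eq ▸ h₂, h₃.perm (hL.cons v),
    j, κ, h₄.perm hL, h₅⟩

/-- `y` differs from `x` or `-x` by a multiple of `v`. -/
def SignedLifts (v x y : Fin n → ℤ) : Prop := Lifts v x y ∨ Lifts v x (-y)

theorem exists_lifts_upToSigns {L L' : List (Fin n → ℤ)}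
    (h : List.Forall₂ (SignedLifts v) L L') :
    ∃ L'', List.Forall₂ (Lifts v) L L'' ∧ UpToSigns L' L'' := by
  induction h with
  | nil => exact ⟨[], .nil, .nil⟩
  | @cons x y _ _ h _ ih =>
    obtain ⟨L'', h₁, h₂⟩ := ih
    rcases h with h | h
    · exact ⟨y :: L'', .cons h h₁, .cons (Or.inl rfl) h₂⟩
    · exact ⟨-y :: L'', .cons h h₁, .cons (Or.inr rfl) h₂⟩

theorem lifts_sum {E : List ((Fin n → ℤ) × (Fin n → ℤ))} (h : ∀ z ∈ E, Lifts v z.1 z.2) :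
    Lifts v E.sum.1 E.sum.2 := by
  induction E with
  | nil => exact .refl _ _
  | cons z E ih =>
    simp only [List.mem_cons, forall_eq_or_imp] at h
    exact h.1.add (ih h.2)

theorem forall₂_map_pairs {E : List ((Fin n → ℤ) × (Fin n → ℤ))} (h : ∀ z ∈ E, Lifts v z.1 z.2) :
    List.Forall₂ (Lifts v) (E.map Prod.fst) (E.map Prod.snd) := by
  induction E with
  | nil => exact .nil
  | cons z E ih =>
    simp only [List.mem_cons, forall_eq_or_imp] at h
    exact .cons h.1 (ih h.2)

theorem KillsTwins.admissible_indep_of_lifts (hq : KillsTwins v U q) (hU : Below f v U)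
    {L L' : List (Fin n → ℤ)} (hL : Admissible v U L) (hL' : Admissible v U L')
    (h : List.Forall₂ (Lifts v) L L') : q (sy (v :: L)) = q (sy (v :: L')) := by
  obtain ⟨P, rfl, rfl, hP⟩ := exists_pairs h
  obtain ⟨hLU, hlen, hsp, j, κ, hr, hj⟩ := hL
  obtain ⟨E, R, rfl, hEs, Q, hPQ, hQ⟩ := SRel.exists_normal (P := P)
    (AddMonoidHom.fst (Fin n → ℤ) (Fin n → ℤ)) hr
  set X := E ++ R with hX
  have hXD : ∀ z ∈ X, z.1 ∈ U ∧ z.2 ∈ U ∧ Lifts v z.1 z.2 := by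
    refine hQ.forall_mem (fun z hz => ⟨hU.neg _ hz.1, hU.neg _ hz.2.1, hz.2.2.neg⟩) ?_
    intro z hz
    have hz' := hPQ.symm.subset hz
    exact ⟨hLU _ (List.mem_map_of_mem hz'), hL'.1 _ (List.mem_map_of_mem hz'), hP z hz'⟩
  have hX₂ : Admissible v U (X.map Prod.snd) :=
    (hL'.perm (hPQ.map Prod.snd)).upToSigns hU (hQ.map (AddMonoidHom.snd _ _))
  have hsy : sy P = sy X ∨ sy P = - sy X := by
    rw [sy_forall₂ hQ]
    exact sy_perm hPQ
  suffices H : q (sy (v :: X.map Prod.fst)) = q (sy (v :: X.map Prod.snd)) by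
    have e₁ : ∀ Y : List ((Fin n → ℤ) × (Fin n → ℤ)),
        q (sy (v :: Y.map Prod.fst)) = q (cons v (map (AddMonoidHom.fst _ _) (sy Y))) := by simp
    have e₂ : ∀ Y : List ((Fin n → ℤ) × (Fin n → ℤ)),
        q (sy (v :: Y.map Prod.snd)) = q (cons v (map (AddMonoidHom.snd _ _) (sy Y))) := by simp
    rw [e₁, e₂] at H ⊢
    rcases hsy with h | h <;> simp only [h, map_neg, H]
  have hXlen : X.length = n := by rw [← hQ.length_eq, ← hPQ.length_eq]; simpa using hlen
  obtain ⟨k, hk⟩ := lifts_sum (v := v) (E := E) fun z hz =>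
    (hXD z (List.mem_append_left _ hz)).2.2
  have hEs' : (E.map Prod.fst).sum = κ • v := by
    rw [← hEs]
    exact (map_list_sum (AddMonoidHom.fst (Fin n → ℤ) (Fin n → ℤ)) E).symm
  have hEs₂ : (E.map Prod.snd).sum = (κ + k) • v := by
    have h1 : E.sum.2 = (E.map Prod.snd).sum :=
      map_list_sum (AddMonoidHom.snd (Fin n → ℤ) (Fin n → ℤ)) E
    have h2 : E.sum.1 = κ • v := hEs
    rw [← h1, hk, h2, add_smul]
  have hfl := forall₂_map_pairs (v := v) fun z hz => (hXD z hz).2.2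
  have hm₁ : ∀ x ∈ X.map Prod.fst, x ∈ U := by
    simp only [List.mem_map]
    rintro _ ⟨z, hz, rfl⟩
    exact (hXD z hz).1
  have hm₂ := hX₂.1
  obtain ⟨-, hlen₂, hsp₂, j', κ', hr', hj'⟩ := hX₂
  simp only [hX, List.map_append] at hlen₂ hsp₂ hr' hm₁ hm₂ hfl ⊢
  have hE0 : E ≠ [] := by
    rintro rfl
    simp at hj
  have huniq := SRel.unique hsp₂ hlen₂ hEs₂ (by simpa using hE0) (by omega) hr'
  rw [List.length_map] at huniq
  rw [hX, List.length_append] at hXlen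
  rcases hj with ⟨hE3, hκ⟩ | ⟨hE4, rfl⟩
  · obtain ⟨a, b, c, rfl⟩ := List.length_eq_three.1 hE3
    have hκ' : |κ + k| ≤ 1 := by
      rw [← huniq.2]
      rcases hj' with h | h
      · exact h.2
      · simp [h.2]
    simp only [List.map_cons, List.map_nil, List.sum_cons, List.sum_nil, add_zero,
      ← add_assoc] at hEs' hEs₂
    exact hq.triangle_indep hU (by simp at hXlen ⊢; omega) hm₁ hm₂ hEs' hEs₂ hκ hκ' hfl
  · obtain ⟨a, E, rfl⟩ := List.exists_cons_of_ne_nil hE0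
    obtain ⟨b, c, d, rfl⟩ := List.length_eq_three.1 (by simpa using hE4)
    have hκ' : 0 + k = 0 := by
      have := huniq.2
      rcases hj' with h | h
      · omega
      · rw [h.2] at this
        simpa using this.symm
    rw [hκ'] at hEs₂
    simp only [List.map_cons, List.map_nil, List.sum_cons, List.sum_nil, add_zero,
      ← add_assoc, zero_smul] at hEs' hEs₂
    exact hq.four_indep hU (by simp at hXlen ⊢; omega) hm₁ hm₂ hEs' hEs₂ hfl

theorem KillsTwins.admissible_indep (hq : KillsTwins v U q) (hU : Below f v U)
    {L L' : List (Fin n → ℤ)} (hL : Admissible v U L) (hL' : Admissible v U L')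
    (h : List.Forall₂ (SignedLifts v) L L') : q (sy (v :: L)) = q (sy (v :: L')) := by
  obtain ⟨L'', h₁, h₂⟩ := exists_lifts_upToSigns h
  rw [hq.admissible_indep_of_lifts hU hL (hL'.upToSigns hU h₂) h₁,
    sy_forall₂ (.cons (Or.inl rfl) h₂)]

theorem Admissible.ne_signedLifts (hU : Below f v U) {L l₁ l₂ : List (Fin n → ℤ)}
    {a b : Fin n → ℤ} (hL : Admissible v U L) (h : L = l₁ ++ a :: b :: l₂) :
    ¬ SignedLifts v a b := by
  subst h
  intro hab
  obtain ⟨c, hc, k, hk⟩ : ∃ c, (c = b ∨ c = -b) ∧ ∃ k : ℤ, a + c = k • v := by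
    rcases hab with ⟨k, hk⟩ | ⟨k, hk⟩
    · exact ⟨-b, Or.inr rfl, -k, by rw [hk]; module⟩
    · exact ⟨b, Or.inl rfl, -k, by rw [neg_eq_iff_eq_neg] at hk; rw [hk]; module⟩
  have hL' : Admissible v U ([a, c] ++ (l₁ ++ l₂)) := by
    refine (hL.perm (L' := a :: b :: (l₁ ++ l₂)) ?_).upToSigns hU
      (.cons (Or.inl rfl) (.cons hc (UpToSigns.refl _)))
    exact List.perm_middle.trans (List.perm_middle.cons a)
  obtain ⟨-, hlen, hsp, j, κ, hr, hj⟩ := hL'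
  have := (SRel.unique hsp hlen (k := k) (by simpa using hk) (by simp) (by omega) hr).1
  simp at this
  omega

end Admissible

section Quotient

open Alt

variable {m n : ℕ} {f : (Fin n → ℤ) →+ ℤ} {v : Fin n → ℤ} {U : Set (Fin n → ℤ)}
  {B : Type} [AddCommGroup B] {q : Alt (Fin n → ℤ) →+ B} {p : (Fin n → ℤ) →+ (Fin m → ℤ)}

/-- The map `p` is the quotient by the line through `v`. -/
structure KillsLine (v : Fin n → ℤ) (p : (Fin n → ℤ) →+ (Fin m → ℤ)) : Prop where
  surj : Function.Surjective p
  ker : ∀ x, p x = 0 ↔ ∃ k : ℤ, x = k • v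

theorem KillsLine.map_self (hp : KillsLine v p) : p v = 0 := (hp.ker v).2 ⟨1, (one_smul _ _).symm⟩

theorem KillsLine.lifts (hp : KillsLine v p) {x y : Fin n → ℤ} (h : p x = p y) : Lifts v x y := by
  obtain ⟨k, hk⟩ := (hp.ker (y - x)).1 (by rw [map_sub, h, sub_self])
  exact ⟨k, by rw [← hk]; abel⟩

theorem KillsLine.forall₂_lifts (hp : KillsLine v p) {L L' : List (Fin n → ℤ)}
    (h : L.map p = L'.map p) : List.Forall₂ (Lifts v) L L' := by
  have h1 : List.Forall₂ Eq (L.map p) (L'.map p) := by rw [List.forall₂_eq_eq_eq, h]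
  rw [List.forall₂_map_left_iff, List.forall₂_map_right_iff] at h1
  exact h1.imp fun _ _ => hp.lifts

theorem Sp.map_of_cons (hp : KillsLine v p) {L : List (Fin n → ℤ)} (h : Sp (v :: L)) :
    Sp (L.map p) := by
  refine (h.map p hp.surj).of_mem_span ?_
  simp only [List.map_cons, hp.map_self, List.mem_cons, forall_eq_or_imp]
  exact ⟨Submodule.zero_mem _, fun x hx => Submodule.subset_span hx⟩

/-- The symbol of `v` and an admissible lift of a list, if there is one. -/
noncomputable def liftFun (v : Fin n → ℤ) (U : Set (Fin n → ℤ)) (q : Alt (Fin n → ℤ) →+ B)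
    (p : (Fin n → ℤ) →+ (Fin m → ℤ)) (l : List (Fin m → ℤ)) : B :=
  if h : ∃ L, L.map p = l ∧ Admissible v U L then q (sy (v :: h.choose)) else 0

theorem liftFun_map (hq : KillsTwins v U q) (hU : Below f v U) (hp : KillsLine v p)
    {L : List (Fin n → ℤ)} (hL : Admissible v U L) :
    liftFun v U q p (L.map p) = q (sy (v :: L)) := by
  have h : ∃ L', L'.map p = L.map p ∧ Admissible v U L' := ⟨L, rfl, hL⟩
  rw [liftFun, dif_pos h]
  exact hq.admissible_indep hU h.choose_spec.2 hL
    ((hp.forall₂_lifts h.choose_spec.1).imp fun _ _ => Or.inl)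

theorem liftFun_eq_zero {l : List (Fin m → ℤ)} (h : ∀ L, L.map p = l → ¬ Admissible v U L) :
    liftFun v U q p l = 0 :=
  dif_neg fun ⟨L, h₁, h₂⟩ => h L h₁ h₂

theorem liftFun_swap (hq : KillsTwins v U q) (hU : Below f v U) (hp : KillsLine v p)
    (l₁ : List (Fin m → ℤ)) (a b : Fin m → ℤ) (l₂ : List (Fin m → ℤ)) :
    liftFun v U q p (l₁ ++ a :: b :: l₂) = - liftFun v U q p (l₁ ++ b :: a :: l₂) := by
  have key : ∀ a b L, L.map p = l₁ ++ a :: b :: l₂ → Admissible v U L →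
      ∃ L', L'.map p = l₁ ++ b :: a :: l₂ ∧ Admissible v U L' ∧ sy (v :: L) = - sy (v :: L') := by
    intro a b L hL hA
    obtain ⟨L₁, M, rfl, rfl, hM⟩ := List.map_eq_append_iff.1 hL
    obtain ⟨x, N, rfl, rfl, hN⟩ := List.map_eq_cons_iff.1 hM
    obtain ⟨y, M, rfl, rfl, rfl⟩ := List.map_eq_cons_iff.1 hN
    exact ⟨L₁ ++ y :: x :: M, by simp, hA.perm ((List.Perm.swap y x M).append_left L₁),
      sy_swap (v :: L₁) x y M⟩
  by_cases h : ∃ L, L.map p = l₁ ++ a :: b :: l₂ ∧ Admissible v U L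
  · obtain ⟨L, hL, hA⟩ := h
    obtain ⟨L', hL', hA', hs⟩ := key a b L hL hA
    rw [← hL, ← hL', liftFun_map hq hU hp hA, liftFun_map hq hU hp hA', hs, map_neg]
  · rw [liftFun_eq_zero fun L h₁ h₂ => h ⟨L, h₁, h₂⟩, liftFun_eq_zero, neg_zero]
    intro L hL hA
    obtain ⟨L', hL', hA', -⟩ := key b a L hL hA
    exact h ⟨L', hL', hA'⟩

theorem liftFun_neg (hq : KillsTwins v U q) (hU : Below f v U) (hp : KillsLine v p)
    (l₁ : List (Fin m → ℤ)) (a : Fin m → ℤ) (l₂ : List (Fin m → ℤ)) :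
    liftFun v U q p (l₁ ++ (-a) :: l₂) = liftFun v U q p (l₁ ++ a :: l₂) := by
  have key : ∀ a L, L.map p = l₁ ++ a :: l₂ → Admissible v U L →
      ∃ L', L'.map p = l₁ ++ (-a) :: l₂ ∧ Admissible v U L' ∧ sy (v :: L) = sy (v :: L') := by
    intro a L hL hA
    obtain ⟨L₁, M, rfl, rfl, hM⟩ := List.map_eq_append_iff.1 hL
    obtain ⟨x, M, rfl, rfl, rfl⟩ := List.map_eq_cons_iff.1 hM
    refine ⟨L₁ ++ (-x) :: M, by simp, hA.upToSigns hU ?_, (sy_neg (v :: L₁) x M).symm⟩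
    exact List.rel_append (UpToSigns.refl L₁) (.cons (Or.inr rfl) (UpToSigns.refl M))
  by_cases h : ∃ L, L.map p = l₁ ++ a :: l₂ ∧ Admissible v U L
  · obtain ⟨L, hL, hA⟩ := h
    obtain ⟨L', hL', hA', hs⟩ := key a L hL hA
    rw [← hL, ← hL', liftFun_map hq hU hp hA, liftFun_map hq hU hp hA', hs]
  · rw [liftFun_eq_zero (l := l₁ ++ a :: l₂) fun L h₁ h₂ => h ⟨L, h₁, h₂⟩, liftFun_eq_zero]
    intro L hL hA
    obtain ⟨L', hL', hA', -⟩ := key (-a) L hL hA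
    exact h ⟨L', by rw [hL', neg_neg], hA'⟩

theorem liftFun_dup (hU : Below f v U) (hp : KillsLine v p)
    (l₁ : List (Fin m → ℤ)) (a : Fin m → ℤ) (l₂ : List (Fin m → ℤ)) :
    liftFun v U q p (l₁ ++ a :: a :: l₂) = 0 := by
  refine liftFun_eq_zero fun L hL hA => ?_
  obtain ⟨L₁, M, rfl, rfl, hM⟩ := List.map_eq_append_iff.1 hL
  obtain ⟨x, N, rfl, rfl, hN⟩ := List.map_eq_cons_iff.1 hM
  obtain ⟨y, M, rfl, hxy, rfl⟩ := List.map_eq_cons_iff.1 hN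
  exact hA.ne_signedLifts hU rfl (Or.inl (hp.lifts hxy.symm))

/-- The map induced by `liftFun`. -/
noncomputable def liftHom (hq : KillsTwins v U q) (hU : Below f v U) (hp : KillsLine v p) :
    Alt (Fin m → ℤ) →+ B :=
  Alt.lift (liftFun v U q p) (liftFun_swap hq hU hp) (liftFun_neg hq hU hp) (liftFun_dup hU hp)

theorem liftHom_sy (hq : KillsTwins v U q) (hU : Below f v U) (hp : KillsLine v p)
    {L : List (Fin n → ℤ)} (hL : Admissible v U L) :
    liftHom hq hU hp (sy (L.map p)) = q (sy (v :: L)) := by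
  rw [liftHom, lift_sy, liftFun_map hq hU hp hL]

theorem liftHom_NS (hq : KillsTwins v U q) (hU : Below f v U) (hp : KillsLine v p) :
    NS (Fin m → ℤ) ≤ (liftHom hq hU hp).ker := by
  refine symSub_le fun l hl => ?_
  rw [AddMonoidHom.mem_ker, liftHom, lift_sy]
  refine liftFun_eq_zero ?_
  rintro L rfl hA
  exact hl (Sp.map_of_cons hp hA.2.2.1)

/-- The link of `v`, projected along `v`. -/
noncomputable def linkProj (v : Fin n → ℤ) (p : (Fin n → ℤ) →+ (Fin m → ℤ)) :
    Alt (Fin n → ℤ) →+ Alt (Fin m → ℤ) :=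
  (Alt.map p).comp (link v)

theorem linkProj_bd (x : Alt (Fin n → ℤ)) : linkProj v p (bd x) = - bd (linkProj v p x) := by
  simp [linkProj, link_bd, map_bd]

theorem linkProj_sy_cons {r : List (Fin n → ℤ)} (h : ∀ x ∈ r, x ≠ v ∧ x ≠ -v) :
    linkProj v p (sy (v :: r)) = sy (r.map p) := by
  simp [linkProj, link_cons_of_forall_ne v r h]

theorem linkProj_sy_of_forall_ne {r : List (Fin n → ℤ)} (h : ∀ x ∈ r, x ≠ v ∧ x ≠ -v) :
    linkProj v p (sy r) = 0 := by
  simp [linkProj, link_of_forall_ne v r h]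

/-- A symbol either avoids `v`, or vanishes, or can be written with `v` exactly once, in front. -/
theorem sy_cases (v : Fin n → ℤ) (g : List (Fin n → ℤ)) :
    (∀ x ∈ g, x ≠ v ∧ x ≠ -v) ∨ sy g = 0 ∨
      ∃ r, (∀ x ∈ r, x ∈ g) ∧ (∀ x ∈ r, x ≠ v ∧ x ≠ -v) ∧
        (sy g = sy (v :: r) ∨ sy g = - sy (v :: r))
        ∧ ∃ Q, g.Perm Q ∧ UpToSigns Q (v :: r) := by
  by_cases h : ∀ x ∈ g, x ≠ v ∧ x ≠ -v
  · exact Or.inl h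
  push Not at h
  obtain ⟨x, hx, hxv⟩ := h
  have hxv' : v = x ∨ v = -x := by
    by_cases h : x = v
    · exact Or.inl h.symm
    · exact Or.inr (by rw [hxv h, neg_neg])
  obtain ⟨l₁, l₂, rfl⟩ := List.append_of_mem hx
  have hperm : (l₁ ++ x :: l₂).Perm (x :: (l₁ ++ l₂)) := List.perm_middle
  have hsig : UpToSigns (x :: (l₁ ++ l₂)) (v :: (l₁ ++ l₂)) := .cons hxv' (UpToSigns.refl _)
  have hsy : sy (l₁ ++ x :: l₂) = sy (v :: (l₁ ++ l₂)) ∨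
      sy (l₁ ++ x :: l₂) = - sy (v :: (l₁ ++ l₂)) := by
    rw [sy_forall₂ hsig]
    exact sy_perm hperm
  by_cases h : ∀ y ∈ l₁ ++ l₂, y ≠ v ∧ y ≠ -v
  · refine Or.inr (Or.inr ⟨l₁ ++ l₂, fun y hy => ?_, h, hsy, _, hperm, hsig⟩)
    simp only [List.mem_append, List.mem_cons] at hy ⊢
    tauto
  · refine Or.inr (Or.inl ?_)
    push Not at h
    obtain ⟨y, hy, hyv⟩ := h
    have h0 : sy (v :: (l₁ ++ l₂)) = 0 := by
      refine sy_eq_zero_of_neg_mem _ _ ?_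
      by_cases h : y = v
      · exact Or.inl (h ▸ hy)
      · exact Or.inr (hyv h ▸ hy)
    rcases hsy with h | h <;> simp [h, h0]

theorem linkProj_NS (hp : KillsLine v p) :
    NS (Fin n → ℤ) ≤ (NS (Fin m → ℤ)).comap (linkProj v p) := by
  refine symSub_le fun g hg => AddSubgroup.mem_comap.2 ?_
  rcases sy_cases v g with h | h | ⟨r, -, hr, hs, Q, hQ, hQr⟩
  · rw [linkProj_sy_of_forall_ne h]
    exact zero_mem _
  · rw [h, map_zero]
    exact zero_mem _
  · have : sy (r.map p) ∈ NS (Fin m → ℤ) := sy_mem_symSub fun h =>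
      hg (((h.of_map p v fun x => (hp.ker x).1).forall₂ hQr.symm).perm hQ.symm)
    rcases hs with hs | hs <;> rw [hs]
    · rwa [linkProj_sy_cons hr]
    · rwa [map_neg, linkProj_sy_cons hr, neg_mem_iff]

/-- The shape of a generator of `M₁` whose entries are `v` or lie below `v`. -/
theorem isG1_cases {g : List (Fin n → ℤ)} (hg : IsG1 n g) (hm : ∀ x ∈ g, x ∈ U ∨ x = v ∨ x = -v)
    (hneg : ∀ u ∈ U, -u ∈ U) :
    (∀ x ∈ g, x ∈ U) ∨ sy g = 0 ∨
      (∃ r, (sy g = sy (v :: r) ∨ sy g = - sy (v :: r)) ∧ (∀ x ∈ r, x ∈ U) ∧ r.length = n ∧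
        ∃ (j : ℕ) (κ : ℤ), SRel r j (κ • v) ∧ ((j = 3 ∧ |κ| ≤ 1) ∨ (j = 4 ∧ κ = 0))) ∨
      ∃ a b r, (sy g = sy (v :: a :: b :: r) ∨ sy g = - sy (v :: a :: b :: r)) ∧
        a ∈ U ∧ b ∈ U ∧ (∀ x ∈ r, x ∈ U) ∧ r.length + 2 = n ∧ (b = a + v ∨ b = a - v) := by
  rcases sy_cases v g with h | h | ⟨r, hrg, hr, hs, Q, hQ, hQr⟩
  · exact Or.inl fun x hx => (hm x hx).resolve_right (not_or.2 (h x hx))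
  · exact Or.inr (Or.inl h)
  have hrU : ∀ x ∈ r, x ∈ U := fun x hx =>
    (hm x (hrg x hx)).resolve_right (not_or.2 (hr x hx))
  have hlen : r.length = n := by
    have := hg.1
    rw [hQ.length_eq, hQr.length_eq] at this
    simpa using this
  refine Or.inr (Or.inr ?_)
  have hrel : ∀ k, SRel g k 0 → SRel (v :: r) k 0 := fun k h => (h.perm hQ).forall₂ hQr
  have hcons : ∀ k, SRel (v :: r) (k + 1) 0 → SRel r (k + 1) ((0 : ℤ) • v) ∨
      SRel r k ((1 : ℤ) • v) := by
    intro k h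
    generalize hk : k + 1 = k' at h
    generalize hy : (0 : Fin n → ℤ) = y at h
    cases h with
    | skip _ h => left; rwa [zero_smul, hy]
    | @pos _ _ k'' y h =>
      obtain rfl : k = k'' := by omega
      right
      convert h.opp using 1
      rw [eq_comm, add_eq_zero_iff_eq_neg] at hy
      rw [hy, one_smul, neg_neg]
    | @neg _ _ k'' y h =>
      obtain rfl : k = k'' := by omega
      right
      convert h using 1
      rw [eq_comm, sub_eq_zero] at hy
      rw [hy, one_smul]
  rcases hg.2 with h | h
  · rcases hcons 2 (hrel _ h) with h | h
    · exact Or.inl ⟨r, hs, hrU, hlen, 3, 0, h, Or.inl ⟨rfl, by simp⟩⟩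
    · right
      obtain ⟨E, R, hE, hEs, Q', hQ', hQR⟩ := SRel.exists_normal (P := r) (AddMonoidHom.id _)
        (by simpa using h)
      obtain ⟨a, b, rfl⟩ := List.length_eq_two.1 hE
      have hm' : ∀ x ∈ [a, b] ++ R, x ∈ U :=
        hQR.forall_mem hneg fun x hx => hrU x (hQ'.symm.subset hx)
      simp only [List.cons_append, List.nil_append, List.mem_cons, forall_eq_or_imp] at hm'
      have hl := hQR.length_eq
      rw [← hQ'.length_eq, hlen] at hl
      refine ⟨a, -b, R, ?_, hm'.1, hneg _ hm'.2.1, hm'.2.2, by simpa using hl.symm, Or.inr ?_⟩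
      · have e₁ := sy_forall₂ (hQR.cons (a := v) (b := v) (Or.inl rfl))
        simp only [List.cons_append, List.nil_append] at e₁
        rw [sy_neg_third, e₁]
        rcases hs with hs | hs <;> rcases sy_perm (hQ'.cons v) with h | h <;> simp [hs, h]
      · simp at hEs
        linear_combination -hEs
  · rcases hcons 3 (hrel _ h) with h | h
    · exact Or.inl ⟨r, hs, hrU, hlen, 4, 0, h, Or.inr ⟨rfl, rfl⟩⟩
    · exact Or.inl ⟨r, hs, hrU, hlen, 3, 1, h, Or.inl ⟨rfl, by simp⟩⟩

end Quotient

section LiftingRelations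

open Alt

variable {m : ℕ} {f : (Fin (m + 1) → ℤ) →+ ℤ} {v : Fin (m + 1) → ℤ} {U : Set (Fin (m + 1) → ℤ)}
  {B : Type} [AddCommGroup B] {q : Alt (Fin (m + 1) → ℤ) →+ B}
  {p : (Fin (m + 1) → ℤ) →+ (Fin m → ℤ)}

/-- The generators of `M₁` with entries `v` or below `v`. -/
def IsG1Below (v : Fin (m + 1) → ℤ) (U : Set (Fin (m + 1) → ℤ)) (l : List (Fin (m + 1) → ℤ)) :
    Prop :=
  IsG1 (m + 1) l ∧ ∀ x ∈ l, x ∈ U ∨ x = v ∨ x = -v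

theorem linkProj_mem_of_isG1Below (hU : Below f v U) (hp : KillsLine v p)
    {g : List (Fin (m + 1) → ℤ)}
    (hg : IsG1Below v U g) : linkProj v p (sy g) ∈ symSub (V := Fin m → ℤ) (IsG1 m) := by
  rcases isG1_cases hg.1 hg.2 hU.neg with h | h | ⟨r, hs, hr, hlen, j, κ, hrel, hj⟩ |
    ⟨a, b, r, hs, ha, hb, hr, -, hab⟩
  · rw [linkProj_sy_of_forall_ne fun x hx => hU.ne (h x hx)]
    exact zero_mem _
  · rw [h, map_zero]
    exact zero_mem _
  · have hmem : sy (r.map p) ∈ symSub (V := Fin m → ℤ) (IsG1 m) := by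
      refine sy_mem_symSub ⟨by simpa using hlen, ?_⟩
      have h := hrel.map p
      rw [map_zsmul, hp.map_self, smul_zero] at h
      rcases hj with ⟨rfl, -⟩ | ⟨rfl, -⟩
      · exact Or.inl h
      · exact Or.inr h
    have e := linkProj_sy_cons (p := p) fun x hx => hU.ne (hr x hx)
    rcases hs with hs | hs <;> rw [hs]
    · rwa [e]
    · rwa [map_neg, e, neg_mem_iff]
  · have e := linkProj_sy_cons (v := v) (p := p) (r := a :: b :: r) (by
      simp only [List.mem_cons, forall_eq_or_imp]
      exact ⟨hU.ne ha, hU.ne hb, fun x hx => hU.ne (hr x hx)⟩)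
    have hpab : p b = p a := by rcases hab with rfl | rfl <;> simp [hp.map_self]
    rw [List.map_cons, List.map_cons, hpab, sy_dup_front] at e
    rcases hs with hs | hs <;> rw [hs]
    · rw [e]
      exact zero_mem _
    · rw [map_neg, e, neg_zero]
      exact zero_mem _

theorem liftHom_linkProj_NS (hq : KillsTwins v U q) (hU : Below f v U) (hp : KillsLine v p)
    {x : Alt (Fin (m + 1) → ℤ)} (hx : x ∈ NS (Fin (m + 1) → ℤ)) :
    liftHom hq hU hp (linkProj v p x) = q x := by
  rw [hq.ns x hx]
  exact liftHom_NS hq hU hp (linkProj_NS hp hx)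

theorem liftHom_linkProj_sy (hq : KillsTwins v U q) (hU : Below f v U) (hp : KillsLine v p)
    {g : List (Fin (m + 1) → ℤ)} (hg : IsG1Below v U g) :
    liftHom hq hU hp (linkProj v p (sy g)) = q (sy g) := by
  by_cases hsp : Sp g
  swap
  · exact liftHom_linkProj_NS hq hU hp (sy_mem_symSub hsp)
  rcases isG1_cases hg.1 hg.2 hU.neg with h | h | ⟨r, hs, hr, hlen, j, κ, hrel, hj⟩ |
    ⟨a, b, r, hs, ha, hb, hr, hlen, hab⟩
  · rw [linkProj_sy_of_forall_ne fun x hx => hU.ne (h x hx), map_zero, hq.g1 g hg.1 h]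
  · simp [h]
  · have e := linkProj_sy_cons (p := p) fun x hx => hU.ne (hr x hx)
    have key : liftHom hq hU hp (linkProj v p (sy (v :: r))) = q (sy (v :: r)) := by
      by_cases hsp' : Sp (v :: r)
      · rw [e, liftHom_sy hq hU hp ⟨hr, hlen, hsp', j, κ, hrel, hj⟩]
      · exact liftHom_linkProj_NS hq hU hp (sy_mem_symSub hsp')
    rcases hs with hs | hs <;> simp only [hs, map_neg, key]
  · have e := linkProj_sy_cons (v := v) (p := p) (r := a :: b :: r) (by
      simp only [List.mem_cons, forall_eq_or_imp]
      exact ⟨hU.ne ha, hU.ne hb, fun x hx => hU.ne (hr x hx)⟩)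
    have hpab : p b = p a := by rcases hab with rfl | rfl <;> simp [hp.map_self]
    rw [List.map_cons, List.map_cons, hpab, sy_dup_front] at e
    have h0 := hq.twin a b r (by omega) ha hb hr hab
    rcases hs with hs | hs <;> simp [hs, map_neg, e, h0]

theorem exists_lift_nonneg (hU : Below f v U) (hp : KillsLine v p) (x : Fin m → ℤ) :
    ∃ y, p y = x ∧ 0 ≤ f y ∧ f y < f v := by
  obtain ⟨y, rfl⟩ := hp.surj x
  refine ⟨y - (f y / f v) • v, ?_, ?_, ?_⟩
  · rw [map_sub, map_zsmul, hp.map_self, smul_zero, sub_zero]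
  all_goals
    rw [map_sub, map_zsmul, smul_eq_mul]
    have h1 := Int.emod_add_mul_ediv (f y) (f v)
    have h2 := Int.emod_nonneg (f y) hU.pos.ne'
    have h3 := Int.emod_lt_of_pos (f y) hU.pos
    linarith

theorem exists_lift_nonpos (hU : Below f v U) (hp : KillsLine v p) (x : Fin m → ℤ) :
    ∃ y, p y = x ∧ -f v < f y ∧ f y ≤ 0 := by
  obtain ⟨y, hy, h1, h2⟩ := exists_lift_nonneg hU hp (-x)
  exact ⟨-y, by simp [hy], by simpa using h2, by simpa using h1⟩

theorem exists_lift_list (hU : Below f v U) (hp : KillsLine v p) (l : List (Fin m → ℤ)) :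
    ∃ L : List (Fin (m + 1) → ℤ), L.map p = l ∧ ∀ x ∈ L, x ∈ U := by
  induction l with
  | nil => exact ⟨[], by simp⟩
  | cons x l ih =>
    obtain ⟨L, rfl, hL⟩ := ih
    obtain ⟨y, rfl, h1, h2⟩ := exists_lift_nonneg hU hp x
    exact ⟨y :: L, rfl, by
      simp only [List.mem_cons, forall_eq_or_imp]
      exact ⟨hU.mem y (by rwa [abs_of_nonneg h1]), hL⟩⟩

/-- A triangle lifts to a triangle below `v`, with prescribed lift of one vertex. -/
theorem exists_lift_triangle (hU : Below f v U) (hp : KillsLine v p) {s : Fin (m + 1) → ℤ}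
    (h0 : 0 ≤ f s) (hs : f s < f v) {a b : Fin m → ℤ} (h : p s + a + b = 0) :
    ∃ a' b', p a' = a ∧ p b' = b ∧ a' ∈ U ∧ b' ∈ U ∧ s + a' + b' = 0 := by
  obtain ⟨a', rfl, h1, h2⟩ := exists_lift_nonpos hU hp a
  refine ⟨a', -s - a', rfl, ?_, hU.mem _ ?_, hU.mem _ ?_, by ring⟩
  · rw [map_sub, map_neg]
    linear_combination -h
  · exact abs_lt.2 ⟨h1, by linarith⟩
  · rw [map_sub, map_neg]
    exact abs_lt.2 ⟨by linarith, by linarith⟩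

theorem exists_lift_isG2 (hU : Below f v U) (hp : KillsLine v p) {l : List (Fin m → ℤ)}
    (hl : IsG2 m l) :
      ∃ L : List (Fin (m + 1) → ℤ), L.map p = l ∧ (∀ x ∈ L, x ∈ U) ∧ IsG2 (m + 1) (L ++ [v]) := by
  obtain ⟨hlen, ⟨s, a, b, c, d, r, rfl, h₁, h₂⟩ | ⟨a, b, c, d, e, f', r, rfl, h₁, h₂⟩⟩ := hl
  · obtain ⟨s, rfl, hs0, hs⟩ := exists_lift_nonneg hU hp s
    obtain ⟨a, b, rfl, rfl, ha, hb, hab⟩ := exists_lift_triangle hU hp hs0 hs h₁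
    obtain ⟨c, d, rfl, rfl, hc, hd, hcd⟩ := exists_lift_triangle hU hp hs0 hs h₂
    obtain ⟨r, rfl, hr⟩ := exists_lift_list hU hp r
    refine ⟨s :: a :: b :: c :: d :: r, rfl, ?_, by simpa using hlen, Or.inl
      ⟨s, a, b, c, d, r ++ [v], rfl, hab, hcd⟩⟩
    simp only [List.mem_cons, forall_eq_or_imp]
    exact ⟨hU.mem s (by rwa [abs_of_nonneg hs0]), ha, hb, hc, hd, hr⟩
  · obtain ⟨a, rfl, ha0, ha⟩ := exists_lift_nonneg hU hp a
    obtain ⟨b, c, rfl, rfl, hb, hc, hbc⟩ := exists_lift_triangle hU hp ha0 ha h₁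
    obtain ⟨d, rfl, hd0, hd⟩ := exists_lift_nonneg hU hp d
    obtain ⟨e, g, rfl, rfl, he, hg, heg⟩ := exists_lift_triangle hU hp hd0 hd h₂
    obtain ⟨r, rfl, hr⟩ := exists_lift_list hU hp r
    refine ⟨a :: b :: c :: d :: e :: g :: r, rfl, ?_, by simpa using hlen, Or.inr
      ⟨a, b, c, d, e, g, r ++ [v], rfl, hbc, heg⟩⟩
    simp only [List.mem_cons, forall_eq_or_imp]
    exact ⟨hU.mem a (by rwa [abs_of_nonneg ha0]), hb, hc,
      hU.mem d (by rwa [abs_of_nonneg hd0]), he, hg, hr⟩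

theorem liftHom_bd_isG2 (hq : KillsTwins v U q) (hU : Below f v U) (hp : KillsLine v p)
    {l : List (Fin m → ℤ)} (hl : IsG2 m l) : liftHom hq hU hp (bd (sy l)) = 0 := by
  obtain ⟨L, rfl, hLU, hL⟩ := exists_lift_isG2 hU hp hl
  have h₁ : liftHom hq hU hp (linkProj v p (bd (sy (L ++ [v])))) = q (bd (sy (L ++ [v]))) := by
    have hB : ∀ x ∈ L ++ [v], x ∈ {x | x ∈ U ∨ x = v ∨ x = -v} := by
      intro x hx
      rcases List.mem_append.1 hx with h | h
      · exact Or.inl (hLU x h)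
      · exact Or.inr (Or.inl (List.mem_singleton.1 h))
    have hmem := bd_mem_of_isG2 hL hB
    have hle : symSub (fun l => IsG1 (m + 1) l ∧ ∀ x ∈ l, x ∈ {x | x ∈ U ∨ x = v ∨ x = -v}) ⊔
        NS (Fin (m + 1) → ℤ) ≤ (((liftHom hq hU hp).comp (linkProj v p)) - q).ker := by
      refine sup_le (symSub_le fun g hg => ?_) fun x hx => ?_
      · rw [AddMonoidHom.mem_ker, AddMonoidHom.sub_apply, sub_eq_zero]
        exact liftHom_linkProj_sy hq hU hp hg
      · rw [AddMonoidHom.mem_ker, AddMonoidHom.sub_apply, sub_eq_zero]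
        exact liftHom_linkProj_NS hq hU hp hx
    have := hle hmem
    rwa [AddMonoidHom.mem_ker, AddMonoidHom.sub_apply, sub_eq_zero] at this
  rw [hq.g2 _ hL, linkProj_bd, sy_middle L v [], List.append_nil, map_zsmul,
    linkProj_sy_cons fun x hx => hU.ne (hLU x hx), map_zsmul, map_neg, map_zsmul, neg_eq_zero] at h₁
  have hu : ((-1 : ℤ) ^ L.length) * (-1) ^ L.length = 1 := by
    rw [← mul_pow]
    simp
  rw [← one_smul ℤ (liftHom hq hU hp _), ← hu, mul_smul, h₁, smul_zero]

theorem KillsTwins.eq_zero_of_linkProj_mem (hq : KillsTwins v U q) (hU : Below f v U)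
    (hp : KillsLine v p) {z : Alt (Fin (m + 1) → ℤ)} (hz : z ∈ symSub (IsG1Below v U))
    (h : linkProj v p z ∈ (symSub (V := Fin m → ℤ) (IsG2 m)).map bd ⊔ NS (Fin m → ℤ)) :
    q z = 0 := by
  have h₁ : symSub (IsG1Below v U) ≤ (((liftHom hq hU hp).comp (linkProj v p)) - q).ker :=
    symSub_le fun g hg => by
      rw [AddMonoidHom.mem_ker, AddMonoidHom.sub_apply, sub_eq_zero]
      exact liftHom_linkProj_sy hq hU hp hg
  have h₂ : (symSub (V := Fin m → ℤ) (IsG2 m)).map bd ⊔ NS (Fin m → ℤ) ≤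
      (liftHom hq hU hp).ker := by
    refine sup_le (AddSubgroup.map_le_iff_le_comap.2 (symSub_le fun l hl => ?_))
      (liftHom_NS hq hU hp)
    exact liftHom_bd_isG2 hq hU hp hl
  have h₃ := h₁ hz
  rw [AddMonoidHom.mem_ker, AddMonoidHom.sub_apply, sub_eq_zero] at h₃
  rw [← h₃]
  exact h₂ h

end LiftingRelations

section Twins

open Alt

variable {n : ℕ} {f : (Fin n → ℤ) →+ ℤ} {v : Fin n → ℤ} {U : Set (Fin n → ℤ)}

/-- The symbols of a triangle `v, a, b` completed by entries below `v`, with `a ∈ S`. -/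
def IsTwin (v : Fin n → ℤ) (U S : Set (Fin n → ℤ)) (l : List (Fin n → ℤ)) : Prop :=
  ∃ a b r, l = v :: a :: b :: r ∧ v + a + b = 0 ∧ a ∈ S ∧ a ∈ U ∧ b ∈ U ∧ (∀ x ∈ r, x ∈ U) ∧
    r.length + 2 = n

/-- The symbols known to be trivial when proving exactness by descent on the height of `v`. -/
noncomputable def Trivials (U : Set (Fin n → ℤ)) : AddSubgroup (Alt (Fin n → ℤ)) :=
  (symSub (V := Fin n → ℤ) (IsG2 n)).map bd ⊔ symSub (fun l => IsG1 n l ∧ ∀ x ∈ l, x ∈ U) ⊔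
    NS (Fin n → ℤ)

/-- The symbols with all entries below `v`, up to non-generating ones. -/
noncomputable def Lower (U : Set (Fin n → ℤ)) : AddSubgroup (Alt (Fin n → ℤ)) :=
  symSub (fun l => ∀ x ∈ l, x ∈ U) ⊔ NS (Fin n → ℤ)

theorem bd_mem_lower {x : Alt (Fin n → ℤ)} (hx : x ∈ Trivials U) : bd x ∈ Lower U := by
  have h : Trivials U ≤ (Lower U).comap bd := by
    refine sup_le (sup_le ?_ (symSub_le fun l hl => ?_)) fun x hx => ?_
    · rintro _ ⟨x, -, rfl⟩
      rw [AddSubgroup.mem_comap, bd_bd]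
      exact zero_mem _
    · refine AddSubgroup.mem_comap.2 (bd_mem l _ ?_)
      rintro l₁ a l₂ rfl
      refine AddSubgroup.mem_sup_left (sy_mem_symSub fun x hx => hl.2 x ?_)
      simp only [List.mem_append, List.mem_cons] at hx ⊢
      tauto
    · exact AddSubgroup.mem_sup_right (bd_mem_NS hx)
  exact h hx

theorem kills_mk (U : Set (Fin n → ℤ)) {K : AddSubgroup (Alt (Fin n → ℤ))} (hK : Trivials U ≤ K) :
    Kills U (QuotientAddGroup.mk' K) where
  ns x hx := (QuotientAddGroup.eq_zero_iff x).2 (hK (AddSubgroup.mem_sup_right hx))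
  g2 _ hl := (QuotientAddGroup.eq_zero_iff _).2 (hK (AddSubgroup.mem_sup_left
    (AddSubgroup.mem_sup_left (AddSubgroup.mem_map_of_mem _ (sy_mem_symSub hl)))))
  g1 _ hl hm := (QuotientAddGroup.eq_zero_iff _).2 (hK (AddSubgroup.mem_sup_left
    (AddSubgroup.mem_sup_right (sy_mem_symSub ⟨hl, hm⟩))))

theorem killsTwins_mk (hU : Below f v U) :
    KillsTwins v U (QuotientAddGroup.mk' (symSub (IsTwin v U Set.univ) ⊔ Trivials U)) where
  toKills := kills_mk U le_sup_right
  twin a b r hlen ha hb hr hab := by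
    refine (QuotientAddGroup.eq_zero_iff _).2 (AddSubgroup.mem_sup_left ?_)
    rcases hab with rfl | rfl
    · rw [← sy_neg_third]
      exact sy_mem_symSub ⟨_, _, r, rfl, by ring, Set.mem_univ _, ha, hU.neg _ hb, hr, by omega⟩
    · rw [← sy_neg_snd]
      exact sy_mem_symSub ⟨_, _, r, rfl, by ring, Set.mem_univ _, hU.neg _ ha, hb, hr, by omega⟩

/-- Cone off with `c` the symbols containing both `h` and `v` up to sign. -/
noncomputable def coneOver (c h v : Fin n → ℤ) : Alt (Fin n → ℤ) →+ Alt (Fin n → ℤ) :=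
  Alt.lift (fun l => if (h ∈ l ∨ -h ∈ l) ∧ (v ∈ l ∨ -v ∈ l) then sy (c :: l) else 0)
    (by
      intro l₁ a b l₂
      have h1 : ∀ x, x ∈ l₁ ++ a :: b :: l₂ ↔ x ∈ l₁ ++ b :: a :: l₂ := fun x =>
        ((List.Perm.swap b a l₂).append_left l₁).mem_iff
      simp only [h1]
      split_ifs
      · exact sy_swap (c :: l₁) a b l₂
      · simp)
    (by
      intro l₁ a l₂
      have h1 : ∀ x, (x ∈ l₁ ++ (-a) :: l₂ ∨ -x ∈ l₁ ++ (-a) :: l₂) ↔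
          (x ∈ l₁ ++ a :: l₂ ∨ -x ∈ l₁ ++ a :: l₂) := fun x => by
        simp only [List.mem_append, List.mem_cons, neg_eq_iff_eq_neg, eq_comm (a := x)]
        constructor <;> rintro ((h | h | h) | (h | h | h)) <;> simp [h, eq_comm]
      simp only [h1]
      split_ifs
      · exact sy_neg (c :: l₁) a l₂
      · rfl)
    (by
      intro l₁ a l₂
      split_ifs
      · exact sy_dup (c :: l₁) a l₂
      · rfl)

theorem coneOver_of_mem {c h v : Fin n → ℤ} {l : List (Fin n → ℤ)} (h₁ : h ∈ l) (h₂ : v ∈ l) :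
    coneOver c h v (sy l) = sy (c :: l) := by
  rw [coneOver, lift_sy, if_pos ⟨Or.inl h₁, Or.inl h₂⟩]

theorem coneOver_of_forall_ne {c h v : Fin n → ℤ} {l : List (Fin n → ℤ)}
    (hl : (∀ x ∈ l, x ≠ h ∧ x ≠ -h) ∨ ∀ x ∈ l, x ≠ v ∧ x ≠ -v) :
    coneOver c h v (sy l) = 0 := by
  rw [coneOver, lift_sy, if_neg]
  rintro ⟨h₁, h₂⟩
  rcases hl with hl | hl
  · rcases h₁ with h | h
    · exact (hl _ h).1 rfl
    · exact (hl _ h).2 rfl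
  · rcases h₂ with h | h
    · exact (hl _ h).1 rfl
    · exact (hl _ h).2 rfl

theorem coneOver_NS {c h : Fin n → ℤ} (hc : v + h + c = 0) :
    NS (Fin n → ℤ) ≤ (NS (Fin n → ℤ)).comap (coneOver c h v) := by
  refine symSub_le fun l hl => AddSubgroup.mem_comap.2 ?_
  rw [coneOver, lift_sy]
  split_ifs with hm
  swap
  · exact zero_mem _
  refine sy_mem_symSub fun hsp => hl (hsp.of_mem_span ?_)
  have hmem : ∀ x : Fin n → ℤ, x ∈ l ∨ -x ∈ l → x ∈ Submodule.span ℤ {x | x ∈ l} := by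
    rintro x (h | h)
    · exact Submodule.subset_span h
    · rw [← neg_neg x]
      exact Submodule.neg_mem _ (Submodule.subset_span h)
  simp only [List.mem_cons, forall_eq_or_imp]
  exact ⟨mem_span_of_add_eq_zero (hmem v hm.2) (hmem h hm.1) (by rw [← hc]; abel),
    fun x hx => Submodule.subset_span hx⟩

theorem coneOver_lower (hU : Below f v U) {c h : Fin n → ℤ} (hc : v + h + c = 0) :
    Lower U ≤ (NS (Fin n → ℤ)).comap (coneOver c h v) := by
  refine sup_le (symSub_le fun l hl => AddSubgroup.mem_comap.2 ?_) (coneOver_NS hc)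
  rw [coneOver_of_forall_ne (Or.inr fun x hx => hU.ne (hl x hx))]
  exact zero_mem _

theorem coneOver_bd_twin (hU : Below f v U) {c h : Fin n → ℤ} (hc : v + h + c = 0) (hhU : h ∈ U)
    (hcU : c ∈ U) {r : List (Fin n → ℤ)} (hr : ∀ x ∈ r, x ∈ U) :
    coneOver c h v (bd (sy (v :: h :: c :: r))) = sy (v :: h :: c :: r) := by
  by_cases h0 : h ∈ c :: r ∨ -h ∈ c :: r
  · have : sy (v :: h :: c :: r) = 0 := by
      rw [← cons_sy, sy_eq_zero_of_neg_mem _ _ h0, map_zero]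
    rw [this, map_zero, map_zero]
  have hne : ∀ x ∈ c :: r, x ≠ h ∧ x ≠ -h := by
    intro x hx
    refine ⟨?_, ?_⟩ <;> rintro rfl
    · exact h0 (Or.inl hx)
    · exact h0 (Or.inr hx)
  have e₁ : bd (sy (v :: h :: c :: r)) = sy (h :: c :: r) - sy (v :: c :: r) + sy (v :: h :: r)
      - cons v (cons h (cons c (bd (sy r)))) := by
    simp only [bd_sy_cons, map_sub, cons_sy]
    abel
  have e₂ : ∀ x, coneOver c h v (cons v (cons h (cons c x))) = 0 := fun x =>
    hom_eq (f := (coneOver c h v).comp ((cons v).comp ((cons h).comp (cons c)))) (g := 0)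
      (fun l => by
      simp only [AddMonoidHom.comp_apply, cons_sy, AddMonoidHom.zero_apply]
      rw [coneOver_of_mem (by simp) (by simp)]
      exact sy_eq_zero_of_neg_mem _ _ (Or.inl (by simp))) x
  have e₃ : coneOver c h v (sy (h :: c :: r)) = 0 := by
    refine coneOver_of_forall_ne (Or.inr ?_)
    simp only [List.mem_cons, forall_eq_or_imp]
    exact ⟨hU.ne hhU, hU.ne hcU, fun x hx => hU.ne (hr x hx)⟩
  have e₄ : coneOver c h v (sy (v :: c :: r)) = 0 := by
    refine coneOver_of_forall_ne (Or.inl ?_)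
    rw [List.forall_mem_cons]
    exact ⟨⟨fun h => (hU.ne hhU).1 h.symm, fun h => (hU.ne hhU).2 (by rw [h, neg_neg])⟩, hne⟩
  rw [e₁]
  simp only [map_sub, map_add, e₂, e₃, e₄]
  rw [coneOver_of_mem (by simp) (by simp), sy_swap_front c v, sy_swap_snd v c h]
  abel

theorem twin_exchange {a b c h : Fin n → ℤ} (hab : v + a + b = 0)
    (hc : v + h + c = 0) (ha : a ∈ U) (hb : b ∈ U) (hh : h ∈ U) (hcU : c ∈ U)
    {r : List (Fin n → ℤ)} (hr : ∀ x ∈ r, x ∈ U) (hlen : r.length + 3 = n) :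
    sy (v :: a :: b :: h :: r) - (sy (v :: a :: b :: c :: r) + sy (v :: h :: c :: b :: r) -
      sy (v :: h :: c :: a :: r)) ∈ Trivials U := by
  have hq := kills_mk U (le_refl (Trivials U))
  have hbd := hq.g2 (v :: a :: b :: h :: c :: r)
    ⟨by simp; omega, Or.inl ⟨_, _, _, _, _, _, rfl, hab, hc⟩⟩
  rw [bd_sy_five] at hbd
  have hF : QuotientAddGroup.mk' (Trivials U) (sy (a :: b :: h :: c :: r)) = 0 := by
    refine hq.g1 _ ⟨by simp; omega, Or.inr ?_⟩ ?_
    · refine .pos' _ (.pos' _ (.neg' _ (.neg' _ ?_)))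
      convert SRel.zero r using 1
      linear_combination hc - hab
    · simp only [List.mem_cons, forall_eq_or_imp]
      exact ⟨ha, hb, hh, hcU, hr⟩
  simp only [map_add, map_sub, hq.ns _ (cons_bd_mem_NS_five hlen hab hc), hF] at hbd
  rw [← QuotientAddGroup.eq_zero_iff]
  change QuotientAddGroup.mk' (Trivials U) _ = 0
  have s₁ : ∀ x : Fin n → ℤ, sy (v :: x :: h :: c :: r) = sy (v :: h :: c :: x :: r) := fun x => by
    rw [sy_swap_snd v x h, sy_swap_third v h x c, neg_neg]
  simp only [map_add, map_sub, ← s₁]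
  rw [← hbd]
  abel

theorem twin_split (hU : Below f v U) {c h : Fin n → ℤ} (hc : v + h + c = 0) (hhU : h ∈ U)
    (hcU : c ∈ U) (hv : ∀ x, v + x + x ≠ 0) (S : Set (Fin n → ℤ)) :
    symSub (IsTwin v U (insert h S)) ≤
      symSub (fun l => ∃ r, l = v :: h :: c :: r ∧ (∀ x ∈ r, x ∈ U)) ⊔
        symSub (fun l => IsTwin v U S l ∧ ∀ x ∈ l, x ≠ h ∧ x ≠ -h) ⊔ Trivials U := by
  refine symSub_le ?_
  rintro _ ⟨a, b, r, rfl, hab, haS, ha, hb, hr, hlen⟩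
  have hE : ∀ r : List (Fin n → ℤ), (∀ x ∈ r, x ∈ U) → sy (v :: h :: c :: r) ∈
      symSub (fun l => ∃ r, l = v :: h :: c :: r ∧ (∀ x ∈ r, x ∈ U)) ⊔
        symSub (fun l => IsTwin v U S l ∧ ∀ x ∈ l, x ≠ h ∧ x ≠ -h) ⊔ Trivials U := fun r hr =>
    AddSubgroup.mem_sup_left (AddSubgroup.mem_sup_left (sy_mem_symSub ⟨r, rfl, hr⟩))
  have hno : ∀ x, x ∈ U → v + (-h) + x ≠ 0 := by
    intro x hx hx0
    have h2 := hU.diff c 2 hcU (by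
      convert hU.neg x hx using 1
      have : (2 : ℤ) • v = v + v := two_smul ℤ v
      rw [this]
      linear_combination hc + hx0)
    norm_num at h2
  have hvh := hU.ne hhU
  by_cases hah : a = h
  · subst hah
    obtain rfl : b = c := by linear_combination hab - hc
    exact hE r hr
  have haS := haS.resolve_left hah
  have hah' : a ≠ -h := by
    rintro rfl
    exact hno b hb hab
  by_cases hbh : b = h
  · subst hbh
    obtain rfl : a = c := by linear_combination hab - hc
    rw [sy_swap_snd]
    exact neg_mem (hE r hr)
  have hbh' : b ≠ -h := by
    rintro rfl
    exact hno a ha (by rw [← hab]; abel)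
  by_cases hrh : ∀ x ∈ r, x ≠ h ∧ x ≠ -h
  · refine AddSubgroup.mem_sup_left (AddSubgroup.mem_sup_right (sy_mem_symSub
      ⟨⟨a, b, r, rfl, hab, haS, ha, hb, hr, hlen⟩, ?_⟩))
    simp only [List.forall_mem_cons]
    exact ⟨⟨fun h => hvh.1 h.symm, fun h => hvh.2 (by rw [h, neg_neg])⟩, ⟨hah, hah'⟩,
      ⟨hbh, hbh'⟩, hrh⟩
  obtain hr' | hr' | ⟨r', hr'm, hr'h, hr's, Q, hQ, hQr⟩ := sy_cases h r
  · exact absurd hr' hrh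
  · rw [← cons_sy, ← cons_sy, ← cons_sy, hr']
    simp only [map_zero]
    exact zero_mem _
  have hlen' : r'.length + 3 = n := by
    have := hQr.length_eq
    rw [← hQ.length_eq] at this
    simp at this
    omega
  have hr'U : ∀ x ∈ r', x ∈ U := fun x hx => hr x (hr'm x hx)
  suffices H : sy (v :: a :: b :: h :: r') ∈
      symSub (fun l => ∃ r, l = v :: h :: c :: r ∧ (∀ x ∈ r, x ∈ U)) ⊔
        symSub (fun l => IsTwin v U S l ∧ ∀ x ∈ l, x ≠ h ∧ x ≠ -h) ⊔ Trivials U by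
    rw [← cons_sy, ← cons_sy, ← cons_sy]
    rcases hr's with e | e <;> rw [e]
    · simpa only [cons_sy] using H
    · simp only [map_neg, cons_sy, neg_mem_iff]
      exact H
  have hex := twin_exchange hab hc ha hb hhU hcU hr'U hlen'
  have hmem : ∀ x, x ∈ U → ∀ y ∈ x :: r', y ∈ U := fun x hx => by
    simp only [List.forall_mem_cons]
    exact ⟨hx, hr'U⟩
  rw [← sub_add_cancel (sy (v :: a :: b :: h :: r'))
    (sy (v :: a :: b :: c :: r') + sy (v :: h :: c :: b :: r') - sy (v :: h :: c :: a :: r'))]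
  refine add_mem (AddSubgroup.mem_sup_right hex) (sub_mem (add_mem ?_ (hE _ (hmem b hb)))
    (hE _ (hmem a ha)))
  have hch : ¬ (c = h ∨ c = -h) := by
    rintro (rfl | rfl)
    · exact hv c hc
    · exact hU.ne_zero (by rw [← hc]; abel)
  refine AddSubgroup.mem_sup_left (AddSubgroup.mem_sup_right (sy_mem_symSub
    ⟨⟨a, b, c :: r', rfl, hab, haS, ha, hb, hmem c hcU, by simp; omega⟩, ?_⟩))
  simp only [List.forall_mem_cons]
  exact ⟨⟨fun h => hvh.1 h.symm, fun h => hvh.2 (by rw [h, neg_neg])⟩, ⟨hah, hah'⟩,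
    ⟨hbh, hbh'⟩, not_or.1 hch, hr'h⟩

theorem mem_trivials_of_isTwin (hU : Below f v U) (hv : ∀ x, v + x + x ≠ 0)
    (S : Finset (Fin n → ℤ)) {t : Alt (Fin n → ℤ)} (ht : t ∈ symSub (IsTwin v U S))
    (hbd : bd t ∈ Lower U) : t ∈ Trivials U := by
  induction S using Finset.induction_on generalizing t with
  | empty =>
    have : symSub (IsTwin v U ((∅ : Finset (Fin n → ℤ)) : Set (Fin n → ℤ))) ≤ Trivials U := by
      refine symSub_le ?_
      rintro _ ⟨a, b, r, -, -, ha, -⟩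
      simp at ha
    exact this ht
  | insert h S _ ih =>
    rw [Finset.coe_insert] at ht
    obtain ⟨c, hc⟩ : ∃ c, v + h + c = 0 := ⟨-(v + h), by ring⟩
    by_cases hhc : h ∈ U ∧ c ∈ U
    swap
    · refine ih (symSub_mono (fun l hl => ?_) ht) hbd
      obtain ⟨a, b, r, rfl, hab, haS, ha, hb, hr⟩ := hl
      rcases haS with rfl | haS
      · obtain rfl : b = c := by linear_combination hab - hc
        exact absurd ⟨ha, hb⟩ hhc
      · exact ⟨a, b, r, rfl, hab, haS, ha, hb, hr⟩
    obtain ⟨hhU, hcU⟩ := hhc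
    obtain ⟨y, hy, j, hj, rfl⟩ := AddSubgroup.mem_sup.1 (twin_split hU hc hhU hcU hv S ht)
    obtain ⟨t₁, ht₁, t₂, ht₂, rfl⟩ := AddSubgroup.mem_sup.1 hy
    have hbd' : bd (t₁ + t₂) ∈ Lower U := by
      rw [map_add] at hbd
      exact (add_mem_cancel_right (bd_mem_lower hj)).1 hbd
    have e₁ : coneOver c h v (bd t₁) = t₁ := by
      have : symSub (fun l => ∃ r, l = v :: h :: c :: r ∧ (∀ x ∈ r, x ∈ U)) ≤
          (((coneOver c h v).comp bd) - AddMonoidHom.id _).ker := by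
        refine symSub_le ?_
        rintro _ ⟨r, rfl, hr⟩
        rw [AddMonoidHom.mem_ker, AddMonoidHom.sub_apply, sub_eq_zero]
        exact coneOver_bd_twin hU hc hhU hcU hr
      have := this ht₁
      rwa [AddMonoidHom.mem_ker, AddMonoidHom.sub_apply, sub_eq_zero] at this
    have e₂ : coneOver c h v (bd t₂) = 0 := by
      have : symSub (fun l => IsTwin v U S l ∧ ∀ x ∈ l, x ≠ h ∧ x ≠ -h) ≤
          ((coneOver c h v).ker).comap bd := by
        refine symSub_le fun l hl => AddSubgroup.mem_comap.2 (bd_mem l _ ?_)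
        rintro l₁ a l₂ rfl
        refine coneOver_of_forall_ne (Or.inl fun x hx => hl.2 x ?_)
        simp only [List.mem_append, List.mem_cons] at hx ⊢
        tauto
      exact this ht₂
    have h₁ : t₁ ∈ NS (Fin n → ℤ) := by
      have := coneOver_lower hU hc hbd'
      rwa [AddSubgroup.mem_comap, map_add, map_add, e₁, e₂, add_zero] at this
    have hT₁ : t₁ ∈ Trivials U := AddSubgroup.mem_sup_right h₁
    refine add_mem (add_mem hT₁ (ih (symSub_mono (fun l hl => hl.1) ht₂) ?_)) hj
    rw [map_add] at hbd'
    exact (add_mem_cancel_left (bd_mem_lower hT₁)).1 hbd'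

theorem exists_finset_isTwin {t : Alt (Fin n → ℤ)} (ht : t ∈ symSub (IsTwin v U Set.univ)) :
    ∃ S : Finset (Fin n → ℤ), t ∈ symSub (IsTwin v U S) := by
  induction ht using AddSubgroup.closure_induction with
  | mem x hx =>
    obtain ⟨l, ⟨a, b, r, rfl, hab, -, h⟩, rfl⟩ := hx
    exact ⟨{a}, sy_mem_symSub ⟨a, b, r, rfl, hab, by simp, h⟩⟩
  | zero => exact ⟨∅, zero_mem _⟩
  | neg x _ hx =>
    obtain ⟨S, hS⟩ := hx
    exact ⟨S, neg_mem hS⟩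
  | add x y _ _ hx hy =>
    obtain ⟨S, hS⟩ := hx
    obtain ⟨T, hT⟩ := hy
    have hmono : ∀ {A B : Set (Fin n → ℤ)}, A ⊆ B → symSub (IsTwin v U A) ≤
        symSub (IsTwin v U B) := fun hAB => symSub_mono fun l hl => by
      obtain ⟨a, b, r, rfl, hab, ha, h⟩ := hl
      exact ⟨a, b, r, rfl, hab, hAB ha, h⟩
    refine ⟨S ∪ T, ?_⟩
    rw [Finset.coe_union]
    exact add_mem (hmono Set.subset_union_left hS) (hmono Set.subset_union_right hT)

end Twins

section MainStep

open Alt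

variable {m : ℕ} {f : (Fin (m + 1) → ℤ) →+ ℤ} {v : Fin (m + 1) → ℤ} {U : Set (Fin (m + 1) → ℤ)}
  {p : (Fin (m + 1) → ℤ) →+ (Fin m → ℤ)}

theorem KillsLine.add_add_ne_zero {n : ℕ} {v : Fin n → ℤ} {p : (Fin n → ℤ) →+ (Fin m → ℤ)}
    (hp : KillsLine v p) (hv : ∀ k : ℤ, k • v = 0 → k = 0) (x : Fin n → ℤ) : v + x + x ≠ 0 := by
  intro h
  have h₁ := congrArg p h
  rw [map_add, map_add, hp.map_self, zero_add, map_zero] at h₁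
  have h₂ : p x = 0 := by
    ext i
    have := congrFun h₁ i
    simp only [Pi.add_apply, Pi.zero_apply] at this ⊢
    omega
  obtain ⟨k, rfl⟩ := (hp.ker x).1 h₂
  have := hv (1 + k + k) (by rw [add_smul, add_smul, one_smul]; exact h)
  omega

theorem mem_trivials_of_linkProj_mem (hU : Below f v U) (hp : KillsLine v p)
    {z : Alt (Fin (m + 1) → ℤ)} (hz : z ∈ symSub (IsG1Below v U))
    (hbd : bd z ∈ NS (Fin (m + 1) → ℤ))
    (h : linkProj v p z ∈ (symSub (V := Fin m → ℤ) (IsG2 m)).map bd ⊔ NS (Fin m → ℤ)) :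
    z ∈ Trivials U := by
  have h₁ := (killsTwins_mk hU).eq_zero_of_linkProj_mem hU hp hz h
  obtain ⟨t, ht, j, hj, rfl⟩ := AddSubgroup.mem_sup.1 ((QuotientAddGroup.eq_zero_iff z).1 h₁)
  obtain ⟨S, hS⟩ := exists_finset_isTwin ht
  refine add_mem (mem_trivials_of_isTwin hU
    (hp.add_add_ne_zero fun k => hU.smul_eq_zero) S hS ?_) hj
  rw [map_add] at hbd
  exact (add_mem_cancel_right (bd_mem_lower hj)).1 (AddSubgroup.mem_sup_right hbd)

end MainStep

section Height

variable {m : ℕ}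

/-- The height of a vector: vectors are compared by the size of the first coordinate, then by
their Euclidean norm; vectors of the same height agree up to sign. -/
noncomputable def height (x : Fin (m + 1) → ℤ) : ℕ ×ₗ ℕ ×ₗ ℕ :=
  toLex ((x 0).natAbs,
    toLex ((∑ i, x i ^ 2).toNat, min (Encodable.encode x) (Encodable.encode (-x))))

theorem height_neg (x : Fin (m + 1) → ℤ) : height (-x) = height x := by
  simp [height, min_comm]

theorem height_lt_of_abs_lt {x y : Fin (m + 1) → ℤ} (h : |x 0| < |y 0|) : height x < height y := by
  exact Prod.Lex.toLex_lt_toLex.2 (Or.inl (by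
    rwa [Int.abs_eq_natAbs, Int.abs_eq_natAbs, Int.ofNat_lt] at h))

theorem abs_le_of_height_le {x y : Fin (m + 1) → ℤ} (h : height x ≤ height y) : |x 0| ≤ |y 0| :=
  not_lt.1 fun h' => (height_lt_of_abs_lt h').not_ge h

theorem sum_sq_le_of_height_lt {x y : Fin (m + 1) → ℤ} (h : height x < height y)
    (hxy : |x 0| = |y 0|) : ∑ i, x i ^ 2 ≤ ∑ i, y i ^ 2 := by
  have hx : 0 ≤ ∑ i, x i ^ 2 := Finset.sum_nonneg fun i _ => sq_nonneg _
  have hy : 0 ≤ ∑ i, y i ^ 2 := Finset.sum_nonneg fun i _ => sq_nonneg _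
  rcases Prod.Lex.toLex_lt_toLex.1 h with h | ⟨-, h⟩
  · simp only [Int.abs_eq_natAbs] at h hxy
    omega
  · rcases Prod.Lex.toLex_lt_toLex.1 h with h | ⟨h, -⟩ <;> simp only at h <;> omega

theorem eq_or_eq_neg_of_height_eq {x y : Fin (m + 1) → ℤ} (h : height x = height y) :
    x = y ∨ x = -y := by
  have h₁ : min (Encodable.encode x) (Encodable.encode (-x)) =
      min (Encodable.encode y) (Encodable.encode (-y)) :=
    congrArg (fun t => (ofLex (ofLex t).2).2) h
  rcases min_choice (Encodable.encode x) (Encodable.encode (-x)) with hx | hx <;>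
    rcases min_choice (Encodable.encode y) (Encodable.encode (-y)) with hy | hy <;>
    rw [hx, hy] at h₁ <;> have h₂ := Encodable.encode_injective h₁
  · exact Or.inl h₂
  · exact Or.inr h₂
  · exact Or.inr (by rw [← h₂, neg_neg])
  · exact Or.inl (neg_injective h₂)

theorem eq_zero_of_height_lt {v w : Fin (m + 1) → ℤ} (hw : w 0 = 0) (h₁ : height (v + w) < height v)
    (h₂ : height (v - w) < height v) : w = 0 := by
  have e₁ := sum_sq_le_of_height_lt h₁ (by simp [hw])
  have e₂ := sum_sq_le_of_height_lt h₂ (by simp [hw])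
  have e₃ : ∑ i, (v + w) i ^ 2 + ∑ i, (v - w) i ^ 2 = 2 * ∑ i, v i ^ 2 + 2 * ∑ i, w i ^ 2 := by
    simp only [← Finset.sum_add_distrib, Finset.mul_sum]
    refine Finset.sum_congr rfl fun i _ => ?_
    simp only [Pi.add_apply, Pi.sub_apply]
    ring
  have e₄ : ∑ i, w i ^ 2 = 0 :=
    le_antisymm (by linarith) (Finset.sum_nonneg fun i _ => sq_nonneg _)
  rw [Finset.sum_eq_zero_iff_of_nonneg fun i _ => sq_nonneg _] at e₄
  ext i
  exact pow_eq_zero_iff two_ne_zero |>.1 (e₄ i (Finset.mem_univ i))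

theorem height_not_lt_of_two_le {v u : Fin (m + 1) → ℤ} (hv : 0 < v 0) {k : ℤ} (hk : 2 ≤ k)
    (h₁ : height u < height v) : ¬ height (u + k • v) < height v := by
  intro h₂
  have a₁ := abs_le_of_height_le h₁.le
  have a₂ := abs_le_of_height_le h₂.le
  rw [abs_of_pos hv, abs_le] at a₁ a₂
  simp only [Pi.add_apply, Pi.smul_apply, smul_eq_mul] at a₂
  obtain rfl : k = 2 := by nlinarith
  have hw := eq_zero_of_height_lt (v := v) (w := u + v)
    (by simp only [Pi.add_apply]; linarith) (by convert h₂ using 2; module)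
    (by rw [← height_neg]; convert h₁ using 2; module)
  rw [eq_neg_of_add_eq_zero_left hw, height_neg] at h₁
  exact lt_irrefl _ h₁

theorem below_height {v : Fin (m + 1) → ℤ} (hv : 0 < v 0) :
    Below (Pi.evalAddMonoidHom (fun _ => ℤ) 0) v {u | height u < height v} where
  pos := hv
  neg u hu := by
    rw [Set.mem_ofPred_eq] at hu ⊢
    rwa [height_neg]
  mem u hu := height_lt_of_abs_lt (hu.trans_le (le_abs_self _))
  le u hu := (abs_le_of_height_le (le_of_lt hu)).trans_eq (abs_of_pos hv)
  diff u k hu hk := by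
    by_contra h
    rcases le_abs.1 (show 2 ≤ |k| by omega) with h | h
    · exact height_not_lt_of_two_le hv h hu hk
    · refine height_not_lt_of_two_le hv h hk ?_
      have e : u + k • v + (-k) • v = u := by module
      rwa [e]

end Height

section LineQuotient

variable {m : ℕ}

theorem exists_killsLine {v : Fin (m + 1) → ℤ} {l : List (Fin (m + 1) → ℤ)} (hl : l.length = m)
    (hsp : Sp (v :: l)) : ∃ p : (Fin (m + 1) → ℤ) →+ (Fin m → ℤ), KillsLine v p := by
  let φ : (Fin (m + 1) → ℤ) →ₗ[ℤ] (Fin (m + 1) → ℤ) :=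
    Fintype.linearCombination ℤ ((v :: l).get ∘ finCongr (by simp [hl]))
  have hs : Function.Surjective φ := by
    rw [← LinearMap.range_eq_top, Fintype.range_linearCombination, ← hsp]
    rw [Set.range_comp, (finCongr _).surjective.range_eq, Set.image_univ]
    congr 1
    ext x
    exact List.mem_iff_get.symm
  let e := LinearEquiv.ofBijective φ ⟨OrzechProperty.injective_of_surjective_endomorphism φ hs, hs⟩
  have he : ∀ k : ℤ, e (Pi.single 0 k) = k • v := fun k => by
    change φ _ = _
    rw [Fintype.linearCombination_apply_single]
    rfl
  refine ⟨(LinearMap.funLeft ℤ ℤ Fin.succ).toAddMonoidHom.comp e.symm.toAddMonoidHom, ?_, ?_⟩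
  · refine (LinearMap.funLeft_surjective_of_injective ℤ ℤ _ (Fin.succ_injective _)).comp
      e.symm.surjective
  · intro x
    constructor
    · intro h
      refine ⟨e.symm x 0, ?_⟩
      rw [← he, ← e.symm_apply_eq]
      ext i
      refine Fin.cases ?_ (fun i => ?_) i
      · simp
      · have := congrFun h i
        simpa using this
    · rintro ⟨k, rfl⟩
      rw [← he]
      ext i
      simp [LinearMap.funLeft]

theorem SRel.mem_span {V : Type} [AddCommGroup V] {l : List V} {k : ℕ} {x : V} (h : SRel l k x) :
    x ∈ Submodule.span ℤ {x | x ∈ l} := by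
  have hmono : ∀ (a : V) (l : List V), Submodule.span ℤ {x | x ∈ l} ≤
      Submodule.span ℤ {x | x ∈ a :: l} := fun a l =>
    Submodule.span_mono fun x hx => List.mem_cons_of_mem a hx
  induction h with
  | nil => exact zero_mem _
  | skip a _ ih => exact hmono _ _ ih
  | pos a _ ih => exact add_mem (hmono _ _ ih) (Submodule.subset_span List.mem_cons_self)
  | neg a _ ih => exact sub_mem (hmono _ _ ih) (Submodule.subset_span List.mem_cons_self)

theorem exists_killsLine_of_isG1 {v : Fin (m + 1) → ℤ} {l : List (Fin (m + 1) → ℤ)}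
    (hl : IsG1 (m + 1) l) (hsp : Sp l) (hv : v ∈ l ∨ -v ∈ l) :
    ∃ p : (Fin (m + 1) → ℤ) →+ (Fin m → ℤ), KillsLine v p := by
  have key : ∀ w, w ∈ l → ∃ l', l'.length = m ∧ Sp (w :: l') := by
    intro w hw
    obtain ⟨r, hr⟩ : ∃ r, l.Perm (w :: r) := ⟨_, List.perm_cons_erase hw⟩
    have h₁ : ∃ j y, SRel r (j + 1) y ∧ y ∈ Submodule.span ℤ {w} := by
      have h₂ : ∃ j, SRel (w :: r) (j + 2) 0 := by
        rcases hl.2 with h | h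
        · exact ⟨1, h.perm hr⟩
        · exact ⟨2, h.perm hr⟩
      obtain ⟨j, h₂⟩ := h₂
      generalize hk : j + 2 = k at h₂
      generalize hz : (0 : Fin (m + 1) → ℤ) = z at h₂
      have hw' : w ∈ Submodule.span ℤ {w} := Submodule.mem_span_singleton_self w
      cases h₂ with
      | skip _ h =>
        obtain rfl : k = (j + 1) + 1 := by omega
        exact ⟨_, _, h, hz ▸ zero_mem _⟩
      | @pos _ _ k y h =>
        obtain rfl : k = j + 1 := by omega
        refine ⟨_, _, h, ?_⟩
        rw [eq_neg_of_add_eq_zero_left hz.symm]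
        exact neg_mem hw'
      | @neg _ _ k y h =>
        obtain rfl : k = j + 1 := by omega
        refine ⟨_, _, h, ?_⟩
        rw [eq_of_sub_eq_zero hz.symm]
        exact hw'
    obtain ⟨j, y, h₁, hy⟩ := h₁
    rw [← List.map_id r] at h₁
    obtain ⟨a, s, hs, h₂⟩ := h₁.exists_perm
    simp only [List.map_id, id] at h₂
    have hspan : ∀ {k : ℕ} {x : Fin (m + 1) → ℤ}, SRel s k x →
        x ∈ Submodule.span ℤ {x | x ∈ w :: s} := fun h =>
      Submodule.span_mono (fun x hx => List.mem_cons_of_mem w hx) h.mem_span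
    have hy' : y ∈ Submodule.span ℤ {x | x ∈ w :: s} :=
      Submodule.span_mono (by simp) hy
    have ha : a ∈ Submodule.span ℤ {x | x ∈ w :: s} := by
      rcases h₂ with h₂ | h₂
      · have := sub_mem hy' (hspan h₂)
        rwa [sub_sub_cancel] at this
      · have := sub_mem (hspan h₂) hy'
        rwa [add_sub_cancel_left] at this
    have hlen := hr.length_eq
    rw [List.length_cons, hs.length_eq, List.length_cons, hl.1] at hlen
    refine ⟨s, by omega, (hsp.perm (hr.trans (hs.cons w))).of_mem_span ?_⟩
    simp only [List.mem_cons, forall_eq_or_imp]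
    simp only [← List.mem_cons]
    exact ⟨Submodule.subset_span List.mem_cons_self, ha, fun x hx =>
      Submodule.subset_span (List.mem_cons_of_mem w hx)⟩
  rcases hv with hv | hv
  · obtain ⟨s, hs, h⟩ := key v hv
    exact exists_killsLine hs h
  · obtain ⟨s, hs, h⟩ := key _ hv
    refine exists_killsLine hs (h.of_mem_or_neg ?_)
    simp only [List.mem_cons, forall_eq_or_imp]
    exact ⟨Or.inr (Or.inl (neg_neg v)), fun x hx => Or.inl (Or.inr hx)⟩

end LineQuotient

section Descent

open Alt

variable {m : ℕ}

/-- The generators of `M₁` whose entries have height at most that of `v`. -/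
def IsG1Le (v : Fin (m + 1) → ℤ) (l : List (Fin (m + 1) → ℤ)) : Prop :=
  IsG1 (m + 1) l ∧ ∀ x ∈ l, height x ≤ height v

theorem symSub_isG1Le_mono {v w : Fin (m + 1) → ℤ} (h : height v ≤ height w) :
    symSub (IsG1Le v) ≤ symSub (IsG1Le w) :=
  symSub_mono fun _ hl => ⟨hl.1, fun x hx => (hl.2 x hx).trans h⟩

theorem exists_forall_height_le (l : List (Fin (m + 1) → ℤ)) (hl : l ≠ []) :
    ∃ w ∈ l, ∀ x ∈ l, height x ≤ height w := by
  induction l with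
  | nil => exact absurd rfl hl
  | cons a l ih =>
    simp only [List.mem_cons, forall_eq_or_imp]
    by_cases h : l = []
    · subst h
      exact ⟨a, Or.inl rfl, le_rfl, by simp⟩
    obtain ⟨w, hw, hle⟩ := ih h
    rcases le_total (height a) (height w) with h | h
    · exact ⟨w, Or.inr hw, h, hle⟩
    · exact ⟨a, Or.inl rfl, le_rfl, fun x hx => (hle x hx).trans h⟩

theorem exists_symSub_isG1Le {P : (Fin (m + 1) → ℤ) → Prop} {z : Alt (Fin (m + 1) → ℤ)}
    (hz : z ∈ symSub (fun l => IsG1 (m + 1) l ∧ ∀ x ∈ l, P x)) :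
    z = 0 ∨ ∃ w, P w ∧ z ∈ symSub (IsG1Le w) := by
  induction hz using AddSubgroup.closure_induction with
  | mem x hx =>
    obtain ⟨l, ⟨hl, hP⟩, rfl⟩ := hx
    obtain ⟨w, hw, hle⟩ := exists_forall_height_le l
      (by rintro rfl; have := hl.1; simp at this)
    exact Or.inr ⟨w, hP w hw, sy_mem_symSub ⟨hl, hle⟩⟩
  | zero => exact Or.inl rfl
  | neg x _ hx =>
    rcases hx with rfl | ⟨w, hw, hx⟩
    · exact Or.inl neg_zero
    · exact Or.inr ⟨w, hw, neg_mem hx⟩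
  | add x y _ _ hx hy =>
    rcases hx with rfl | ⟨w, hw, hx⟩
    · rwa [zero_add]
    rcases hy with rfl | ⟨w', hw', hy⟩
    · rw [add_zero]
      exact Or.inr ⟨w, hw, hx⟩
    rcases le_total (height w) (height w') with h | h
    · exact Or.inr ⟨w', hw', add_mem (symSub_isG1Le_mono h hx) hy⟩
    · exact Or.inr ⟨w, hw, add_mem hx (symSub_isG1Le_mono h hy)⟩

theorem not_sp_of_forall_apply_eq_zero {l : List (Fin (m + 1) → ℤ)} (h : ∀ x ∈ l, x 0 = 0) :
    ¬ Sp l := by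
  intro hsp
  have h₁ : Submodule.span ℤ {x | x ∈ l} ≤
      LinearMap.ker (LinearMap.proj (R := ℤ) (φ := fun _ : Fin (m + 1) => ℤ) 0) :=
    Submodule.span_le.2 fun x hx => h x hx
  rw [hsp] at h₁
  have := h₁ (x := Pi.single 0 1) trivial
  simp at this

theorem SRel.le_length {V : Type} [AddCommGroup V] {l : List V} {k : ℕ} {y : V} (h : SRel l k y) :
    k ≤ l.length := by
  induction h with
  | nil => rfl
  | skip a _ ih => exact ih.trans (Nat.le_succ _)
  | pos a _ ih => exact Nat.succ_le_succ ih
  | neg a _ ih => exact Nat.succ_le_succ ih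

/-- Every `M₁`-cycle with entries of height at most that of `v` can be rewritten with entries
of smaller height. -/
theorem mem_trivials_of_isG1Le
    (ih : ∀ z ∈ symSub (V := Fin m → ℤ) (IsG1 m), bd z ∈ NS (Fin m → ℤ) →
      z ∈ (symSub (V := Fin m → ℤ) (IsG2 m)).map bd ⊔ NS (Fin m → ℤ))
    {v : Fin (m + 1) → ℤ} (hv : 0 < v 0) {z : Alt (Fin (m + 1) → ℤ)} (hz : z ∈ symSub (IsG1Le v))
    (hbd : bd z ∈ NS (Fin (m + 1) → ℤ)) : z ∈ Trivials {u | height u < height v} := by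
  have hU := below_height hv
  have hle : ∀ l, IsG1Le v l → IsG1Below v {u | height u < height v} l := fun l hl =>
    ⟨hl.1, fun x hx => (hl.2 x hx).lt_or_eq.imp_right eq_or_eq_neg_of_height_eq⟩
  have hzB := symSub_mono hle hz
  by_cases h : ∃ l, IsG1 (m + 1) l ∧ Sp l ∧ (v ∈ l ∨ -v ∈ l)
  · obtain ⟨l, hl, hsp, hvl⟩ := h
    obtain ⟨p, hp⟩ := exists_killsLine_of_isG1 hl hsp hvl
    refine mem_trivials_of_linkProj_mem hU hp hzB hbd (ih _ ?_ ?_)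
    · have : symSub (IsG1Below v {u | height u < height v}) ≤
          (symSub (V := Fin m → ℤ) (IsG1 m)).comap (linkProj v p) :=
        symSub_le fun g hg => linkProj_mem_of_isG1Below hU hp hg
      exact this hzB
    · have := linkProj_NS hp hbd
      rw [AddSubgroup.mem_comap, linkProj_bd] at this
      exact neg_mem_iff.1 this
  · have : symSub (IsG1Below v {u | height u < height v}) ≤
        Trivials {u | height u < height v} := by
      refine symSub_le fun l hl => ?_
      by_cases hsp : Sp l
      · refine AddSubgroup.mem_sup_left (AddSubgroup.mem_sup_right (sy_mem_symSub ⟨hl.1, fun x hx =>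
          (hl.2 x hx).resolve_right ?_⟩))
        rintro (rfl | rfl)
        · exact h ⟨l, hl.1, hsp, Or.inl hx⟩
        · exact h ⟨l, hl.1, hsp, Or.inr hx⟩
      · exact AddSubgroup.mem_sup_right (sy_mem_symSub hsp)
    exact this hzB

/-- Modulo non-generating symbols, every cycle built from `M₁`-generators is a combination of
boundaries of `M₂`-generators. -/
theorem mem_map_bd_of_bd_mem_NS (n : ℕ) : ∀ z ∈ symSub (V := Fin n → ℤ) (IsG1 n),
    bd z ∈ NS (Fin n → ℤ) → z ∈ (symSub (V := Fin n → ℤ) (IsG2 n)).map bd ⊔ NS (Fin n → ℤ) := by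
  induction n with
  | zero =>
    intro z hz _
    have : symSub (V := Fin 0 → ℤ) (IsG1 0) ≤ ⊥ := by
      refine symSub_le ?_
      rintro l ⟨hl, h | h⟩ <;> have := h.le_length <;> omega
    rw [(AddSubgroup.mem_bot).1 (this hz)]
    exact zero_mem _
  | succ m ih =>
    have key : ∀ v : Fin (m + 1) → ℤ, ∀ z ∈ symSub (IsG1Le v), bd z ∈ NS (Fin (m + 1) → ℤ) →
        z ∈ (symSub (V := Fin (m + 1) → ℤ) (IsG2 (m + 1))).map bd ⊔ NS (Fin (m + 1) → ℤ) := by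
      intro v
      induction v using (InvImage.wf (height (m := m)) wellFounded_lt).induction with
      | _ v ihv =>
      intro z hz hbd
      by_cases h0 : v 0 = 0
      · have : symSub (IsG1Le v) ≤ NS (Fin (m + 1) → ℤ) :=
          symSub_le fun l hl => sy_mem_symSub (not_sp_of_forall_apply_eq_zero fun x hx => by
            have := abs_le_of_height_le (hl.2 x hx)
            rwa [h0, abs_zero, abs_nonpos_iff] at this)
        exact AddSubgroup.mem_sup_right (this hz)
      have hT : z ∈ Trivials {u | height u < height v} := by
        rcases lt_or_gt_of_ne h0 with h0 | h0
        · have := mem_trivials_of_isG1Le ih (v := -v) (by simpa using h0)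
            (symSub_isG1Le_mono (height_neg v).ge hz) hbd
          rwa [height_neg] at this
        · exact mem_trivials_of_isG1Le ih h0 hz hbd
      obtain ⟨s, hs, y, hy, rfl⟩ := AddSubgroup.mem_sup.1 hT
      obtain ⟨_, ⟨w, hw, rfl⟩, φ, hφ, rfl⟩ := AddSubgroup.mem_sup.1 hs
      refine add_mem (add_mem (AddSubgroup.mem_sup_left ⟨w, hw, rfl⟩) ?_)
        (AddSubgroup.mem_sup_right hy)
      rw [map_add, map_add, bd_bd, zero_add] at hbd
      have hbdφ := (add_mem_cancel_right (bd_mem_NS hy)).1 hbd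
      rcases exists_symSub_isG1Le hφ with rfl | ⟨v', hv', hφ'⟩
      · exact zero_mem _
      · exact ihv v' hv' φ hφ' hbdφ
    intro z hz hbd
    have hz' : z ∈ symSub (fun l => IsG1 (m + 1) l ∧ ∀ x ∈ l, True) :=
      symSub_mono (fun l hl => ⟨hl, fun _ _ => trivial⟩) hz
    rcases exists_symSub_isG1Le hz' with rfl | ⟨v, -, hv⟩
    · exact zero_mem _
    · exact key v z hv hbd

end Descent

section Tuples

open Alt

theorem exists_ofFn_eq {V : Type} {N : ℕ} {l : List V} (h : l.length = N) :
    ∃ a : Fin N → V, List.ofFn a = l := by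
  subst h
  exact ⟨l.get, List.ofFn_get l⟩

theorem lt_of_ofFn_eq {V : Type} {N : ℕ} {a : Fin N → V} {l₁ l₂ : List V} {x y : V}
    (h : List.ofFn a = l₁ ++ x :: y :: l₂) : l₁.length + 1 < N := by
  have := congrArg List.length h
  simp only [List.length_ofFn, List.length_append, List.length_cons] at this
  omega

theorem apply_of_ofFn_eq {V : Type} {N : ℕ} {a : Fin N → V} {l : List V}
    (h : List.ofFn a = l) (k : ℕ) (hk : k < N) : l[k]? = some (a ⟨k, hk⟩) := by
  subst h
  simp [hk]

theorem ofFn_comp_swap {V : Type} {N : ℕ} {a : Fin N → V} {l₁ l₂ : List V} {x y : V}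
    (h : List.ofFn a = l₁ ++ x :: y :: l₂) :
    List.ofFn (a ∘ Equiv.swap ⟨l₁.length, by have := lt_of_ofFn_eq h; omega⟩
      ⟨l₁.length + 1, lt_of_ofFn_eq h⟩) = l₁ ++ y :: x :: l₂ := by
  have hN := lt_of_ofFn_eq h
  have hlen := congrArg List.length h
  simp only [List.length_ofFn, List.length_append, List.length_cons] at hlen
  have e := apply_of_ofFn_eq h
  have e₁ := e l₁.length (by omega)
  have e₂ := e (l₁.length + 1) (by omega)
  simp only [List.getElem?_append_right le_rfl, Nat.sub_self, List.getElem?_cons_zero,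
    List.getElem?_append_right (Nat.le_add_right _ 1), Nat.add_sub_cancel_left,
    List.getElem?_cons_succ, Option.some_inj] at e₁ e₂
  refine List.ext_getElem (by simp; omega) fun k h₁ h₂ => ?_
  rw [List.length_ofFn] at h₁
  rw [List.getElem_ofFn, Function.comp_apply]
  rcases lt_trichotomy k l₁.length with hk | rfl | hk
  · rw [Equiv.swap_apply_of_ne_of_ne (by simp; omega) (by simp; omega), List.getElem_append_left hk]
    have := e k h₁
    rw [List.getElem?_append_left hk, List.getElem?_eq_getElem hk, Option.some_inj] at this
    exact this.symm
  · simp [e₂]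
  · obtain rfl | hk := Nat.eq_or_lt_of_le hk
    · simp [e₁]
    obtain ⟨d, rfl⟩ := Nat.exists_eq_add_of_le hk
    rw [Equiv.swap_apply_of_ne_of_ne (by simp; omega) (by simp; omega)]
    have := e _ h₁
    rw [List.getElem?_append_right (by omega)] at this
    rw [List.getElem_append_right (by omega)]
    have hd : l₁.length.succ + 1 + d - l₁.length = d + 2 := by omega
    simp only [hd] at this ⊢
    simp at this ⊢
    rw [List.getElem?_eq_getElem, Option.some_inj] at this
    exact this.symm

theorem ofFn_split {V : Type} {N : ℕ} (a : Fin N → V) (k : ℕ) (hk : k + 1 < N) :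
    ∃ l₁ x y l₂, l₁.length = k ∧ List.ofFn a = l₁ ++ x :: y :: l₂ := by
  refine ⟨(List.ofFn a).take k, a ⟨k, by omega⟩, a ⟨k + 1, hk⟩, (List.ofFn a).drop (k + 2),
    by simp; omega, ?_⟩
  conv_lhs => rw [← List.take_append_drop k (List.ofFn a),
    List.drop_eq_getElem_cons (by simp; omega), List.drop_eq_getElem_cons (by simp; omega)]
  simp

variable {V : Type} [AddCommGroup V]

theorem sy_ofFn_comp_perm {N : ℕ} (σ : Equiv.Perm (Fin N)) (a : Fin N → V) :
    sy (List.ofFn (a ∘ σ)) = ((Equiv.Perm.sign σ : ℤˣ) : ℤ) • sy (List.ofFn a) := by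
  cases N with
  | zero => simp [Subsingleton.elim σ 1]
  | succ N =>
    have hσ : σ ∈ Submonoid.closure
        (Set.range fun i : Fin N => Equiv.swap i.castSucc i.succ) := by
      rw [Equiv.Perm.mclosure_swap_castSucc_succ]
      trivial
    induction hσ using Submonoid.closure_induction generalizing a with
    | mem σ h =>
      obtain ⟨i, rfl⟩ := h
      obtain ⟨l₁, x, y, l₂, hl, h⟩ := ofFn_split a i (by omega)
      have h' := ofFn_comp_swap h
      have e₁ : (⟨l₁.length, by omega⟩ : Fin (N + 1)) = i.castSucc := Fin.ext hl
      have e₂ : (⟨l₁.length + 1, by omega⟩ : Fin (N + 1)) = i.succ := Fin.ext (by simp [hl])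
      rw [e₁, e₂] at h'
      rw [h, h', sy_swap, Equiv.Perm.sign_swap (Fin.castSucc_lt_succ).ne]
      simp
    | one => simp
    | mul σ τ _ _ hσ hτ =>
      rw [Equiv.Perm.coe_mul, ← Function.comp_assoc, hτ, hσ, smul_smul, Equiv.Perm.sign_mul,
        Units.val_mul, mul_comm]

theorem bd_sy_ofFn {N : ℕ} (a : Fin (N + 1) → V) :
    bd (sy (List.ofFn a)) = ∑ i : Fin (N + 1), ((-1 : ℤ) ^ (i : ℕ)) •
      sy (List.ofFn (a ∘ i.succAbove)) := by
  induction N with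
  | zero => simp [bd_sy_cons, bd_nil]
  | succ N ih =>
    rw [List.ofFn_succ, bd_sy_cons, ih, Fin.sum_univ_succ (n := N + 1), map_sum, sub_eq_add_neg,
      ← Finset.sum_neg_distrib]
    congr 1
    refine Finset.sum_congr rfl fun i _ => ?_
    rw [map_zsmul, cons_sy, ← neg_smul, Fin.val_succ, pow_succ, mul_neg_one,
      List.ofFn_succ (f := a ∘ i.succ.succAbove)]
    simp [Function.comp_def]

theorem units_smul_eq_or (u : ℤˣ) (x : V) : (u : ℤ) • x = x ∨ (u : ℤ) • x = -x := by
  rcases Int.units_eq_one_or u with rfl | rfl <;> simp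

theorem forall₂_ofFn_smul {N : ℕ} (ε : Fin N → ℤˣ) (a : Fin N → V) :
    List.Forall₂ (fun a b => b = a ∨ b = -a) (List.ofFn a)
      (List.ofFn fun t => ((ε t : ℤˣ) : ℤ) • a t) := by
  rw [List.forall₂_iff_get]
  simp only [List.length_ofFn, true_and]
  intro i h₁ h₂
  simpa using units_smul_eq_or _ _

end Tuples

section GeneratingTuples

open Alt

variable {n : ℕ}

theorem linearIndependent_of_span_eq_top {ι : Type} [Fintype ι] (g : ι → (Fin n → ℤ))
    (hι : Fintype.card ι = n) (hg : Submodule.span ℤ (Set.range g) = ⊤) :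
    LinearIndependent ℤ g := by
  let e : (Fin n → ℤ) ≃ₗ[ℤ] (ι → ℤ) :=
    LinearEquiv.funCongrLeft ℤ ℤ (Fintype.equivFinOfCardEq hι)
  rw [linearIndependent_iff_injective_fintypeLinearCombination]
  have hs : Function.Surjective (Fintype.linearCombination ℤ g) := by
    rw [← LinearMap.range_eq_top, Fintype.range_linearCombination, hg]
  have := OrzechProperty.injective_of_surjective_endomorphism
    ((Fintype.linearCombination ℤ g).comp e.toLinearMap) (hs.comp e.surjective)
  intro x y h
  have := @this (e.symm x) (e.symm y) (by simpa using h)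
  exact e.symm.injective this

theorem isBasisOn_of_span {ι : Type} [Finite ι] {v : ι → (Fin n → ℤ)} {s : Set ι}
    (hs : s.ncard = n) (h : Submodule.span ℤ (v '' s) = ⊤) : IsBasisOn v s := by
  have := Fintype.ofFinite s
  refine ⟨linearIndependent_of_span_eq_top _ ?_ ?_, h⟩
  · rw [← Nat.card_eq_fintype_card, ← hs]
    rfl
  · rw [← h, Set.image_eq_range]
    rfl

theorem sp_ofFn_iff {N : ℕ} {v : Fin N → (Fin n → ℤ)} :
    Sp (List.ofFn v) ↔ Submodule.span ℤ (Set.range v) = ⊤ := by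
  have : {x | x ∈ List.ofFn v} = Set.range v := by
    ext x
    simp [List.mem_ofFn]
  rw [Sp, this]

theorem IsBasisOn.sp {N : ℕ} {v : Fin N → (Fin n → ℤ)} {s : Set (Fin N)} (h : IsBasisOn v s) :
    Sp (List.ofFn v) := by
  rw [sp_ofFn_iff, eq_top_iff, ← h.2]
  exact Submodule.span_mono (Set.image_subset_range _ _)

theorem gen0_iff {v : Fin n → (Fin n → ℤ)} : Gen0 n v ↔ Sp (List.ofFn v) := by
  refine ⟨fun h => h.sp, fun h => isBasisOn_of_span (by simp) ?_⟩
  rw [Set.image_univ]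
  exact sp_ofFn_iff.1 h

theorem SRel.exists_perm_units {V ι : Type} [AddCommGroup V] (g : ι → V) {P : List ι}
    {k : ℕ} {y : V}
    (h : SRel (P.map g) (k + 1) y) :
    ∃ a P', P.Perm (a :: P') ∧ ∃ ε : ℤˣ, SRel (P'.map g) k (y + (ε : ℤ) • g a) := by
  obtain ⟨a, P', hP, h | h⟩ := h.exists_perm
  · exact ⟨a, P', hP, -1, by simpa [sub_eq_add_neg] using h⟩
  · exact ⟨a, P', hP, 1, by simpa using h⟩

theorem SRel.units {V : Type} [AddCommGroup V] {l : List V} {k : ℕ} {y : V} (a : V) (ε : ℤˣ)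
    (h : SRel l k y) : SRel (a :: l) (k + 1) (y + (ε : ℤ) • a) := by
  rcases Int.units_eq_one_or ε with rfl | rfl
  · simpa using h.pos a
  · simpa [sub_eq_add_neg] using h.neg a

theorem exists_perm_finRange {N : ℕ} {I : List (Fin N)} (h : I.Nodup) :
    ∃ r, (I ++ r).Perm (List.finRange N) := by
  obtain ⟨l, hl, hs⟩ := List.subperm_of_subset h fun x _ => List.mem_finRange x
  obtain ⟨r, hr⟩ := hs.exists_perm_append
  exact ⟨r, ((hl.append_right r).symm).trans hr.symm⟩

theorem smul_units_smul {V : Type} [AddCommGroup V] (ε : ℤˣ) (x y : V)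
    (h : (ε : ℤ) • x + y = 0) : x = ((-ε : ℤˣ) : ℤ) • y := by
  rcases Int.units_eq_one_or ε with rfl | rfl
  · simpa using eq_neg_of_add_eq_zero_left h
  · have : -x + y = 0 := by simpa using h
    simpa using (neg_add_eq_zero.1 this)

theorem gen1_iff {v : Fin (n + 1) → (Fin n → ℤ)} :
    Gen1 n v ↔ Sp (List.ofFn v) ∧ (SRel (List.ofFn v) 3 0 ∨ SRel (List.ofFn v) 4 0) := by
  rw [List.ofFn_eq_map]
  constructor
  · rintro ⟨i, j, k, hij, hik, hjk, hb, h⟩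
    refine ⟨by rw [← List.ofFn_eq_map]; exact hb.sp, ?_⟩
    rcases h with ⟨ε, η, h⟩ | ⟨l, hli, hlj, hlk, ε, η, θ, h⟩
    · left
      obtain ⟨r, hr⟩ := exists_perm_finRange (I := [i, j, k]) (by simp [hij, hik, hjk])
      refine SRel.perm (hr.map v) ?_
      have := (((SRel.zero (r.map v)).units (v k) η).units (v j) ε).units (v i) (-1)
      have hz : (0 : Fin n → ℤ) = 0 + (η : ℤ) • v k + (ε : ℤ) • v j + ((-1 : ℤˣ) : ℤ) • v i := by
        rw [h, Units.val_neg, Units.val_one]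
        module
      rw [hz]
      exact this
    · right
      obtain ⟨r, hr⟩ := exists_perm_finRange (I := [i, j, k, l])
        (by simp [hij, hik, hjk, hli.symm, hlj.symm, hlk.symm])
      refine SRel.perm (hr.map v) ?_
      have := ((((SRel.zero (r.map v)).units (v l) θ).units (v k) η).units (v j) ε).units (v i) (-1)
      have hz : (0 : Fin n → ℤ) =
          0 + (θ : ℤ) • v l + (η : ℤ) • v k + (ε : ℤ) • v j + ((-1 : ℤˣ) : ℤ) • v i := by
        rw [h, Units.val_neg, Units.val_one]
        module
      rw [hz]
      exact this
  · rintro ⟨hsp, h⟩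
    have hB : ∀ i : Fin (n + 1), v i ∈ Submodule.span ℤ (v '' {x | x ≠ i}) →
        IsBasisOn v {x | x ≠ i} := by
      intro i hi
      refine isBasisOn_of_span ?_ ?_
      · have : {x | x ≠ i} = ({i} : Set (Fin (n + 1)))ᶜ := rfl
        rw [this, Set.ncard_compl, Set.ncard_singleton, Nat.card_fin, Nat.add_sub_cancel]
      rw [← List.ofFn_eq_map, sp_ofFn_iff] at hsp
      rw [eq_top_iff, ← hsp, Submodule.span_le]
      rintro _ ⟨t, rfl⟩
      by_cases ht : t = i
      · subst ht
        exact hi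
      · exact Submodule.subset_span ⟨t, ht, rfl⟩
    have hm : ∀ {i j : Fin (n + 1)} (ε : ℤˣ), i ≠ j →
        (ε : ℤ) • v j ∈ Submodule.span ℤ (v '' {x | x ≠ i}) := fun ε h =>
      Submodule.smul_mem _ _ (Submodule.subset_span ⟨_, h.symm, rfl⟩)
    rcases h with h | h
    · obtain ⟨i, P₁, h₁, ε₁, h⟩ := h.exists_perm_units
      obtain ⟨j, P₂, h₂, ε₂, h⟩ := h.exists_perm_units
      obtain ⟨k, P₃, h₃, ε₃, h⟩ := h.exists_perm_units
      have hnd := ((h₁.trans ((h₂.trans (h₃.cons j)).cons i)).nodup_iff).1 (List.nodup_finRange _)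
      simp only [List.nodup_cons, List.mem_cons, not_or] at hnd
      obtain ⟨⟨hij, hik, -⟩, ⟨hjk, -⟩, -⟩ := hnd
      have e := h.eq_zero
      rw [zero_add, add_assoc] at e
      have e' := smul_units_smul _ _ _ e
      rw [smul_add, smul_smul, smul_smul, ← Units.val_mul, ← Units.val_mul] at e'
      refine ⟨i, j, k, hij, hik, hjk, hB i ?_, Or.inl ⟨_, _, e'⟩⟩
      rw [e']
      exact add_mem (hm _ hij) (hm _ hik)
    · obtain ⟨i, P₁, h₁, ε₁, h⟩ := h.exists_perm_units
      obtain ⟨j, P₂, h₂, ε₂, h⟩ := h.exists_perm_units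
      obtain ⟨k, P₃, h₃, ε₃, h⟩ := h.exists_perm_units
      obtain ⟨l, P₄, h₄, ε₄, h⟩ := h.exists_perm_units
      have hnd := ((h₁.trans ((h₂.trans ((h₃.trans (h₄.cons k)).cons j)).cons i)).nodup_iff).1
        (List.nodup_finRange _)
      simp only [List.nodup_cons, List.mem_cons, not_or] at hnd
      obtain ⟨⟨hij, hik, hil, -⟩, ⟨hjk, hjl, -⟩, ⟨hkl, -⟩, -⟩ := hnd
      have e := h.eq_zero
      rw [zero_add, add_assoc, add_assoc, ← add_assoc ((ε₂ : ℤ) • v j)] at e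
      have e' := smul_units_smul _ _ _ e
      rw [smul_add, smul_add, smul_smul, smul_smul, smul_smul, ← Units.val_mul, ← Units.val_mul,
        ← Units.val_mul] at e'
      refine ⟨i, j, k, hij, hik, hjk, hB i ?_, Or.inr
        ⟨l, Ne.symm hil, Ne.symm hjl, Ne.symm hkl, _, _, _, e'⟩⟩
      rw [e']
      exact add_mem (add_mem (hm _ hij) (hm _ hik)) (hm _ hil)

theorem gen2_of_isG2 {v : Fin (n + 2) → (Fin n → ℤ)} (hsp : Sp (List.ofFn v))
    (h : IsG2 n (List.ofFn v)) : Gen2 n v := by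
  have hB : ∀ i j : Fin (n + 2), i ≠ j → v i ∈ Submodule.span ℤ (v '' {x | x ≠ i ∧ x ≠ j}) →
      v j ∈ Submodule.span ℤ (v '' {x | x ≠ i ∧ x ≠ j}) → IsBasisOn v {x | x ≠ i ∧ x ≠ j} := by
    intro i j hij hi hj
    refine isBasisOn_of_span ?_ ?_
    · have : {x | x ≠ i ∧ x ≠ j} = ({i, j} : Set (Fin (n + 2)))ᶜ := by
        ext x
        simp
      rw [this, Set.ncard_compl, Set.ncard_pair hij, Nat.card_fin, Nat.add_sub_cancel]
    · rw [sp_ofFn_iff] at hsp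
      rw [eq_top_iff, ← hsp, Submodule.span_le]
      rintro _ ⟨t, rfl⟩
      by_cases hti : t = i
      · subst hti
        exact hi
      by_cases htj : t = j
      · subst htj
        exact hj
      exact Submodule.subset_span ⟨t, ⟨hti, htj⟩, rfl⟩
  have hm : ∀ {i j t : Fin (n + 2)} (ε : ℤˣ), t ≠ i → t ≠ j →
      (ε : ℤ) • v t ∈ Submodule.span ℤ (v '' {x | x ≠ i ∧ x ≠ j}) := fun ε h h' =>
    Submodule.smul_mem _ _ (Submodule.subset_span ⟨_, ⟨h, h'⟩, rfl⟩)
  obtain ⟨-, ⟨s, a, b, c, d, r, hl, h₁, h₂⟩ | ⟨a, b, c, d, e, f, r, hl, h₁, h₂⟩⟩ := h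
  · have hlen := congrArg List.length hl
    simp only [List.length_ofFn, List.length_cons] at hlen
    have g := apply_of_ofFn_eq hl
    have g₀ := g 0 (by omega)
    have g₁ := g 1 (by omega)
    have g₂ := g 2 (by omega)
    have g₃ := g 3 (by omega)
    have g₄ := g 4 (by omega)
    simp only [List.getElem?_cons_zero, List.getElem?_cons_succ, Option.some_inj] at g₀ g₁ g₂ g₃ g₄
    subst g₀ g₁ g₂ g₃ g₄
    have e₁ : v ⟨1, by omega⟩ = ((-1 : ℤˣ) : ℤ) • v ⟨2, by omega⟩ +
        ((-1 : ℤˣ) : ℤ) • v ⟨0, by omega⟩ := by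
      rw [Units.val_neg, Units.val_one, neg_one_smul, neg_one_smul]
      linear_combination h₁
    have e₂ : v ⟨3, by omega⟩ = ((-1 : ℤˣ) : ℤ) • v ⟨4, by omega⟩ +
        ((-1 : ℤˣ) : ℤ) • v ⟨0, by omega⟩ := by
      rw [Units.val_neg, Units.val_one, neg_one_smul, neg_one_smul]
      linear_combination h₂
    refine ⟨⟨1, by omega⟩, ⟨3, by omega⟩, ⟨2, by omega⟩, ⟨0, by omega⟩, ⟨4, by omega⟩, by simp,
      hB _ _ (by simp) ?_ ?_, ⟨_, _, e₁⟩, Or.inl ⟨_, _, e₂⟩⟩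
    · rw [e₁]
      exact add_mem (hm _ (by simp) (by simp)) (hm _ (by simp) (by simp))
    · rw [e₂]
      exact add_mem (hm _ (by simp) (by simp)) (hm _ (by simp) (by simp))
  · have hlen := congrArg List.length hl
    simp only [List.length_ofFn, List.length_cons] at hlen
    have g := apply_of_ofFn_eq hl
    have g₀ := g 0 (by omega)
    have g₁ := g 1 (by omega)
    have g₂ := g 2 (by omega)
    have g₃ := g 3 (by omega)
    have g₄ := g 4 (by omega)
    have g₅ := g 5 (by omega)
    simp only [List.getElem?_cons_zero, List.getElem?_cons_succ,
      Option.some_inj] at g₀ g₁ g₂ g₃ g₄ g₅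
    subst g₀ g₁ g₂ g₃ g₄ g₅
    have e₁ : v ⟨0, by omega⟩ = ((-1 : ℤˣ) : ℤ) • v ⟨1, by omega⟩ +
        ((-1 : ℤˣ) : ℤ) • v ⟨2, by omega⟩ := by
      rw [Units.val_neg, Units.val_one, neg_one_smul, neg_one_smul]
      linear_combination h₁
    have e₂ : v ⟨3, by omega⟩ = ((-1 : ℤˣ) : ℤ) • v ⟨4, by omega⟩ +
        ((-1 : ℤˣ) : ℤ) • v ⟨5, by omega⟩ := by
      rw [Units.val_neg, Units.val_one, neg_one_smul, neg_one_smul]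
      linear_combination h₂
    refine ⟨⟨0, by omega⟩, ⟨3, by omega⟩, ⟨1, by omega⟩, ⟨2, by omega⟩, ⟨4, by omega⟩, by simp,
      hB _ _ (by simp) ?_ ?_, ⟨_, _, e₁⟩, Or.inr ⟨⟨5, by omega⟩, by simp, by simp, by simp, by simp,
        by simp, _, _, e₂⟩⟩
    · rw [e₁]
      exact add_mem (hm _ (by simp) (by simp)) (hm _ (by simp) (by simp))
    · rw [e₂]
      exact add_mem (hm _ (by simp) (by simp)) (hm _ (by simp) (by simp))

theorem Gen2.exists_isG2 {v : Fin (n + 2) → (Fin n → ℤ)} (h : Gen2 n v) :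
    ∃ l, IsG2 n l ∧ (sy (List.ofFn v) = sy l ∨ sy (List.ofFn v) = - sy l) := by
  have key : ∀ (I : List (Fin (n + 2))), I.Nodup → ∀ L : List (Fin n → ℤ),
      List.Forall₂ (fun a b => b = a ∨ b = -a) (I.map v) L →
      ∃ r : List (Fin n → ℤ), (L ++ r).length = n + 2 ∧
        (sy (List.ofFn v) = sy (L ++ r) ∨ sy (List.ofFn v) = - sy (L ++ r)) := by
    intro I hI L hL
    obtain ⟨r, hr⟩ := exists_perm_finRange hI
    refine ⟨r.map v, ?_, ?_⟩
    · have := hr.length_eq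
      rw [List.length_append, List.length_finRange] at this
      rw [List.length_append, ← hL.length_eq, List.length_map, List.length_map, this]
    · have h₁ : sy (L ++ r.map v) = sy ((I ++ r).map v) := by
        rw [List.map_append]
        exact sy_forall₂ (List.rel_append hL (List.forall₂_same.2 fun _ _ => Or.inl rfl))
      rw [h₁, List.ofFn_eq_map]
      exact sy_perm (hr.map v).symm
  obtain ⟨i, j, k, l, m, hne, -, ⟨ε, η, h₁⟩,
    ⟨ε', η', h₂⟩ | ⟨q, hqi, hqj, hqk, hql, hqm, ε', η', h₂⟩⟩ := h
  · simp only [List.pairwise_cons, List.mem_cons, forall_eq_or_imp, List.not_mem_nil,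
      IsEmpty.forall_iff, implies_true, and_true, List.Pairwise.nil] at hne
    obtain ⟨⟨hij, hik, hil, him⟩, ⟨hjk, hjl, hjm⟩, ⟨hkl, hkm⟩, hlm⟩ := hne
    obtain ⟨r, hr, hs⟩ := key [l, k, i, m, j] (by
        simp [him, hkm, hlm, hij, hil.symm, hik.symm, hjk.symm, hjl.symm, hjm.symm, hkl.symm])
      [v l, ((η * ε : ℤˣ) : ℤ) • v k, ((-η : ℤˣ) : ℤ) • v i, ((η' * ε' : ℤˣ) : ℤ) • v m,
        ((-η' : ℤˣ) : ℤ) • v j]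
      (.cons (Or.inl rfl) (.cons (units_smul_eq_or _ _) (.cons (units_smul_eq_or _ _)
        (.cons (units_smul_eq_or _ _) (.cons (units_smul_eq_or _ _) .nil)))))
    have e : ∀ (ε η : ℤˣ) (x y z : Fin n → ℤ), x = (ε : ℤ) • y + (η : ℤ) • z →
        z + ((η * ε : ℤˣ) : ℤ) • y + ((-η : ℤˣ) : ℤ) • x = 0 := by
      rintro ε η x y z rfl
      rcases Int.units_eq_one_or η with rfl | rfl <;>
        simp only [one_mul, neg_mul, Units.val_neg, Units.val_one, neg_neg] <;> module
    exact ⟨_, ⟨hr, Or.inl ⟨_, _, _, _, _, r, rfl, e _ _ _ _ _ h₁, e _ _ _ _ _ h₂⟩⟩, hs⟩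
  · simp only [List.pairwise_cons, List.mem_cons, forall_eq_or_imp, List.not_mem_nil,
      IsEmpty.forall_iff, implies_true, and_true, List.Pairwise.nil] at hne
    obtain ⟨⟨hij, hik, hil, him⟩, ⟨hjk, hjl, hjm⟩, ⟨hkl, hkm⟩, hlm⟩ := hne
    obtain ⟨r, hr, hs⟩ := key [i, k, l, j, m, q] (by
        simp [hij, hik, hil, him, hjm, hkl, hkm, hlm, hjk.symm, hjl.symm, hqi.symm, hqj.symm,
          hqk.symm, hql.symm, hqm.symm])
      [-v i, (ε : ℤ) • v k, (η : ℤ) • v l, -v j, (ε' : ℤ) • v m, (η' : ℤ) • v q]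
      (.cons (Or.inr rfl) (.cons (units_smul_eq_or _ _) (.cons (units_smul_eq_or _ _)
        (.cons (Or.inr rfl) (.cons (units_smul_eq_or _ _) (.cons (units_smul_eq_or _ _) .nil))))))
    refine ⟨_, ⟨hr, Or.inr ⟨_, _, _, _, _, _, r, rfl, ?_, ?_⟩⟩, hs⟩
    · rw [h₁]
      abel
    · rw [h₂]
      abel

end GeneratingTuples

section Transfer

open Alt

variable {n N : ℕ} {P : (Fin N → (Fin n → ℤ)) → Prop} {Q : List (Fin n → ℤ) → Prop}

/-- The map from the free group on tuples to alternating symbols. -/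
noncomputable def freeToAlt (P : (Fin N → (Fin n → ℤ)) → Prop) :
    FreeAbelianGroup {v : Fin N → (Fin n → ℤ) // P v} →+ Alt (Fin n → ℤ) :=
  FreeAbelianGroup.lift fun a => sy (List.ofFn a.1)

@[simp] theorem freeToAlt_of (a : {v : Fin N → (Fin n → ℤ) // P v}) :
    freeToAlt P (FreeAbelianGroup.of a) = sy (List.ofFn a.1) := by
  simp [freeToAlt]

theorem freeToAlt_eq_zero {x} (hx : x ∈ Rels n N P) : freeToAlt P x = 0 := by
  suffices h : Rels n N P ≤ (freeToAlt P).ker from h hx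
  refine (AddSubgroup.closure_le _).2 ?_
  rintro _ (⟨a, b, σ, h, rfl⟩ | ⟨a, b, ε, h, rfl⟩)
  · have hb : b.1 = a.1 ∘ σ := funext h
    rw [SetLike.mem_coe, AddMonoidHom.mem_ker, map_sub, map_zsmul, freeToAlt_of, freeToAlt_of, hb,
      sy_ofFn_comp_perm, smul_smul, ← Units.val_mul, Int.units_mul_self, Units.val_one, one_smul,
      sub_self]
  · have hb : b.1 = fun t => ((ε t : ℤˣ) : ℤ) • a.1 t := funext h
    rw [SetLike.mem_coe, AddMonoidHom.mem_ker, map_sub, freeToAlt_of, freeToAlt_of, hb,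
      sy_forall₂ (forall₂_ofFn_smul ε a.1), sub_self]

/-- The map from the quotient on tuples satisfying `P` to alternating symbols. -/
noncomputable def toAlt (P : (Fin N → (Fin n → ℤ)) → Prop) :
    FreeAbelianGroup {v : Fin N → (Fin n → ℤ) // P v} ⧸ Rels n N P →+ Alt (Fin n → ℤ) :=
  QuotientAddGroup.lift (Rels n N P) (freeToAlt P) fun _ => freeToAlt_eq_zero

@[simp] theorem toAlt_mk (x : FreeAbelianGroup {v : Fin N → (Fin n → ℤ) // P v}) :
    toAlt P (QuotientAddGroup.mk' (Rels n N P) x) = freeToAlt P x := rfl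

/-- The class of a tuple, zero if it does not satisfy `P`. -/
noncomputable def symbol (P : (Fin N → (Fin n → ℤ)) → Prop) (a : Fin N → (Fin n → ℤ)) :
    FreeAbelianGroup {v : Fin N → (Fin n → ℤ) // P v} ⧸ Rels n N P :=
  if h : P a then QuotientAddGroup.mk' (Rels n N P) (FreeAbelianGroup.of ⟨a, h⟩) else 0

theorem symbol_of_pos {a : Fin N → (Fin n → ℤ)} (h : P a) :
    symbol P a = QuotientAddGroup.mk' (Rels n N P) (FreeAbelianGroup.of ⟨a, h⟩) := dif_pos h

theorem symbol_of_neg {a : Fin N → (Fin n → ℤ)} (h : ¬ P a) : symbol P a = 0 := dif_neg h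

/-- The tuples satisfying `P` are those whose list of entries satisfies `Q`, a condition which
depends only on the lines spanned by the entries and excludes repetitions. -/
structure IsSymbolPred (P : (Fin N → (Fin n → ℤ)) → Prop) (Q : List (Fin n → ℤ) → Prop) : Prop where
  iff (a : Fin N → (Fin n → ℤ)) : P a ↔ Q (List.ofFn a)
  perm {l l' : List (Fin n → ℤ)} (h : l.Perm l') : Q l → Q l'
  forall₂ {l l' : List (Fin n → ℤ)} (h : List.Forall₂ (fun a b => b = a ∨ b = -a) l l') : Q l → Q l'
  dup (x : Fin n → ℤ) (r : List (Fin n → ℤ)) (h : r.length + 2 = N) : ¬ Q (x :: x :: r)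

theorem symbol_comp_perm (hP : IsSymbolPred P Q) (σ : Equiv.Perm (Fin N))
    (a : Fin N → (Fin n → ℤ)) :
    symbol P (a ∘ σ) = ((Equiv.Perm.sign σ : ℤˣ) : ℤ) • symbol P a := by
  by_cases h : P a
  · have h' : P (a ∘ σ) :=
      (hP.iff _).2 (hP.perm (Equiv.Perm.ofFn_comp_perm σ a).symm ((hP.iff _).1 h))
    have key : symbol P a - ((Equiv.Perm.sign σ : ℤˣ) : ℤ) • symbol P (a ∘ σ) = 0 := by
      rw [symbol_of_pos h, symbol_of_pos h', ← map_zsmul, ← map_sub]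
      exact (QuotientAddGroup.eq_zero_iff _).2
        (AddSubgroup.subset_closure (Or.inl ⟨⟨a, h⟩, ⟨_, h'⟩, σ, fun _ => rfl, rfl⟩))
    rw [sub_eq_zero.1 key, smul_smul, ← Units.val_mul, Int.units_mul_self, Units.val_one, one_smul]
  · have h' : ¬ P (a ∘ σ) := fun h' =>
      h ((hP.iff _).2 (hP.perm (Equiv.Perm.ofFn_comp_perm σ a) ((hP.iff _).1 h')))
    rw [symbol_of_neg h, symbol_of_neg h', smul_zero]

theorem symbol_eq_of_forall₂ (hP : IsSymbolPred P Q) {a b : Fin N → (Fin n → ℤ)}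
    (hab : List.Forall₂ (fun a b => b = a ∨ b = -a) (List.ofFn a) (List.ofFn b)) :
    symbol P b = symbol P a := by
  have hab' : List.Forall₂ (fun a b => b = a ∨ b = -a) (List.ofFn b) (List.ofFn a) :=
    hab.flip.imp fun x y h => h.imp Eq.symm fun h => by rw [h, neg_neg]
  by_cases h : P a
  · have h' : P b := (hP.iff _).2 (hP.forall₂ hab ((hP.iff _).1 h))
    have hu : ∀ t, ∃ ε : ℤˣ, b t = (ε : ℤ) • a t := by
      intro t
      have := (List.forall₂_iff_get.1 hab).2 t (by simp) (by simp)
      simp only [List.get_ofFn] at this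
      rcases this with h | h
      · exact ⟨1, by simpa using h⟩
      · exact ⟨-1, by simpa using h⟩
    choose ε hε using hu
    rw [symbol_of_pos h, symbol_of_pos h', eq_comm, ← sub_eq_zero, ← map_sub]
    exact (QuotientAddGroup.eq_zero_iff _).2
      (AddSubgroup.subset_closure (Or.inr ⟨⟨a, h⟩, ⟨_, h'⟩, ε, hε, rfl⟩))
  · have h' : ¬ P b := fun h' => h ((hP.iff _).2 (hP.forall₂ hab' ((hP.iff _).1 h')))
    rw [symbol_of_neg h, symbol_of_neg h']

/-- The class of a list, zero if its length is not `N`. -/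
noncomputable def listSymbol (P : (Fin N → (Fin n → ℤ)) → Prop) (l : List (Fin n → ℤ)) :
    FreeAbelianGroup {v : Fin N → (Fin n → ℤ) // P v} ⧸ Rels n N P :=
  if h : l.length = N then symbol P (exists_ofFn_eq h).choose else 0

@[simp] theorem listSymbol_ofFn (a : Fin N → (Fin n → ℤ)) :
    listSymbol P (List.ofFn a) = symbol P a := by
  have h : (List.ofFn a).length = N := List.length_ofFn
  rw [listSymbol, dif_pos h, List.ofFn_injective (exists_ofFn_eq h).choose_spec]

theorem listSymbol_of_length_ne {l : List (Fin n → ℤ)} (h : l.length ≠ N) : listSymbol P l = 0 :=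
  dif_neg h

/-- The projection from alternating symbols to the quotient on tuples satisfying `P`. -/
noncomputable def ofAlt (hP : IsSymbolPred P Q) :
    Alt (Fin n → ℤ) →+ FreeAbelianGroup {v : Fin N → (Fin n → ℤ) // P v} ⧸ Rels n N P :=
  Alt.lift (listSymbol P)
    (fun l₁ x y l₂ => by
      by_cases h : (l₁ ++ x :: y :: l₂).length = N
      · obtain ⟨a, ha⟩ := exists_ofFn_eq h
        rw [← ofFn_comp_swap ha, ← ha, listSymbol_ofFn, listSymbol_ofFn, symbol_comp_perm hP,
          Equiv.Perm.sign_swap (by simp)]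
        simp
      · rw [listSymbol_of_length_ne h, listSymbol_of_length_ne (by simpa using h), neg_zero])
    (fun l₁ x l₂ => by
      by_cases h : (l₁ ++ x :: l₂).length = N
      · obtain ⟨a, ha⟩ := exists_ofFn_eq h
        obtain ⟨b, hb⟩ := exists_ofFn_eq (l := l₁ ++ (-x) :: l₂) (N := N) (by simpa using h)
        rw [← ha, ← hb, listSymbol_ofFn, listSymbol_ofFn]
        refine symbol_eq_of_forall₂ hP ?_
        rw [ha, hb]
        exact List.rel_append (R := fun a b : Fin n → ℤ => b = a ∨ b = -a)
          (List.forall₂_same.2 fun _ _ => Or.inl rfl)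
          (.cons (Or.inr rfl) (List.forall₂_same.2 fun _ _ => Or.inl rfl))
      · rw [listSymbol_of_length_ne h, listSymbol_of_length_ne (by simpa using h)])
    (fun l₁ x l₂ => by
      by_cases h : (l₁ ++ x :: x :: l₂).length = N
      · obtain ⟨a, ha⟩ := exists_ofFn_eq h
        rw [← ha, listSymbol_ofFn, symbol_of_neg]
        rw [hP.iff, ha]
        intro hQ
        have hp : (l₁ ++ x :: x :: l₂).Perm (x :: x :: (l₁ ++ l₂)) :=
          List.perm_middle.trans (List.perm_middle.cons x)
        exact hP.dup x (l₁ ++ l₂) (hp.length_eq.symm.trans h) (hP.perm hp hQ)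
      · exact listSymbol_of_length_ne h)

@[simp] theorem ofAlt_sy (hP : IsSymbolPred P Q) (l : List (Fin n → ℤ)) :
    ofAlt hP (sy l) = listSymbol P l := by
  simp [ofAlt]

theorem ofAlt_toAlt (hP : IsSymbolPred P Q)
    (x : FreeAbelianGroup {v : Fin N → (Fin n → ℤ) // P v} ⧸ Rels n N P) :
    ofAlt hP (toAlt P x) = x := by
  obtain ⟨x, rfl⟩ := QuotientAddGroup.mk'_surjective _ x
  rw [toAlt_mk]
  induction x using FreeAbelianGroup.induction_on with
  | zero => simp
  | of a => rw [freeToAlt_of, ofAlt_sy, listSymbol_ofFn, symbol_of_pos a.2]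
  | neg a h => rw [map_neg, map_neg, h, map_neg]
  | add x y hx hy => rw [map_add, map_add, hx, hy, map_add]

theorem ofAlt_eq_zero (hP : IsSymbolPred P Q) (hQ : ∀ l, Q l → Sp l) {x : Alt (Fin n → ℤ)}
    (hx : x ∈ NS (Fin n → ℤ)) : ofAlt hP x = 0 := by
  refine (symSub_le (K := (ofAlt hP).ker) fun l hl => ?_) hx
  rw [AddMonoidHom.mem_ker, ofAlt_sy]
  by_cases h : l.length = N
  · obtain ⟨a, rfl⟩ := exists_ofFn_eq h
    rw [listSymbol_ofFn]
    exact symbol_of_neg fun ha => hl (hQ _ ((hP.iff _).1 ha))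
  · exact listSymbol_of_length_ne h

theorem toAlt_ofAlt_sub_mem (hP : IsSymbolPred P Q) {K : AddSubgroup (Alt (Fin n → ℤ))}
    {L : List (Fin n → ℤ) → Prop} (hL : ∀ l, L l → l.length = N)
    (hK : ∀ l, L l → ¬ Q l → sy l ∈ K) {x : Alt (Fin n → ℤ)} (hx : x ∈ symSub L) :
    toAlt P (ofAlt hP x) - x ∈ K := by
  refine (symSub_le (K := K.comap ((toAlt P).comp (ofAlt hP) - AddMonoidHom.id _))
    fun l hl => ?_) hx
  obtain ⟨a, rfl⟩ := exists_ofFn_eq (hL l hl)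
  simp only [AddSubgroup.mem_comap, AddMonoidHom.sub_apply, AddMonoidHom.comp_apply,
    AddMonoidHom.id_apply, ofAlt_sy, listSymbol_ofFn]
  by_cases h : P a
  · rw [symbol_of_pos h, toAlt_mk, freeToAlt_of, sub_self]
    exact zero_mem _
  · rw [symbol_of_neg h, map_zero, zero_sub]
    exact neg_mem (hK _ hl fun h' => h ((hP.iff _).2 h'))

end Transfer

section Exactness

open Alt

variable (n : ℕ)

theorem isSymbolPred_gen0 : IsSymbolPred (Gen0 n) Sp where
  iff _ := gen0_iff
  perm h hl := hl.perm h
  forall₂ h hl := hl.forall₂ h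
  dup x r h hl := by
    have : Sp (x :: r) := hl.of_subset (by simp)
    have := this.le_length
    rw [List.length_cons] at this
    omega

theorem SRel.le_two_of_dup {x : Fin n → ℤ} {r : List (Fin n → ℤ)}
    (hsp : Sp (x :: x :: r)) (hr : r.length + 2 = n + 1) {k : ℕ} (h : SRel (x :: x :: r) k 0) :
    k ≤ 2 := by
  have key : ∀ (j : ℕ) (κ : ℤ), SRel (x :: r) j (κ • x) → j ≤ 1 := by
    intro j κ h
    by_contra! hj
    exact hj.ne' (SRel.unique (E := [x]) (k := 1) hsp (by simp; omega) (by simp) (by simp)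
      (by omega) h).1
  generalize hy : (0 : Fin n → ℤ) = y at h
  cases h with
  | skip _ h => exact (key _ 0 (by simpa [← hy] using h)).trans (by omega)
  | pos _ h =>
    have := key _ (-1) (by rwa [neg_one_smul, ← eq_neg_of_add_eq_zero_left hy.symm])
    omega
  | neg _ h =>
    have := key _ 1 (by rw [one_smul]; exact sub_eq_zero.1 hy.symm ▸ h)
    omega

theorem isSymbolPred_gen1 :
    IsSymbolPred (Gen1 n) fun l => Sp l ∧ (SRel l 3 0 ∨ SRel l 4 0) where
  iff _ := gen1_iff
  perm h hl := ⟨hl.1.perm h, hl.2.imp (SRel.perm h) (SRel.perm h)⟩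
  forall₂ h hl := ⟨hl.1.forall₂ h, hl.2.imp (fun h' => h'.forall₂ h) fun h' => h'.forall₂ h⟩
  dup x r h hl := by
    rcases hl.2 with h' | h' <;> have := h'.le_two_of_dup n hl.1 h <;> omega

theorem d1_eq (x) : d1 n x = ofAlt (isSymbolPred_gen0 n) (bd (freeToAlt (Gen1 n) x)) := by
  suffices h : d1 n = (ofAlt (isSymbolPred_gen0 n)).comp (bd.comp (freeToAlt (Gen1 n))) from
    DFunLike.congr_fun h x
  refine FreeAbelianGroup.lift_ext _ _ fun a => ?_
  simp only [AddMonoidHom.comp_apply, freeToAlt_of, bd_sy_ofFn, map_sum, map_zsmul, ofAlt_sy,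
    listSymbol_ofFn]
  exact FreeAbelianGroup.lift_apply_of _ _

theorem d2_eq (x) : d2 n x = - ofAlt (isSymbolPred_gen1 n) (bd (freeToAlt (Gen2 n) x)) := by
  suffices h : d2 n = -(ofAlt (isSymbolPred_gen1 n)).comp (bd.comp (freeToAlt (Gen2 n))) from
    DFunLike.congr_fun h x
  refine FreeAbelianGroup.lift_ext _ _ fun a => ?_
  simp only [AddMonoidHom.neg_apply, AddMonoidHom.comp_apply, freeToAlt_of, bd_sy_ofFn, map_sum,
    map_zsmul, ofAlt_sy, listSymbol_ofFn, ← Finset.sum_neg_distrib, ← neg_smul]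
  refine (FreeAbelianGroup.lift_apply_of _ _).trans (Finset.sum_congr rfl fun i _ => ?_)
  rw [pow_succ, mul_neg_one]
  rfl

theorem freeToAlt_gen1_mem (x) : freeToAlt (Gen1 n) x ∈ symSub (IsG1 n) := by
  induction x using FreeAbelianGroup.induction_on with
  | zero => rw [map_zero]; exact zero_mem _
  | of a =>
    rw [freeToAlt_of]
    exact sy_mem_symSub ⟨List.length_ofFn, (gen1_iff.1 a.2).2⟩
  | neg a h => rw [map_neg]; exact neg_mem h
  | add x y hx hy => rw [map_add]; exact add_mem hx hy

theorem bd_freeToAlt_gen2_mem (x) :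
    bd (freeToAlt (Gen2 n) x) ∈ symSub (IsG1 n) ⊔ NS (Fin n → ℤ) := by
  induction x using FreeAbelianGroup.induction_on with
  | zero => rw [map_zero, map_zero]; exact zero_mem _
  | of a =>
    rw [freeToAlt_of]
    obtain ⟨l, hl, h⟩ := a.2.exists_isG2
    have := sup_le_sup_right (symSub_mono fun _ h => h.1) _
      (bd_mem_of_isG2 (B := Set.univ) hl fun _ _ => trivial)
    rcases h with h | h <;> rw [h]
    · exact this
    · rw [map_neg]
      exact neg_mem this
  | neg a h => rw [map_neg, map_neg]; exact neg_mem h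
  | add x y hx hy => rw [map_add, map_add]; exact add_mem hx hy

theorem bd_mem_symSub_length {N : ℕ} {x : Alt (Fin n → ℤ)}
    (hx : x ∈ symSub fun l : List (Fin n → ℤ) => l.length = N + 1) :
    bd x ∈ symSub fun l : List (Fin n → ℤ) => l.length = N := by
  refine (symSub_le (K := (symSub fun l => l.length = N).comap bd) fun l hl =>
    AddSubgroup.mem_comap.2 (bd_mem l _ ?_)) hx
  rintro l₁ a l₂ rfl
  refine sy_mem_symSub ?_
  simp only [List.length_append, List.length_cons] at hl ⊢
  omega

theorem toAlt_ofAlt_gen1_sub_mem {x : Alt (Fin n → ℤ)} (hx : x ∈ symSub (IsG1 n) ⊔ NS (Fin n → ℤ)) :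
    toAlt (Gen1 n) (ofAlt (isSymbolPred_gen1 n) x) - x ∈ NS (Fin n → ℤ) := by
  obtain ⟨y, hy, z, hz, rfl⟩ := AddSubgroup.mem_sup.1 hx
  rw [map_add, ofAlt_eq_zero _ (fun _ h => h.1) hz, add_zero, ← sub_sub]
  exact sub_mem (toAlt_ofAlt_sub_mem (isSymbolPred_gen1 n) (fun _ h => h.1)
    (fun l hl hQ => sy_mem_symSub fun h => hQ ⟨h, hl.2⟩) hy) hz

theorem d1_eq_zero {x} (hx : x ∈ Rels n (n + 1) (Gen1 n)) : d1 n x = 0 := by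
  rw [d1_eq, freeToAlt_eq_zero hx, map_zero, map_zero]

theorem d2_eq_zero {x} (hx : x ∈ Rels n (n + 2) (Gen2 n)) : d2 n x = 0 := by
  rw [d2_eq, freeToAlt_eq_zero hx, map_zero, map_zero, neg_zero]

theorem ofAlt_bd_mem_range_d2 {w : Alt (Fin n → ℤ)} (hw : w ∈ symSub (IsG2 n)) :
    ofAlt (isSymbolPred_gen1 n) (bd w) ∈ (d2 n).range := by
  refine (symSub_le (K := (d2 n).range.comap ((ofAlt (isSymbolPred_gen1 n)).comp bd))
    fun l hl => ?_) hw
  rw [AddSubgroup.mem_comap, AddMonoidHom.comp_apply]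
  by_cases hsp : Sp l
  · obtain ⟨a, rfl⟩ := exists_ofFn_eq hl.1
    refine ⟨-FreeAbelianGroup.of ⟨a, gen2_of_isG2 hsp hl⟩, ?_⟩
    rw [map_neg, d2_eq, freeToAlt_of, neg_neg]
  · rw [ofAlt_eq_zero _ (fun _ h => h.1) (bd_mem_NS (sy_mem_symSub hsp))]
    exact zero_mem _

theorem d1_eq_zero_iff (x) : d1 n x = 0 ↔ bd (freeToAlt (Gen1 n) x) ∈ NS (Fin n → ℤ) := by
  rw [d1_eq]
  refine ⟨fun h => ?_, ofAlt_eq_zero _ fun _ h => h⟩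
  have := toAlt_ofAlt_sub_mem (isSymbolPred_gen0 n) (fun _ h => h)
    (fun l _ hQ => sy_mem_symSub (P := fun l => ¬ Sp l) hQ)
    (bd_mem_symSub_length n (symSub_mono (fun _ h => h.1) (freeToAlt_gen1_mem n x)))
  rw [h, map_zero, zero_sub] at this
  exact neg_mem_iff.1 this

end Exactness

/-- **Theorem A, degree 2 part.**  For `n ≥ 3`, the maps `δ₁` and `δ₂` descend to
the quotients `M₁` and `M₂` (they kill the permutation and sign relations), and the
resulting sequence `M₂ → M₁ → M₀` is exact at `M₁`: the kernel of `δ₁` is the image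
of `δ₂`. -/
theorem steinberg_relations_among_relations (n : ℕ) (hn : 3 ≤ n) :
    ∃ (h1 : ∀ x ∈ Rels n (n + 1) (Gen1 n), d1 n x = 0)
      (h2 : ∀ x ∈ Rels n (n + 2) (Gen2 n), d2 n x = 0),
      Function.Exact
        (⇑(QuotientAddGroup.lift (Rels n (n + 2) (Gen2 n)) (d2 n) h2))
        (⇑(QuotientAddGroup.lift (Rels n (n + 1) (Gen1 n)) (d1 n) h1)) := by
  refine ⟨fun _ => d1_eq_zero n, fun _ => d2_eq_zero n, fun y => ?_⟩
  obtain ⟨x, rfl⟩ := QuotientAddGroup.mk'_surjective _ y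
  have hx : freeToAlt (Gen1 n) x = toAlt (Gen1 n) (QuotientAddGroup.mk' _ x) := rfl
  refine (d1_eq_zero_iff n x).trans ⟨fun h => ?_, ?_⟩
  · obtain ⟨_, ⟨w, hw, rfl⟩, e, he, h⟩ := AddSubgroup.mem_sup.1
      (mem_map_bd_of_bd_mem_NS n _ (freeToAlt_gen1_mem n x) h)
    obtain ⟨z, hz⟩ := ofAlt_bd_mem_range_d2 n hw
    refine ⟨QuotientAddGroup.mk' _ z, hz.trans ?_⟩
    rw [← ofAlt_toAlt (isSymbolPred_gen1 n) (QuotientAddGroup.mk' _ x), ← hx, ← h, map_add,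
      ofAlt_eq_zero _ (fun _ h => h.1) he, add_zero]
  · rintro ⟨z, hz⟩
    obtain ⟨z, rfl⟩ := QuotientAddGroup.mk'_surjective _ z
    replace hz : d2 n z = QuotientAddGroup.mk' _ x := hz
    have := bd_mem_NS (toAlt_ofAlt_gen1_sub_mem n (bd_freeToAlt_gen2_mem n z))
    rw [map_sub, Alt.bd_bd, sub_zero, ← neg_mem_iff, ← map_neg, ← map_neg, ← d2_eq, hz,
      ← hx] at this
    exact this
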